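/- Every planar graph has a planar (possibly non-smooth) 2-Lombardi drawing, and consequently every planar graph has a planar smooth 3-Lombardi drawing. -/

import Mathlib

open Set

noncomputable section

/-- A `Piece` is a parameterized circular arc or line segment in the plane `ℂ`. -/
inductive Piece : Type
  | arc (c : ℂ) (r θ₀ θ₁ : ℝ) : Piece
  | seg (p q : ℂ) : Piece

namespace Piece

/-- The parameterization of a piece over `[0,1]`. -/
def toFun : Piece → ℝ → ℂ
  | arc c r θ₀ θ₁, t => c + (r : ℂ) * Complex.exp (Complex.I * ((θ₀ + t * (θ₁ - θ₀) : ℝ) : ℂ))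
  | seg p q, t => p + (t : ℂ) * (q - p)

/-- Nondegeneracy: the parameterization has nonvanishing velocity. -/
def Nondeg : Piece → Prop
  | arc _ r θ₀ θ₁ => r ≠ 0 ∧ θ₀ ≠ θ₁
  | seg p q => p ≠ q

end Piece

/-- The direction of a vector, as an angle modulo `2π`. -/
def dirAngle (z : ℂ) : Real.Angle := (Complex.arg z : Real.Angle)

/-- `γ`, restricted to `[s,t]`, is an affine reparameterization of a single
nondegenerate circular arc or line segment. -/
def IsArcOn (γ : ℝ → ℂ) (s t : ℝ) : Prop :=
  ∃ P : Piece, P.Nondeg ∧ ∀ u ∈ Set.Icc (0 : ℝ) 1, γ (s + u * (t - s)) = P.toFun u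

/-- The curve `γ : [0,1] → ℂ` consists of at most `k` circular arcs (or segments). -/
def PolyArc (k : ℕ) (γ : ℝ → ℂ) : Prop :=
  ∃ m : ℕ, 0 < m ∧ m ≤ k ∧ ∃ f : ℕ → ℝ, f 0 = 0 ∧ f m = 1 ∧
    (∀ i < m, f i < f (i + 1)) ∧ ∀ i < m, IsArcOn γ (f i) (f (i + 1))

/-- A drawing of a simple graph in the plane: vertices go to distinct points, each edge is a
simple continuous curve between the points of its endpoints (traversed consistently in both
directions), and no edge passes through a vertex other than its endpoints. -/
structure GraphDrawing (V : Type*) (G : SimpleGraph V) where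
  pos : V → ℂ
  inj : Function.Injective pos
  curve : ∀ ⦃u v : V⦄, G.Adj u v → ℝ → ℂ
  cont : ∀ ⦃u v : V⦄ (h : G.Adj u v), ContinuousOn (curve h) (Set.Icc 0 1)
  source_eq : ∀ ⦃u v : V⦄ (h : G.Adj u v), curve h 0 = pos u
  target_eq : ∀ ⦃u v : V⦄ (h : G.Adj u v), curve h 1 = pos v
  symm : ∀ ⦃u v : V⦄ (h : G.Adj u v) (t : ℝ), curve h.symm t = curve h (1 - t)
  simple : ∀ ⦃u v : V⦄ (h : G.Adj u v), Set.InjOn (curve h) (Set.Icc 0 1)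
  vertexFree : ∀ ⦃u v : V⦄ (h : G.Adj u v) (w : V),
    pos w ∈ curve h '' Set.Icc 0 1 → w = u ∨ w = v

namespace GraphDrawing

variable {V : Type*} {G : SimpleGraph V} (D : GraphDrawing V G)

/-- Every edge of the drawing is drawn with at most `k` circular arcs. -/
def KArc (k : ℕ) : Prop := ∀ ⦃u v : V⦄ (h : G.Adj u v), PolyArc k (D.curve h)

/-- Every edge curve is continuously differentiable with nonvanishing derivative
(no sharp bends). -/
def Smooth : Prop := ∀ ⦃u v : V⦄ (h : G.Adj u v),
  ContDiffOn ℝ 1 (D.curve h) (Set.Icc 0 1) ∧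
    ∀ t ∈ Set.Icc (0 : ℝ) 1, derivWithin (D.curve h) (Set.Icc 0 1) t ≠ 0

/-- Perfect angular resolution: at each vertex `v`, the tangent directions of the incident
edge curves at `v` are equally spaced around `v`. -/
def PerfectRes : Prop := ∀ v : V,
  ∃ (θ : ℝ) (e : {u // G.Adj v u} ≃ Fin (Nat.card {u // G.Adj v u})),
    ∀ (u : V) (h : G.Adj v u), ∃ d : ℂ, d ≠ 0 ∧
      HasDerivWithinAt (D.curve h) d (Set.Icc 0 1) 0 ∧
      dirAngle d =
        ((θ + 2 * Real.pi * ((e ⟨u, h⟩ : Fin _) : ℕ) /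
            (Nat.card {u // G.Adj v u}) : ℝ) : Real.Angle)

/-- The drawing is planar (crossing-free): two distinct edges meet only at
common endpoints. -/
def NonCrossing : Prop := ∀ ⦃u v u' v' : V⦄ (h : G.Adj u v) (h' : G.Adj u' v'),
  s(u, v) ≠ s(u', v') →
    (D.curve h '' Set.Icc 0 1) ∩ (D.curve h' '' Set.Icc 0 1) ⊆
      ({D.pos u, D.pos v} ∩ {D.pos u', D.pos v'} : Set ℂ)

end GraphDrawing

/-- `G` has a Lombardi drawing: a drawing with one circular arc (or segment) per edge and
perfect angular resolution at every vertex. -/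
def HasLombardi (V : Type*) (G : SimpleGraph V) : Prop :=
  ∃ D : GraphDrawing V G, D.KArc 1 ∧ D.PerfectRes

section
/-- cohomological planarity of a combinatorial map; fixed points of `α` are dead darts -/
def PlanarMap {D : Type} (σ : Equiv.Perm D) (α : D → D) : Prop :=
  ∀ (A : Type) [AddCommGroup A] (g h : D → A), (∀ d, α d = d → g d = 0) →
    (∀ d, g (α d) = - g d) → (∀ d, g d = h (σ (α d)) - h d) →
    ∃ p : D → A, (∀ d, p (σ d) = p d) ∧ ∀ d, g d = p (α d) - p d

theorem PlanarMap.delete {D : Type} {σ : Equiv.Perm D} {α α' : D → D} (hP : PlanarMap σ α)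
    (hα : ∀ d, α (α d) = d) (hα' : ∀ d, α' (α' d) = d) (hsub : ∀ d, α' d = d ∨ α' d = α d) :
    PlanarMap σ α' := by
  intro A _ g h h0 h1 h2
  have key : ∀ d, α' d = d → α' (α d) = α d := by
    intro d hd
    rcases hsub (α d) with h | h
    · exact h
    · rw [hα] at h
      have := hα' (α d)
      rw [h, hd] at this
      rw [← this]; exact hd
  have kill : ∀ d, α' d = d → h (σ d) = h d := by
    intro d hd
    have := h2 d
    rw [h0 d hd, hd] at this
    exact (sub_eq_zero.mp this.symm)
  have live : ∀ d, α' d = α d → h (σ (α d)) - h d = g d := by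
    intro d hd; rw [h2 d, hd]
  have ex := hP A (fun d => h (σ (α d)) - h d) h ?_ ?_ (fun d => rfl)
  · obtain ⟨p, hp, hp2⟩ := ex
    refine ⟨p, hp, fun d => ?_⟩
    rcases hsub d with hd | hd
    · rw [h0 d hd, hd, sub_self]
    · rw [hd, ← hp2 d, live d hd]
  · intro d hd
    rcases hsub d with h | h
    · rw [hd, kill d h, sub_self]
    · rw [live d h]; exact h0 d (h.trans hd)
  · intro d
    rcases hsub d with hd | hd
    · rw [hα, kill d hd, kill _ (key d hd)]; abel
    · have h3 : α' (α d) = α (α d) := by rw [← hd, hα', hd, hα]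
      rw [live d hd, live _ h3, ← h1 d, hd]

theorem PlanarMap.contract {D : Type} [DecidableEq D] {σ : Equiv.Perm D} {α α' : D → D}
    (hP : PlanarMap σ α)
    (hα : ∀ d, α (α d) = d) (x : D) (hx : α x ≠ x)
    (h1 : ∀ d, d ≠ x → d ≠ α x → α' d = α d) (h2 : α' x = x) (h3 : α' (α x) = α x) :
    PlanarMap (σ * Equiv.swap x (α x)) α' := by
  intro A _ g h g0 g1 g2
  have hφ : ∀ d, (σ * Equiv.swap x (α x)) (α' d) = σ (α d) := by
    intro d
    by_cases hd : d = x
    · subst hd; rw [h2]; simp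
    by_cases hd' : d = α x
    · subst hd'; rw [h3, hα]; simp
    · rw [h1 d hd hd', Equiv.Perm.mul_apply, Equiv.swap_apply_of_ne_of_ne]
      · intro h; apply hd'; rw [← h, hα]
      · intro h; apply hd; rw [← hα d, h, hα]
  have gx := g0 x h2
  have gx' := g0 _ h3
  have ex := hP A g h ?_ ?_ ?_
  · obtain ⟨p, hp, hp2⟩ := ex
    have hpx : p (α x) = p x := by
      have := hp2 x; rw [gx] at this; exact sub_eq_zero.mp this.symm
    refine ⟨p, fun d => ?_, fun d => ?_⟩
    · rw [Equiv.Perm.mul_apply, hp]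
      by_cases hd : d = x
      · subst hd; simp [hpx]
      by_cases hd' : d = α x
      · subst hd'; simp [hpx]
      rw [Equiv.swap_apply_of_ne_of_ne hd hd']
    · by_cases hd : d = x
      · subst hd; simp [gx, h2]
      by_cases hd' : d = α x
      · subst hd'; simp [gx', h3]
      rw [hp2 d, h1 d hd hd']
  · intro d hd
    by_cases hd' : d = x
    · subst hd'; exact gx
    by_cases hd'' : d = α x
    · subst hd''; exact gx'
    exact g0 d ((h1 d hd' hd'').trans hd)
  · intro d
    by_cases hd' : d = x
    · subst hd'; rw [gx, gx', neg_zero]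
    by_cases hd'' : d = α x
    · subst hd''; rw [hα, gx, gx', neg_zero]
    rw [← h1 d hd' hd'', g1]
  · intro d; rw [g2 d, hφ]

theorem sameCycle_mul_swap {D : Type} [DecidableEq D] [Finite D] (σ : Equiv.Perm D) (d e : D)
    (h : ¬ σ.SameCycle d e) : (σ * Equiv.swap d e).SameCycle d e := by
  by_contra hS
  set τ := σ * Equiv.swap d e with hτ
  let A : Set D := {x | x = e ∨ (τ.SameCycle d x ∧ σ.SameCycle e x)}
  have hde : τ d = σ e := by simp [hτ]
  have hmap : ∀ x ∈ A, τ.SameCycle d (σ x) ∧ σ.SameCycle e (σ x) := by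
    rintro x (rfl | ⟨h1, h2⟩)
    · rw [← hde]
      refine ⟨Equiv.Perm.sameCycle_apply_right.mpr (Equiv.Perm.SameCycle.refl _ _), ?_⟩
      rw [hde]
      exact Equiv.Perm.sameCycle_apply_right.mpr (Equiv.Perm.SameCycle.refl _ _)
    · refine ⟨?_, Equiv.Perm.sameCycle_apply_right.mpr h2⟩
      have hxd : x ≠ d := by rintro rfl; exact h h2.symm
      have hxe : x ≠ e := by rintro rfl; exact hS h1
      have : σ x = τ x := by rw [hτ, Equiv.Perm.mul_apply, Equiv.swap_apply_of_ne_of_ne hxd hxe]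
      rw [this]; exact Equiv.Perm.sameCycle_apply_right.mpr h1
  let f : A → A := fun x => ⟨σ x, Or.inr (hmap x x.2)⟩
  have hf : Function.Injective f := by
    intro x y hxy
    have := congrArg Subtype.val hxy
    exact Subtype.ext (σ.injective this)
  obtain ⟨x, hx⟩ := Finite.surjective_of_injective hf ⟨e, Or.inl rfl⟩
  have h1 : σ x = e := congrArg Subtype.val hx
  have := (hmap x x.2).1
  rw [h1] at this
  exact hS this

theorem closed_sameCycle {D : Type} [Finite D] (σ : Equiv.Perm D) (S : Set D)
    (hS : ∀ d ∈ S, σ d ∈ S) {d e : D} (h : σ.SameCycle d e) (hd : d ∈ S) : e ∈ S := by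
  obtain ⟨n, -, hn⟩ := h.exists_pow_eq'
  rw [← hn]
  clear hn
  induction n with
  | zero => simpa
  | succ n ih => rw [pow_succ', Equiv.Perm.mul_apply]; exact hS _ ih

/-- contracting all edges inside labels -/
theorem contract_labels {D L : Type} [Finite D] (ℓ : D → L) (n : ℕ) :
    ∀ (σ : Equiv.Perm D) (α : D → D), PlanarMap σ α → (∀ d, α (α d) = d) →
      (∀ d, ℓ (σ d) = ℓ d) →
      (∀ S : Set D, (∀ d ∈ S, σ d ∈ S) → (∀ d ∈ S, ℓ (α d) = ℓ d → α d ∈ S) →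
        ∀ d ∈ S, ∀ e, ℓ e = ℓ d → e ∈ S) →
      {d | α d ≠ d ∧ ℓ (α d) = ℓ d}.ncard ≤ n →
      ∃ (σ' : Equiv.Perm D) (α' : D → D), PlanarMap σ' α' ∧ (∀ d, α' (α' d) = d) ∧
        (∀ d e, σ'.SameCycle d e ↔ ℓ d = ℓ e) ∧ (∀ d, ℓ (α d) ≠ ℓ d → α' d = α d) ∧
        (∀ d, ℓ (α d) = ℓ d → α' d = d) := by
  classical
  induction n with
  | zero =>
    intro σ α hP hα hℓ hS hc
    have h0 : {d | α d ≠ d ∧ ℓ (α d) = ℓ d} = ∅ := by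
      rw [← Set.ncard_eq_zero]; omega
    refine ⟨σ, α, hP, hα, fun d e => ⟨fun h => ?_, fun h => ?_⟩, fun d _ => rfl, fun d hd => ?_⟩
    · have := closed_sameCycle σ {x | ℓ x = ℓ d} (fun x hx => by
        simp only [mem_ofPred_eq] at *; rw [hℓ, hx]) h rfl
      exact this.symm
    · refine hS {x | σ.SameCycle d x} ?_ ?_ d (Equiv.Perm.SameCycle.refl _ _) e h.symm
      · intro x hx; exact Equiv.Perm.sameCycle_apply_right.mpr hx
      · intro x hx h
        by_cases hxx : α x = x
        · rw [hxx]; exact hx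
        · have : x ∈ {d | α d ≠ d ∧ ℓ (α d) = ℓ d} := ⟨hxx, h⟩
          rw [h0] at this; exact this.elim
    · by_contra hxx
      have : d ∈ {d | α d ≠ d ∧ ℓ (α d) = ℓ d} := ⟨hxx, hd⟩
      rw [h0] at this; exact this.elim
  | succ n ih =>
    intro σ α hP hα hℓ hS hc
    by_cases hne : ∃ x, α x ≠ x ∧ ℓ (α x) = ℓ x
    swap
    · have h0 : {d | α d ≠ d ∧ ℓ (α d) = ℓ d} = ∅ := by
        ext d; simp only [mem_ofPred_eq, mem_empty_iff_false, iff_false]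
        exact fun h => hne ⟨d, h⟩
      exact ih σ α hP hα hℓ hS (by rw [h0]; simp)
    obtain ⟨x, hx, hxl⟩ := hne
    let α' : D → D := fun d => if d = x ∨ d = α x then d else α d
    have a1 : ∀ d, d ≠ x → d ≠ α x → α' d = α d := by
      intro d h1 h2; simp [α', h1, h2]
    have a2 : α' x = x := by simp [α']
    have a3 : α' (α x) = α x := by simp [α']
    have hαne : ∀ d, d ≠ x → d ≠ α x → α d ≠ x ∧ α d ≠ α x := by
      intro d h1 h2
      refine ⟨fun h => h2 ?_, fun h => h1 ?_⟩
      · rw [← h, hα]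
      · rw [← hα d, h, hα]
    have a4 : ∀ d, α' (α' d) = d := by
      intro d
      by_cases hd : d = x
      · subst hd; rw [a2, a2]
      by_cases hd' : d = α x
      · subst hd'; rw [a3, a3]
      rw [a1 d hd hd', a1 _ (hαne d hd hd').1 (hαne d hd hd').2, hα]
    have hcard : {d | α' d ≠ d ∧ ℓ (α' d) = ℓ d}.ncard ≤ n := by
      have : {d | α' d ≠ d ∧ ℓ (α' d) = ℓ d} ⊂ {d | α d ≠ d ∧ ℓ (α d) = ℓ d} := by
        refine ⟨?_, fun h => (h (show x ∈ _ from ⟨hx, hxl⟩)).1 a2⟩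
        rintro d ⟨h1, h2⟩
        by_cases hd : d = x
        · subst hd; exact (h1 a2).elim
        by_cases hd' : d = α x
        · subst hd'; exact (h1 a3).elim
        rw [a1 d hd hd'] at h1 h2
        exact ⟨h1, h2⟩
      have := Set.ncard_lt_ncard this (Set.toFinite _)
      omega
    have fin : ∀ σ' : Equiv.Perm D, PlanarMap σ' α' → (∀ d, ℓ (σ' d) = ℓ d) →
        (∀ S : Set D, (∀ d ∈ S, σ' d ∈ S) → (∀ d ∈ S, ℓ (α' d) = ℓ d → α' d ∈ S) →
          (∀ d ∈ S, σ d ∈ S) ∧ (x ∈ S → α x ∈ S) ∧ (α x ∈ S → x ∈ S)) →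
        ∃ (σ' : Equiv.Perm D) (α' : D → D), PlanarMap σ' α' ∧ (∀ d, α' (α' d) = d) ∧
        (∀ d e, σ'.SameCycle d e ↔ ℓ d = ℓ e) ∧ (∀ d, ℓ (α d) ≠ ℓ d → α' d = α d) ∧
        (∀ d, ℓ (α d) = ℓ d → α' d = d) := by
      intro σ' hP' hl hSS
      have ex := ih σ' α' hP' a4 hl ?_ hcard
      · obtain ⟨σ'', α'', b1, b2, b3, b4, b5⟩ := ex
        refine ⟨σ'', α'', b1, b2, b3, fun d hd => ?_, fun d hd => ?_⟩
        · by_cases hd1 : d = x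
          · subst hd1; exact (hd hxl).elim
          by_cases hd' : d = α x
          · subst hd'; rw [hα] at hd; exact (hd hxl.symm).elim
          have := b4 d; rw [a1 d hd1 hd'] at this
          exact this hd
        · by_cases hd1 : d = x
          · subst hd1; exact b5 _ (by rw [a2])
          by_cases hd' : d = α x
          · subst hd'; exact b5 _ (by rw [a3])
          have := b5 d; rw [a1 d hd1 hd'] at this
          exact this hd
      · intro S s1 s2
        obtain ⟨t1, t2, t3⟩ := hSS S s1 s2
        refine hS S t1 ?_
        intro d hd hdl
        by_cases hd1 : d = x
        · subst hd1; exact t2 hd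
        by_cases hd' : d = α x
        · subst hd'; rw [hα]; exact t3 hd
        have := s2 d hd; rw [a1 d hd1 hd'] at this
        exact this hdl
    by_cases hsc : σ.SameCycle x (α x)
    · refine fin σ (hP.delete hα a4 ?_) hℓ ?_
      · intro d
        by_cases hd : d = x
        · subst hd; exact Or.inl a2
        by_cases hd' : d = α x
        · subst hd'; exact Or.inl a3
        exact Or.inr (a1 d hd hd')
      · intro S s1 s2
        exact ⟨s1, fun h => closed_sameCycle σ S s1 hsc h,
          fun h => closed_sameCycle σ S s1 hsc.symm h⟩
    · have hsc' := sameCycle_mul_swap σ _ _ hsc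
      refine fin (σ * Equiv.swap x (α x)) (hP.contract hα x hx a1 a2 a3) ?_ ?_
      · intro d
        rw [Equiv.Perm.mul_apply, hℓ]
        by_cases hd : d = x
        · subst hd; simp [hxl]
        by_cases hd' : d = α x
        · subst hd'; simp [hxl]
        rw [Equiv.swap_apply_of_ne_of_ne hd hd']
      · intro S s1 s2
        have t2 := fun h => closed_sameCycle _ S s1 hsc' h
        have t3 := fun h => closed_sameCycle _ S s1 hsc'.symm h
        refine ⟨fun d hd => ?_, t2, t3⟩
        have e1 : σ d = (σ * Equiv.swap x (α x)) (Equiv.swap x (α x) d) := by simp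
        rw [e1]
        apply s1
        by_cases hd1 : d = x
        · subst hd1; simpa using t2 hd
        by_cases hd' : d = α x
        · subst hd'; simpa using t3 hd
        rwa [Equiv.swap_apply_of_ne_of_ne hd1 hd']

end

section
theorem PlanarMap.restrict {D D' : Type} {σ : Equiv.Perm D} {α : D → D} {σ' : Equiv.Perm D'}
    {α' : D' → D'} (hP : PlanarMap σ α) (hα : ∀ d, α (α d) = d) (ι : D' → D)
    (hι : Function.Injective ι) (h1 : ∀ d, σ (ι d) = ι (σ' d)) (h2 : ∀ d, α (ι d) = ι (α' d)) :
    PlanarMap σ' α' := by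
  intro A _ g h g0 g1 g2
  have out1 : ∀ d, d ∉ range ι → α d ∉ range ι := by
    rintro d hd ⟨e, he⟩
    exact hd ⟨α' e, by rw [← h2, he, hα]⟩
  have out2 : ∀ d, d ∉ range ι → σ d ∉ range ι := by
    rintro d hd ⟨e, he⟩
    apply hd
    refine ⟨σ'.symm e, σ.injective ?_⟩
    rw [h1, Equiv.apply_symm_apply, he]
  have ext : ∀ (f : D' → A) d, d ∉ range ι → Function.extend ι f 0 d = 0 := by
    intro f d hd
    rw [Function.extend_apply' _ _ _ (fun h => hd h)]; rfl
  have exi : ∀ (f : D' → A) d, Function.extend ι f 0 (ι d) = f d := fun f d => hι.extend_apply f 0 d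
  obtain ⟨p, hp, hp2⟩ := hP A (Function.extend ι g 0) (Function.extend ι h 0)
    (by
      intro d hd
      by_cases hr : d ∈ range ι
      · obtain ⟨e, rfl⟩ := hr
        rw [exi]; apply g0; apply hι; rw [← h2, hd]
      · exact ext _ _ hr)
    (by
      intro d
      by_cases hr : d ∈ range ι
      · obtain ⟨e, rfl⟩ := hr
        rw [h2, exi, exi, g1]
      · rw [ext _ _ hr, ext _ _ (out1 _ hr), neg_zero])
    (by
      intro d
      by_cases hr : d ∈ range ι
      · obtain ⟨e, rfl⟩ := hr
        rw [h2, h1, exi, exi, exi, g2]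
      · rw [ext _ _ hr, ext _ _ hr, ext _ _ (out2 _ (out1 _ hr)), sub_zero])
  refine ⟨p ∘ ι, fun d => ?_, fun d => ?_⟩
  · simp only [Function.comp]; rw [← h1, hp]
  · simp only [Function.comp]; rw [← h2, ← hp2, exi]

theorem int_integrate {A : Type} [AddCommGroup A] (f : ℤ → A) :
    ∃ F : ℤ → A, F 0 = 0 ∧ ∀ x, F (x + 1) = F x + f x := by
  refine ⟨fun x => match x with
    | Int.ofNat n => ∑ i ∈ Finset.range n, f i
    | Int.negSucc n => - ∑ i ∈ Finset.range (n + 1), f (-(i + 1 : ℤ)), by simp, fun x => ?_⟩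
  rcases x with n | n
  · have : (Int.ofNat n + 1 : ℤ) = Int.ofNat (n + 1) := rfl
    rw [this]
    simp [Finset.sum_range_succ]
  · rcases n with _ | n
    · have : (Int.negSucc 0 + 1 : ℤ) = Int.ofNat 0 := rfl
      rw [this]; simp
    · have : (Int.negSucc (n + 1) + 1 : ℤ) = Int.negSucc n := rfl
      rw [this]
      simp only [Finset.sum_range_succ _ (n + 1)]
      have : (Int.negSucc (n + 1) : ℤ) = -(((n + 1 : ℕ) : ℤ) + 1) := by
        rw [Int.negSucc_eq]
      rw [this]
      abel

def gridE (k : Fin 4) : ℤ × ℤ := ![(1, 0), (0, 1), (-1, 0), (0, -1)] k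

theorem gridE_opp (k : Fin 4) : gridE (k + 2) = - gridE k := by
  fin_cases k <;> rfl

def gridσ : Equiv.Perm ((ℤ × ℤ) × Fin 4) := Equiv.prodCongr (Equiv.refl _) (Equiv.addRight 1)

def gridα (d : (ℤ × ℤ) × Fin 4) : (ℤ × ℤ) × Fin 4 := (d.1 + gridE d.2, d.2 + 2)

theorem gridα_invol (d) : gridα (gridα d) = d := by
  rcases d with ⟨z, k⟩
  simp only [gridα, gridE_opp, add_assoc, Prod.mk.injEq]
  constructor
  · simp
  · fin_cases k <;> rfl

theorem grid_planar : PlanarMap gridσ gridα := by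
  intro A _ g h _ g1 g2
  have s : ∀ z k, gridσ (gridα (z, k)) = (z + gridE k, k + 3) := by
    intro z k
    simp only [gridσ, gridα, Equiv.prodCongr_apply, Prod.map, Equiv.refl_apply,
      Equiv.coe_addRight, Prod.mk.injEq, true_and]
    fin_cases k <;> rfl
  have g2' : ∀ z k, g (z, k) = h (z + gridE k, k + 3) - h (z, k) := by
    intro z k; rw [g2, s]
  have g1' : ∀ z k, g (z + gridE k, k + 2) = - g (z, k) := fun z k => g1 (z, k)
  set a : ℤ → ℤ → A := fun x y => g ((x, y), 0) with ha
  set b : ℤ → ℤ → A := fun x y => g ((x, y), 1) with hb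
  have compat : ∀ x y, a x y + b (x + 1) y = b x y + a x (y + 1) := by
    intro x y
    have e1 : g ((x, y + 1), 0) = h ((x + 1, y + 1), 3) - h ((x, y + 1), 0) := by
      have := g2' (x, y + 1) 0; simpa [gridE] using this
    have e2 : g ((x + 1, y + 1), 3) = h ((x + 1, y), 2) - h ((x + 1, y + 1), 3) := by
      have := g2' (x + 1, y + 1) 3; simpa [gridE] using this
    have e3 : g ((x + 1, y), 2) = h ((x, y), 1) - h ((x + 1, y), 2) := by
      have := g2' (x + 1, y) 2; simpa [gridE] using this
    have e4 : g ((x, y), 1) = h ((x, y + 1), 0) - h ((x, y), 1) := by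
      have := g2' (x, y) 1; simpa [gridE] using this
    have f1 : g ((x + 1, y + 1), 3) = - g ((x + 1, y), 1) := by
      have := g1' (x + 1, y) 1; simpa [gridE] using this
    have f2 : g ((x + 1, y), 2) = - g ((x, y), 0) := by
      have := g1' (x, y) 0; simpa [gridE] using this
    have z1 : g ((x, y + 1), 0) + g ((x + 1, y + 1), 3) + g ((x + 1, y), 2) + g ((x, y), 1) = 0 := by
      rw [e1, e2, e3, e4]; abel
    rw [f1, f2] at z1
    simp only [ha, hb]
    rw [← sub_eq_zero, ← neg_eq_zero, ← z1]; abel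
  obtain ⟨F, F0, F1⟩ := int_integrate (fun x => a x 0)
  choose B B0 B1 using fun x => int_integrate (fun y => b x y)
  have hx : ∀ x y, F (x + 1) + B (x + 1) y = F x + B x y + a x y := by
    intro x y
    induction y using Int.induction_on with
    | zero => rw [B0, B0, F1]; abel
    | succ n ih =>
      rw [B1, B1, ← add_assoc, ih]
      have := compat x n
      rw [add_assoc, this]; abel
    | pred n ih =>
      have c := compat x (-(n : ℤ) - 1)
      have c1 := B1 x (-(n : ℤ) - 1)
      have c2 := B1 (x + 1) (-(n : ℤ) - 1)
      rw [sub_add_cancel] at c c1 c2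
      rw [c1, c2] at ih
      have : F (x + 1) + B (x + 1) (-(n : ℤ) - 1) =
        F (x + 1) + (B (x + 1) (-(n : ℤ) - 1) + b (x + 1) (-(n : ℤ) - 1)) - b (x + 1) (-(n : ℤ) - 1) := by
        abel
      rw [this, ih]
      have c' : a x (-(n : ℤ)) = a x (-(n : ℤ) - 1) + b (x + 1) (-(n : ℤ) - 1) - b x (-(n : ℤ) - 1) := by
        rw [c]; abel
      rw [c']; abel
  have hy : ∀ x y, F x + B x (y + 1) = F x + B x y + b x y := by
    intro x y; rw [B1]; abel
  refine ⟨fun d => F d.1.1 + B d.1.1 d.1.2, fun d => rfl, ?_⟩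
  have p0 : ∀ x y, g ((x, y), 0) = F (x + 1) + B (x + 1) y - (F x + B x y) := by
    intro x y; rw [hx]; simp [ha]
  have p1 : ∀ x y, g ((x, y), 1) = F x + B x (y + 1) - (F x + B x y) := by
    intro x y; rw [hy]; simp [hb]
  rintro ⟨⟨x, y⟩, k⟩
  fin_cases k
  · simpa [gridα, gridE] using p0 x y
  · simpa [gridα, gridE] using p1 x y
  · have f2 : g ((x, y), 2) = - g ((x - 1, y), 0) := by
      have := g1' (x - 1, y) 0; simpa [gridE] using this
    have := p0 (x - 1) y
    simp only [gridα, gridE]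
    simp at *
    rw [f2, this, ← sub_eq_add_neg x 1]
    simp
  · have f2 : g ((x, y), 3) = - g ((x, y - 1), 1) := by
      have := g1' (x, y - 1) 1; simpa [gridE] using this
    have := p1 x (y - 1)
    simp only [gridα, gridE]
    simp at *
    rw [f2, this, ← sub_eq_add_neg y 1]
    simp

end

section
open Classical in
theorem PlanarMap.pendant {D : Type} {σ : Equiv.Perm D} {α : D → D} (hP : PlanarMap σ α)
    (hα : ∀ d, α (α d) = d) :
    ∃ α' : D ⊕ {d // α d = d} → D ⊕ {d // α d = d},
      PlanarMap (Equiv.sumCongr σ (Equiv.refl _)) α' ∧ (∀ d, α' (α' d) = d) ∧ (∀ d, α' d ≠ d) ∧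
      (∀ d, α d ≠ d → α' (Sum.inl d) = Sum.inl (α d)) ∧
      (∀ d, α' (Sum.inr d) = Sum.inl d.1) ∧ (∀ d, α' (Sum.inl d.1) = Sum.inr d) := by
  let α' : D ⊕ {d // α d = d} → D ⊕ {d // α d = d} := fun x =>
    match x with
    | Sum.inl d => if h : α d = d then Sum.inr ⟨d, h⟩ else Sum.inl (α d)
    | Sum.inr d => Sum.inl d.1
  have a1 : ∀ d, α d ≠ d → α' (Sum.inl d) = Sum.inl (α d) := by
    intro d hd; simp [α', hd]
  have a2 : ∀ d, α' (Sum.inr d) = Sum.inl d.1 := fun d => rfl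
  have a3 : ∀ d : {d // α d = d}, α' (Sum.inl d.1) = Sum.inr d := by
    intro d; simp [α', d.2]
  have a4 : ∀ d, α' (α' d) = d := by
    rintro (d | d)
    · by_cases h : α d = d
      · rw [a3 ⟨d, h⟩, a2]
      · rw [a1 d h, a1, hα]
        intro h'; exact h (by rw [hα] at h'; exact h'.symm)
    · rw [a2, a3]
  refine ⟨α', ?_, a4, ?_, a1, a2, a3⟩
  · intro A _ g h g0 g1 g2
    obtain ⟨p, hp, hp2⟩ := hP A (fun d => if α d = d then 0 else g (Sum.inl d)) (fun d => h (Sum.inl d))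
      (by intro d hd; simp [hd])
      (by
        intro d
        by_cases hd : α d = d
        · simp [hd]
        · have : α (α d) ≠ α d := by rw [hα]; exact fun h => hd h.symm
          rw [if_neg hd, if_neg this, ← g1, a1 d hd])
      (by
        intro d
        by_cases hd : α d = d
        · rw [if_pos hd, hd]
          have e1 := g2 (Sum.inl d)
          have e2 := g2 (Sum.inr ⟨d, hd⟩)
          have e3 := g1 (Sum.inl d)
          rw [a3 ⟨d, hd⟩] at e1 e3
          rw [a2] at e2
          simp only [Equiv.sumCongr_apply, Sum.map_inr, Sum.map_inl, Equiv.refl_apply] at e1 e2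
          have : h (Sum.inl (σ d)) - h (Sum.inl d) = g (Sum.inl d) + g (Sum.inr ⟨d, hd⟩) := by
            rw [e1, e2]; abel
          rw [this, e3]; abel
        · rw [if_neg hd, g2, a1 d hd]; rfl)
    refine ⟨Sum.elim p (fun d => p d.1 + g (Sum.inl d.1)), ?_, ?_⟩
    · rintro (d | d)
      · exact hp d
      · rfl
    · rintro (d | d)
      · by_cases hd : α d = d
        · rw [a3 ⟨d, hd⟩]; simp
        · rw [a1 d hd]
          have := hp2 d
          rw [if_neg hd] at this
          exact this
      · rw [a2]
        have e3 := g1 (Sum.inr d)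
        rw [a2] at e3
        simp only [Sum.elim_inl, Sum.elim_inr]
        rw [e3]; abel
  · rintro (d | d)
    · by_cases h : α d = d
      · rw [a3 ⟨d, h⟩]; simp
      · rw [a1 d h]; simpa using h
    · rw [a2]; simp

/-- a connected simple plane map without dead darts, with vertices labelled by `v` -/
structure SimpleMap (D W : Type) where
  σ : Equiv.Perm D
  α : D → D
  v : D → W
  planar : PlanarMap σ α
  inv : ∀ d, α (α d) = d
  cyc : ∀ d e, σ.SameCycle d e ↔ v d = v e
  noloop : ∀ d, v (α d) ≠ v d
  simple : ∀ d e, v d = v e → v (α d) = v (α e) → d = e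
  conn : ∀ S : Set D, S.Nonempty → (∀ d ∈ S, σ d ∈ S) → (∀ d ∈ S, α d ∈ S) → S = univ

theorem map_of_grid {L : Type} (B : Set (ℤ × ℤ)) (hB : B.Finite) (ℓ : ℤ × ℤ → L)
    (hfib : ∀ S : Set (ℤ × ℤ), S ⊆ B → (∀ z ∈ S, ∀ k, z + gridE k ∈ B → ℓ (z + gridE k) = ℓ z →
      z + gridE k ∈ S) → ∀ z ∈ S, ∀ w ∈ B, ℓ w = ℓ z → w ∈ S)
    (hconn : ∀ S : Set (ℤ × ℤ), S ⊆ B → S.Nonempty → (∀ z ∈ S, ∀ k, z + gridE k ∈ B →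
      z + gridE k ∈ S) → S = B) :
    ∃ (D W : Type) (_ : Finite D) (M : SimpleMap D (L ⊕ W)),
      (∀ z ∈ B, ∃ d, M.v d = Sum.inl (ℓ z)) ∧
      (∀ z ∈ B, ∀ k, z + gridE k ∈ B → ℓ (z + gridE k) ≠ ℓ z →
        ∃ d, M.v d = Sum.inl (ℓ z) ∧ M.v (M.α d) = Sum.inl (ℓ (z + gridE k))) := by
  classical
  -- step 1: kill edges leaving the box
  let α1 : (ℤ × ℤ) × Fin 4 → (ℤ × ℤ) × Fin 4 := fun d =>
    if d.1 ∈ B ∧ d.1 + gridE d.2 ∈ B then gridα d else d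
  have α1inv : ∀ d, α1 (α1 d) = d := by
    intro d
    by_cases h : d.1 ∈ B ∧ d.1 + gridE d.2 ∈ B
    · have e1 : α1 d = gridα d := if_pos h
      have e2 : α1 (gridα d) = gridα (gridα d) := by
        apply if_pos
        refine ⟨h.2, ?_⟩
        have := congrArg Prod.fst (gridα_invol d)
        change (gridα d).1 + gridE (gridα d).2 = d.1 at this
        rw [this]; exact h.1
      rw [e1, e2, gridα_invol]
    · have e1 : α1 d = d := if_neg h
      rw [e1, e1]
  have P1 : PlanarMap gridσ α1 := by
    refine grid_planar.delete gridα_invol α1inv ?_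
    intro d
    by_cases h : d.1 ∈ B ∧ d.1 + gridE d.2 ∈ B
    · exact Or.inr (if_pos h)
    · exact Or.inl (if_neg h)
  -- step 2: restrict
  let D := B × Fin 4
  have : Finite B := hB
  let ι : D → (ℤ × ℤ) × Fin 4 := fun d => (d.1.1, d.2)
  let σ2 : Equiv.Perm D := Equiv.prodCongr (Equiv.refl _) (Equiv.addRight 1)
  let α2 : D → D := fun d => if h : d.1.1 + gridE d.2 ∈ B then (⟨_, h⟩, d.2 + 2) else d
  have hι : Function.Injective ι := by
    rintro ⟨⟨z, hz⟩, k⟩ ⟨⟨w, hw⟩, k'⟩ h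
    simp only [ι, Prod.mk.injEq] at h
    obtain ⟨rfl, rfl⟩ := h; rfl
  have ια : ∀ d, α1 (ι d) = ι (α2 d) := by
    intro d
    by_cases h : d.1.1 + gridE d.2 ∈ B
    · have e1 : α1 (ι d) = gridα (ι d) := if_pos ⟨d.1.2, h⟩
      have e2 : α2 d = (⟨_, h⟩, d.2 + 2) := dif_pos h
      rw [e1, e2]; rfl
    · have e1 : α1 (ι d) = ι d := if_neg (fun h' => h h'.2)
      have e2 : α2 d = d := dif_neg h
      rw [e1, e2]
  have P2 : PlanarMap σ2 α2 := P1.restrict α1inv ι hι (fun d => rfl) ια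
  have inv2 : ∀ d, α2 (α2 d) = d := by
    intro d; apply hι; rw [← ια, ← ια, α1inv]
  let lab : D → L := fun d => ℓ d.1.1
  have α2live : ∀ (d : D) (h : d.1.1 + gridE d.2 ∈ B), (α2 d).1.1 = d.1.1 + gridE d.2 := by
    intro d h
    have e2 : α2 d = (⟨_, h⟩, d.2 + 2) := dif_pos h
    rw [e2]
  -- closure under σ2 means all directions
  have dirs : ∀ S : Set D, (∀ d ∈ S, σ2 d ∈ S) → ∀ z k k', (z, k) ∈ S → (z, k') ∈ S := by
    intro S hS z k k' h
    have a1 := hS _ h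
    have a2 := hS _ a1
    have a3 := hS _ a2
    have e : ∀ k k' : Fin 4, k' = k ∨ k' = k + 1 ∨ k' = k + 1 + 1 ∨ k' = k + 1 + 1 + 1 := by decide
    rcases e k k' with rfl | rfl | rfl | rfl
    · exact h
    · exact a1
    · exact a2
    · exact a3
  have fib2 : ∀ S : Set D, (∀ d ∈ S, σ2 d ∈ S) → (∀ d ∈ S, lab (α2 d) = lab d → α2 d ∈ S) →
        ∀ d ∈ S, ∀ e, lab e = lab d → e ∈ S := by
    intro S s1 s2 d hd e he
    let S' : Set (ℤ × ℤ) := {z | ∃ h : z ∈ B, ((⟨z, h⟩, 0) : D) ∈ S}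
    have := hfib S' (fun z hz => hz.1) ?_ d.1.1 ⟨d.1.2, dirs S s1 _ _ _ hd⟩ e.1.1 e.1.2 he
    · obtain ⟨h, h'⟩ := this
      exact dirs S s1 _ _ _ h'
    · rintro z ⟨hz, hzS⟩ k hk hl
      refine ⟨hk, ?_⟩
      have h1 : ((⟨z, hz⟩, k) : D) ∈ S := dirs S s1 _ _ _ hzS
      have e2 : α2 (⟨z, hz⟩, k) = (⟨_, hk⟩, k + 2) := dif_pos hk
      have h2 := s2 _ h1
      rw [e2] at h2
      exact dirs S s1 _ _ _ (h2 hl)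
  have conn2 : ∀ S : Set D, S.Nonempty → (∀ d ∈ S, σ2 d ∈ S) → (∀ d ∈ S, α2 d ∈ S) → S = univ := by
    intro S ⟨d, hd⟩ s1 s2
    let S' : Set (ℤ × ℤ) := {z | ∃ h : z ∈ B, ((⟨z, h⟩, 0) : D) ∈ S}
    have := hconn S' (fun z hz => hz.1) ⟨d.1.1, d.1.2, dirs S s1 _ _ _ hd⟩ ?_
    · ext e
      simp only [mem_univ, iff_true]
      have h1 : e.1.1 ∈ S' := by rw [this]; exact e.1.2
      obtain ⟨h, h'⟩ := h1
      exact dirs S s1 _ _ _ h'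
    · rintro z ⟨hz, hzS⟩ k hk
      refine ⟨hk, ?_⟩
      have h1 : ((⟨z, hz⟩, k) : D) ∈ S := dirs S s1 _ _ _ hzS
      have e2 : α2 (⟨z, hz⟩, k) = (⟨_, hk⟩, k + 2) := dif_pos hk
      have h2 := s2 _ h1
      rw [e2] at h2
      exact dirs S s1 _ _ _ h2
  -- step 3: contract
  obtain ⟨σ3, α3, P3, inv3, cyc3, live3, dead3⟩ :=
    contract_labels lab _ σ2 α2 P2 inv2 (fun d => rfl) fib2 le_rfl
  have lab3 : ∀ d, α3 d ≠ d → α3 d = α2 d ∧ lab (α2 d) ≠ lab d := by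
    intro d hd
    have : lab (α2 d) ≠ lab d := fun h => hd (dead3 d h)
    exact ⟨live3 d this, this⟩
  -- step 4: dedupe
  let _ : LinearOrder L := IsWellOrder.linearOrder (WellOrderingRel (α := L))
  let key : D → L × L := fun d => (lab d, lab (α3 d))
  have hs : Function.Surjective (rangeFactorization key) := rangeFactorization_surjective
  let rep : D → D := fun d => Function.surjInv hs (rangeFactorization key d)
  have rep1 : ∀ d, key (rep d) = key d := by
    intro d
    have := Function.surjInv_eq hs (rangeFactorization key d)
    exact congrArg Subtype.val this
  have rep2 : ∀ d e, key d = key e → rep d = rep e := by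
    intro d e h
    have : rangeFactorization key d = rangeFactorization key e := Subtype.ext h
    simp only [rep, this]
  let keep : D → Prop := fun d => (lab d < lab (α3 d) ∧ d = rep d) ∨
    (lab (α3 d) < lab d ∧ α3 d = rep (α3 d))
  have keepα : ∀ d, keep d → keep (α3 d) := by
    rintro d (⟨h1, h2⟩ | ⟨h1, h2⟩)
    · right; rw [inv3]; exact ⟨h1, h2⟩
    · left; rw [inv3]; exact ⟨h1, h2⟩
  let α4 : D → D := fun d => if keep d then α3 d else d
  have a4k : ∀ d, keep d → α4 d = α3 d := fun d h => if_pos h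
  have a4n : ∀ d, ¬ keep d → α4 d = d := fun d h => if_neg h
  have inv4 : ∀ d, α4 (α4 d) = d := by
    intro d
    by_cases h : keep d
    · rw [a4k d h, a4k _ (keepα d h), inv3]
    · rw [a4n d h, a4n d h]
  have P4 : PlanarMap σ3 α4 := P3.delete inv3 inv4 (fun d => by
    by_cases h : keep d
    · exact Or.inr (a4k d h)
    · exact Or.inl (a4n d h))
  have live4 : ∀ d, α4 d ≠ d → keep d := by
    intro d h; by_contra h'; exact h (a4n d h')
  have keeplab : ∀ d, keep d → lab (α3 d) ≠ lab d := by
    rintro d (⟨h1, _⟩ | ⟨h1, _⟩)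
    · exact h1.ne'
    · exact h1.ne
  have simple4 : ∀ d e, keep d → keep e → lab d = lab e → lab (α3 d) = lab (α3 e) → d = e := by
    rintro d e (⟨h1, h2⟩ | ⟨h1, h2⟩) (⟨h3, h4⟩ | ⟨h3, h4⟩) hl hl'
    · rw [h2, h4]; exact rep2 _ _ (Prod.ext hl hl')
    · rw [hl, hl'] at h1; exact (lt_asymm h1 h3).elim
    · rw [hl, hl'] at h1; exact (lt_asymm h1 h3).elim
    · have : α3 d = α3 e := by
        rw [h2, h4]; exact rep2 _ _ (Prod.ext hl' (by simpa only [key, inv3] using hl))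
      rw [← inv3 d, this, inv3]
  have rep4 : ∀ d, lab (α3 d) ≠ lab d → ∃ e, keep e ∧ lab e = lab d ∧ lab (α3 e) = lab (α3 d) := by
    intro d hd
    rcases lt_or_gt_of_ne hd with h | h
    · have r1 := rep1 (α3 d)
      simp only [key, inv3, Prod.mk.injEq] at r1
      refine ⟨α3 (rep (α3 d)), Or.inr ?_, r1.2, ?_⟩
      · rw [inv3, r1.1, r1.2]
        refine ⟨h, rep2 _ _ ?_⟩
        simp only [key, inv3, Prod.mk.injEq]
        exact ⟨r1.1.symm, r1.2.symm⟩
      · rw [inv3]; exact r1.1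
    · have r1 := rep1 d
      simp only [key, Prod.mk.injEq] at r1
      refine ⟨rep d, Or.inl ?_, r1.1, r1.2⟩
      rw [r1.1, r1.2]
      refine ⟨h, rep2 _ _ ?_⟩
      simp only [key, Prod.mk.injEq]
      exact ⟨r1.1.symm, r1.2.symm⟩
  have conn4 : ∀ S : Set D, S.Nonempty → (∀ d ∈ S, σ3 d ∈ S) → (∀ d ∈ S, α4 d ∈ S) → S = univ := by
    intro S hne s1 s2
    have fibS : ∀ d ∈ S, ∀ e, lab d = lab e → e ∈ S := fun d hd e h =>
      closed_sameCycle σ3 S s1 ((cyc3 d e).2 h) hd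
    refine conn2 S hne (fun d hd => fibS d hd _ rfl) ?_
    intro d hd
    by_cases hl : lab (α2 d) = lab d
    · exact fibS d hd _ hl.symm
    · have e3 := live3 d hl
      rw [← e3] at hl ⊢
      obtain ⟨e, he, he1, he2⟩ := rep4 d hl
      have : α3 e ∈ S := by
        rw [← a4k e he]; exact s2 _ (fibS d hd _ he1.symm)
      exact fibS _ this _ he2
  -- step 5: pendant
  obtain ⟨α5, P5, inv5, ne5, l5, r5, i5⟩ := P4.pendant inv4
  have keep5 : ∀ d, keep d → α5 (Sum.inl d) = Sum.inl (α3 d) := by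
    intro d hd
    have : α4 d ≠ d := by
      rw [a4k d hd]; intro h; exact keeplab d hd (by rw [h])
    rw [l5 d this, a4k d hd]
  have kn : ∀ d, keep d ∨ α4 d = d := fun d => by
    by_cases h : keep d
    · exact Or.inl h
    · exact Or.inr (a4n d h)
  let W := {d // α4 d = d}
  let v : D ⊕ W → L ⊕ W := Sum.map lab id
  refine ⟨D ⊕ W, W, inferInstance, ⟨Equiv.sumCongr σ3 (Equiv.refl _), α5, v, P5, inv5, ?_, ?_, ?_, ?_⟩, ?_, ?_⟩
  · have pw : ∀ (n : ℕ) d, ((Equiv.sumCongr σ3 (Equiv.refl W) : Equiv.Perm _) ^ n) (Sum.inl d) =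
        Sum.inl ((σ3 ^ n) d) := by
      intro n
      induction n with
      | zero => intro d; rfl
      | succ n ih => intro d; rw [pow_succ', pow_succ', Equiv.Perm.mul_apply, ih]; rfl
    have pwr : ∀ d, (Equiv.sumCongr σ3 (Equiv.refl W) : Equiv.Perm _) (Sum.inr d) = Sum.inr d :=
      fun d => rfl
    have inv_of : ∀ d e, Equiv.Perm.SameCycle (Equiv.sumCongr σ3 (Equiv.refl W)) d e → v d = v e := by
      intro d e h
      refine (closed_sameCycle _ {x | v x = v d} ?_ h rfl).symm
      rintro (x | x) hx
      · simp only [mem_ofPred_eq] at hx ⊢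
        rw [← hx]
        have : lab (σ3 x) = lab x := ((cyc3 x (σ3 x)).1
          (Equiv.Perm.sameCycle_apply_right.mpr (Equiv.Perm.SameCycle.refl _ _))).symm
        exact congrArg Sum.inl this
      · exact hx
    intro d e
    refine ⟨inv_of d e, fun h => ?_⟩
    rcases d with d | d <;> rcases e with e | e
    · have h' : lab d = lab e := Sum.inl_injective h
      obtain ⟨n, -, hn⟩ := ((cyc3 d e).2 h').exists_pow_eq'
      refine ⟨n, ?_⟩
      rw [zpow_natCast, pw, hn]
    · exact (Sum.inl_ne_inr h).elim
    · exact (Sum.inr_ne_inl h).elim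
    · have h' : d = e := Sum.inr_injective h
      rw [h']
  · rintro (d | d)
    · rcases kn d with h | h
      · rw [keep5 d h]
        intro h'; exact keeplab d h (Sum.inl_injective h')
      · rw [i5 ⟨d, h⟩]; exact Sum.inr_ne_inl
    · rw [r5]; exact Sum.inl_ne_inr
  · rintro (d | d) (e | e) h1 h2
    · rcases kn d with h | h <;> rcases kn e with h' | h'
      · rw [keep5 d h, keep5 e h'] at h2
        rw [simple4 d e h h' (Sum.inl_injective h1) (Sum.inl_injective h2)]
      · rw [keep5 d h, i5 ⟨e, h'⟩] at h2; exact (Sum.inl_ne_inr h2).elim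
      · rw [keep5 e h', i5 ⟨d, h⟩] at h2; exact (Sum.inr_ne_inl h2).elim
      · rw [i5 ⟨d, h⟩, i5 ⟨e, h'⟩] at h2
        have := Sum.inr_injective h2
        have := congrArg Subtype.val this
        exact congrArg Sum.inl this
    · exact (Sum.inl_ne_inr h1).elim
    · exact (Sum.inr_ne_inl h1).elim
    · exact congrArg Sum.inr (Sum.inr_injective h1)
  · intro S hne s1 s2
    have h1 : (Sum.inl ⁻¹' S : Set D) = univ := by
      apply conn4
      · obtain ⟨d | d, hd⟩ := hne
        · exact ⟨d, hd⟩
        · refine ⟨d.1, ?_⟩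
          have := s2 _ hd
          rwa [r5] at this
      · intro d hd; exact s1 _ hd
      · intro d hd
        rcases kn d with h | h
        · rw [a4k d h]
          have := s2 _ hd
          rwa [keep5 d h] at this
        · rw [h]; exact hd
    have h2 : ∀ d, (Sum.inl d : D ⊕ W) ∈ S := by
      intro d
      have : d ∈ (Sum.inl ⁻¹' S : Set D) := by rw [h1]; trivial
      exact this
    ext x
    simp only [mem_univ, iff_true]
    rcases x with d | d
    · exact h2 d
    · rw [← i5]; exact s2 _ (h2 _)
  · intro z hz
    exact ⟨Sum.inl (⟨z, hz⟩, 0), rfl⟩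
  · intro z hz k hk hl
    have e2 := α2live (⟨z, hz⟩, k) hk
    have l2 : lab (α2 (⟨z, hz⟩, k)) = ℓ (z + gridE k) := by simp only [lab, e2]
    have e3 : α3 (⟨z, hz⟩, k) = α2 (⟨z, hz⟩, k) := live3 _ (by rw [l2]; exact hl)
    obtain ⟨e, he, he1, he2⟩ := rep4 (⟨z, hz⟩, k) (by rw [e3, l2]; exact hl)
    refine ⟨Sum.inl e, congrArg Sum.inl he1, ?_⟩
    change v (α5 _) = _
    rw [keep5 e he]
    exact congrArg Sum.inl (he2.trans (by rw [e3, l2]))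

end

section
inductive KD (D : Type) : Type
  | A0 (d : D) | A1 (d : D) | A2 (d : D)
  | B0 (d : D) | B1 (d : D) | B2 (d : D)
  | C0 (d : D) | C1 (d : D) | C2 (d : D)

namespace KD

def rot {D : Type} : KD D → KD D
  | A0 d => A1 d | A1 d => A2 d | A2 d => A0 d
  | B0 d => B1 d | B1 d => B2 d | B2 d => B0 d
  | C0 d => C1 d | C1 d => C2 d | C2 d => C0 d

theorem rot3 {D : Type} (x : KD D) : rot (rot (rot x)) = x := by cases x <;> rfl

def rotE {D : Type} : Equiv.Perm (KD D) := ⟨rot, fun x => rot (rot x), rot3, rot3⟩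

def ff {D : Type} : KD D → D × Fin 3
  | A0 d => (d, 0) | A1 d => (d, 0) | A2 d => (d, 0)
  | B0 d => (d, 1) | B1 d => (d, 1) | B2 d => (d, 1)
  | C0 d => (d, 2) | C1 d => (d, 2) | C2 d => (d, 2)

def al {D : Type} (α : D → D) (φ : Equiv.Perm D) : KD D → KD D
  | A0 d => A0 (α d) | A1 d => B2 d | A2 d => B0 (φ.symm d)
  | B0 d => A2 (φ d) | B1 d => C0 d | B2 d => A1 d
  | C0 d => B1 d | C1 d => C2 (φ d) | C2 d => C1 (φ.symm d)

theorem al_inv {D : Type} (α : D → D) (φ : Equiv.Perm D) (hα : ∀ d, α (α d) = d) (x : KD D) :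
    al α φ (al α φ x) = x := by cases x <;> simp [al, hα]

def vv {D W Y : Type} (α : D → D) (φ : Equiv.Perm D) (v : D → W) (y : D → Y) : KD D → W ⊕ (D ⊕ Y)
  | A0 d => Sum.inl (v d) | A1 d => Sum.inl (v (α d)) | A2 d => Sum.inr (Sum.inl d)
  | B0 d => Sum.inl (v (α d)) | B1 d => Sum.inr (Sum.inl (φ d)) | B2 d => Sum.inr (Sum.inl d)
  | C0 d => Sum.inr (Sum.inl d) | C1 d => Sum.inr (Sum.inl (φ d)) | C2 d => Sum.inr (Sum.inr (y d))

instance {D : Type} [Finite D] : Finite (KD D) := by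
  have : Function.Injective (fun x : KD D => ((ff x, match x with
    | A0 _ => 0 | A1 _ => 1 | A2 _ => 2 | B0 _ => 0 | B1 _ => 1 | B2 _ => 2
    | C0 _ => 0 | C1 _ => 1 | C2 _ => 2) : (D × Fin 3) × Fin 3)) := by
    intro x y h
    cases x <;> cases y <;> simp_all [ff]
  exact Finite.of_injective _ this

end KD

/-- the face permutation -/
def SimpleMap.φ {D W : Type} (M : SimpleMap D W) : Equiv.Perm D :=
  (Function.Involutive.toPerm M.α M.inv).trans M.σ

theorem SimpleMap.φ_apply {D W : Type} (M : SimpleMap D W) (d : D) : M.φ d = M.σ (M.α d) := rfl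

theorem SimpleMap.v_σ {D W : Type} (M : SimpleMap D W) (d : D) : M.v (M.σ d) = M.v d :=
  ((M.cyc d (M.σ d)).1 (Equiv.Perm.sameCycle_apply_right.mpr (Equiv.Perm.SameCycle.refl _ _))).symm

theorem SimpleMap.v_φ {D W : Type} (M : SimpleMap D W) (d : D) : M.v (M.φ d) = M.v (M.α d) := by
  rw [M.φ_apply, M.v_σ]

theorem SimpleMap.φφ_ne {D W : Type} (M : SimpleMap D W)
    (h3 : ∀ d : D, ∃ e, M.v e ≠ M.v d ∧ M.v e ≠ M.v (M.α d)) (d : D) : M.φ (M.φ d) ≠ d := by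
  intro h
  set e := M.φ d with he
  have h1 : M.v (M.α e) = M.v d := by rw [← M.v_φ, h]
  have h2 : e = M.α d := M.simple _ _ (M.v_φ d) (by rw [h1, M.inv])
  have h4 : M.σ (M.α d) = M.α d := by rw [← M.φ_apply, ← he, h2]
  have h5 : M.σ d = d := by
    rw [h2, M.φ_apply, M.inv] at h; exact h
  obtain ⟨x, hx1, hx2⟩ := h3 d
  have := M.conn {y | y = d ∨ y = M.α d} ⟨d, Or.inl rfl⟩ ?_ ?_
  · have hx : x ∈ {y | y = d ∨ y = M.α d} := by rw [this]; trivial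
    rcases hx with rfl | rfl
    · exact hx1 rfl
    · exact hx2 rfl
  · rintro y (rfl | rfl)
    · exact Or.inl h5
    · exact Or.inr h4
  · rintro y (rfl | rfl)
    · exact Or.inr rfl
    · exact Or.inl (M.inv _)

open KD in
theorem exists_kmap {D W : Type} [Finite D] (M : SimpleMap D W) (h2 : ∀ d, M.φ (M.φ d) ≠ d) :
    ∃ (Y : Type) (K : SimpleMap (KD D) (W ⊕ (D ⊕ Y))), (∀ x, K.φ x = rot x) ∧
      (∀ d, K.v (A0 d) = Sum.inl (M.v d)) ∧ (∀ d, K.v (K.α (A0 d)) = Sum.inl (M.v (M.α d))) ∧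
      (∀ d w, K.v (C0 d) ≠ Sum.inl w) ∧ (∀ d w, K.v (C1 d) ≠ Sum.inl w) ∧
      (∀ d w, K.v (C2 d) ≠ Sum.inl w) := by
  let Y := Quotient (Equiv.Perm.SameCycle.setoid M.φ)
  let y : D → Y := fun d => Quotient.mk _ d
  have hy : ∀ d e, y d = y e ↔ M.φ.SameCycle d e := fun d e => Quotient.eq
  have hyφ : ∀ d, y (M.φ d) = y d := fun d => (hy _ _).2
    (Equiv.Perm.sameCycle_apply_left.mpr (Equiv.Perm.SameCycle.refl _ _))
  let a : KD D → KD D := al M.α M.φ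
  have ainv : ∀ x, a (a x) = x := al_inv M.α M.φ M.inv
  let s : Equiv.Perm (KD D) := (Function.Involutive.toPerm a ainv).trans rotE
  have sa : ∀ x, s x = rot (a x) := fun x => rfl
  let V : KD D → W ⊕ (D ⊕ Y) := vv M.α M.φ M.v y
  have Vs : ∀ x, V (s x) = V x := by
    intro x
    rw [sa]
    cases x <;> simp [V, a, vv, al, rot, M.inv, M.v_φ]
    rename_i d
    have := hyφ (M.φ.symm d)
    rw [Equiv.apply_symm_apply] at this; exact this.symm
  have sc : ∀ x y, s x = y → s.SameCycle x y := by
    rintro x _ rfl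
    exact Equiv.Perm.sameCycle_apply_right.mpr (Equiv.Perm.SameCycle.refl _ _)
  have cA0 : ∀ d e, M.v d = M.v e → s.SameCycle (A0 d) (A0 e) := by
    intro d e h
    refine closed_sameCycle M.σ {x | s.SameCycle (A0 d) (A0 x)} ?_ ((M.cyc d e).2 h)
      (Equiv.Perm.SameCycle.refl _ _)
    intro x hx
    refine Equiv.Perm.SameCycle.trans hx ?_
    have h1 : s.SameCycle (A0 x) (A1 (M.α x)) := sc _ _ rfl
    have h2 : s.SameCycle (A1 (M.α x)) (B0 (M.α x)) := sc _ _ rfl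
    have h3 : s.SameCycle (B0 (M.α x)) (A0 (M.φ (M.α x))) := sc _ _ rfl
    rw [M.φ_apply, M.inv] at h3
    exact h1.trans (h2.trans h3)
  have cA1 : ∀ d, s.SameCycle (A1 d) (A0 (M.φ d)) := fun d =>
    (sc (A1 d) (B0 d) rfl).trans (sc (B0 d) (A0 (M.φ d)) rfl)
  have cB0 : ∀ d, s.SameCycle (B0 d) (A0 (M.φ d)) := fun d => sc (B0 d) (A0 (M.φ d)) rfl
  have cB2 : ∀ d, s.SameCycle (B2 d) (A2 d) := fun d => sc _ _ rfl
  have cC0 : ∀ d, s.SameCycle (C0 d) (A2 d) := fun d => (sc (C0 d) (B2 d) rfl).trans (cB2 d)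
  have cC1 : ∀ d, s.SameCycle (C1 d) (A2 (M.φ d)) := fun d =>
    (sc (C1 d) (C0 (M.φ d)) rfl).trans (cC0 _)
  have cB1 : ∀ d, s.SameCycle (B1 d) (A2 (M.φ d)) := fun d =>
    (sc (B1 d) (C1 d) rfl).trans (cC1 _)
  have cC2 : ∀ d e, y d = y e → s.SameCycle (C2 d) (C2 e) := by
    intro d e h
    refine closed_sameCycle M.φ {x | s.SameCycle (C2 d) (C2 x)} ?_ ((hy d e).1 h)
      (Equiv.Perm.SameCycle.refl _ _)
    intro x hx
    refine Equiv.Perm.SameCycle.trans hx (Equiv.Perm.SameCycle.symm ?_)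
    apply sc
    rw [sa]; simp [a, al, rot]
  have can : ∀ x, (∃ d, s.SameCycle x (A0 d)) ∨ (∃ d, s.SameCycle x (A2 d)) ∨
      (∃ d, s.SameCycle x (C2 d)) := by
    intro x
    cases x with
    | A0 d => exact Or.inl ⟨d, Equiv.Perm.SameCycle.refl _ _⟩
    | A1 d => exact Or.inl ⟨_, cA1 d⟩
    | A2 d => exact Or.inr (Or.inl ⟨d, Equiv.Perm.SameCycle.refl _ _⟩)
    | B0 d => exact Or.inl ⟨_, cB0 d⟩
    | B1 d => exact Or.inr (Or.inl ⟨_, cB1 d⟩)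
    | B2 d => exact Or.inr (Or.inl ⟨_, cB2 d⟩)
    | C0 d => exact Or.inr (Or.inl ⟨_, cC0 d⟩)
    | C1 d => exact Or.inr (Or.inl ⟨_, cC1 d⟩)
    | C2 d => exact Or.inr (Or.inr ⟨d, Equiv.Perm.SameCycle.refl _ _⟩)
  have Vc : ∀ x z, s.SameCycle x z → V x = V z := fun x z h =>
    (closed_sameCycle s {t | V t = V x} (fun t ht => by
      simp only [mem_ofPred_eq] at *; rw [Vs, ht]) h rfl).symm
  have nl : ∀ d, M.v (M.α d) ≠ M.v d := M.noloop
  have yf : ∀ d, y (M.φ.symm d) = y d := by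
    intro d
    have := hyφ (M.φ.symm d)
    rw [Equiv.apply_symm_apply] at this; exact this.symm
  have Hpl : PlanarMap s a := by
    intro A _ g h g0 g1 g2
    have tri : ∀ x, g x + g (rot x) + g (rot (rot x)) = 0 := by
      intro x
      have e : ∀ x, g x = h (rot x) - h x := by
        intro x; have := g2 x; rw [sa, ainv] at this; exact this
      rw [e x, e (rot x), e (rot (rot x)), rot3]; abel
    have tA := fun d => tri (A0 d)
    have tB := fun d => tri (B0 d)
    have tC := fun d => tri (C0 d)
    simp only [rot] at tA tB tC
    have q1 : ∀ d, g (B2 d) = - g (A1 d) := fun d => g1 (A1 d)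
    have q2 : ∀ d, g (A2 (M.φ d)) = - g (B0 d) := fun d => g1 (B0 d)
    have q3 : ∀ d, g (C0 d) = - g (B1 d) := fun d => g1 (B1 d)
    have q4 : ∀ d, g (C2 (M.φ d)) = - g (C1 d) := fun d => g1 (C1 d)
    have q5 : ∀ d, g (A0 (M.α d)) = - g (A0 d) := fun d => g1 (A0 d)
    have hM : ∀ d, g (A0 d) = (g (C2 (M.φ d)) + g (A2 (M.φ d))) - (g (C2 d) + g (A2 d)) := by
      intro d
      have a1 := tA d
      have a2 := tB d
      have a3 := tC d
      rw [q1] at a2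
      rw [q3] at a3
      rw [q4, q2]
      have : g (A0 d) - (-g (C1 d) + -g (B0 d) - (g (C2 d) + g (A2 d))) =
        (g (A0 d) + g (A1 d) + g (A2 d)) + (g (B0 d) + g (B1 d) + - g (A1 d)) +
        (- g (B1 d) + g (C1 d) + g (C2 d)) := by abel
      rw [a1, a2, a3] at this
      rw [← sub_eq_zero, this]; simp
    obtain ⟨p, hp, hp2⟩ := M.planar A (fun d => g (A0 d)) (fun d => g (C2 d) + g (A2 d))
      (by intro d hd; exact (nl d (by rw [hd])).elim) q5 hM
    have hpφ : ∀ d, p (M.φ d) = p (M.α d) := fun d => by rw [M.φ_apply, hp]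
    have hpφ' : ∀ d, p (M.α (M.φ.symm d)) = p d := fun d => by
      rw [← hpφ, Equiv.apply_symm_apply]
    let X : D → A := fun d => p d - g (A2 d)
    let Yy : D → A := fun d => p d - (g (C2 d) + g (A2 d))
    have Yφ : ∀ d, Yy (M.φ d) = Yy d := by
      intro d
      simp only [Yy]
      have e1 := hM d
      have e2 := hp2 d
      rw [hpφ]
      have e3 : g (C2 (M.φ d)) + g (A2 (M.φ d)) = g (A0 d) + (g (C2 d) + g (A2 d)) := by
        rw [e1]; abel
      rw [e3, e2]; abel
    have Yφ' : ∀ d, Yy (M.φ.symm d) = Yy d := by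
      intro d
      rw [← Yφ, Equiv.apply_symm_apply]
    have e2 : ∀ d, g (A2 d) = - g (B0 (M.φ.symm d)) := fun d => by
      have := q2 (M.φ.symm d)
      rwa [Equiv.apply_symm_apply] at this
    have e4 : ∀ d, g (C2 d) = - g (C1 (M.φ.symm d)) := fun d => by
      have := q4 (M.φ.symm d)
      rwa [Equiv.apply_symm_apply] at this
    let P : KD D → A := fun x => match x with
      | A0 d => p d | A1 d => p (M.α d) | A2 d => X d
      | B0 d => p (M.α d) | B1 d => X (M.φ d) | B2 d => X d
      | C0 d => X d | C1 d => X (M.φ d) | C2 d => Yy d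
    refine ⟨P, ?_, ?_⟩
    · intro x
      rw [sa]
      cases x <;> simp [a, al, rot, P, M.inv, hpφ, Yφ']
    · intro x
      cases x with
      | A0 d => exact hp2 d
      | A1 d =>
        simp only [a, al, P, X]
        have a1 := tA d
        have a2 := hp2 d
        have : p (M.α d) = g (A0 d) + p d := by rw [a2]; abel
        rw [this, ← sub_eq_zero, ← a1]; abel
      | A2 d =>
        simp only [a, al, P, X, hpφ']; abel
      | B0 d =>
        simp only [a, al, P, X, hpφ, q2]; abel
      | B1 d =>
        simp only [a, al, P, X, hpφ, q2]
        have a1 := tA d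
        have a3 := tB d
        rw [q1] at a3
        have a2 := hp2 d
        have : p (M.α d) = g (A0 d) + p d := by rw [a2]; abel
        rw [this, ← sub_eq_zero]
        have a4 : g (B1 d) - (p d - g (A2 d) - (g (A0 d) + p d - -g (B0 d))) =
          (g (A0 d) + g (A1 d) + g (A2 d)) + (g (B0 d) + g (B1 d) + - g (A1 d)) := by abel
        rw [a4, a1, a3, add_zero]
      | B2 d =>
        simp only [a, al, P, X, q1]
        have a1 := tA d
        have a2 := hp2 d
        have : p (M.α d) = g (A0 d) + p d := by rw [a2]; abel
        rw [this, ← sub_eq_zero, ← neg_eq_zero, ← a1]; abel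
      | C0 d =>
        simp only [a, al, P, X, hpφ, q2, q3]
        have a1 := tA d
        have a3 := tB d
        rw [q1] at a3
        have a2 := hp2 d
        have : p (M.α d) = g (A0 d) + p d := by rw [a2]; abel
        rw [this, ← sub_eq_zero, ← neg_eq_zero]
        have a4 : -(-g (B1 d) - (g (A0 d) + p d - -g (B0 d) - (p d - g (A2 d)))) =
          (g (A0 d) + g (A1 d) + g (A2 d)) + (g (B0 d) + g (B1 d) + - g (A1 d)) := by abel
        rw [a4, a1, a3, add_zero]
      | C1 d =>
        simp only [a, al, P, X]
        rw [Yφ]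
        have := Yφ d
        simp only [Yy] at this ⊢
        rw [← this, q4]; abel
      | C2 d =>
        simp only [a, al, P, X, Yy, Equiv.apply_symm_apply]; abel
  have Hcy : ∀ d e, s.SameCycle d e ↔ V d = V e := by
    intro x z
    refine ⟨Vc x z, fun h => ?_⟩
    rcases can x with ⟨d, hd⟩ | ⟨d, hd⟩ | ⟨d, hd⟩ <;> rcases can z with ⟨e, he⟩ | ⟨e, he⟩ | ⟨e, he⟩ <;>
      rw [Vc _ _ hd, Vc _ _ he] at h <;> simp [V, vv] at h
    · exact hd.trans ((cA0 d e h).trans he.symm)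
    · subst h; exact hd.trans he.symm
    · exact hd.trans ((cC2 d e h).trans he.symm)
  have Hnl : ∀ d, V (a d) ≠ V d := by
    intro x
    cases x <;> simp [V, a, vv, al, nl]
    all_goals
      rename_i d
      intro h
      have := M.v_φ d
      rw [h] at this
      first | exact (nl d this.symm) | skip
    · have := M.v_φ d
      rw [← h] at this
      exact (nl d this.symm)
  have Hsi : ∀ d e, V d = V e → V (a d) = V (a e) → d = e := by
    have nlφ : ∀ d, M.v (M.α (M.φ d)) ≠ M.v (M.α d) := fun d h => nl _ (h.trans (M.v_φ d).symm)
    have vs : ∀ d, M.v (M.α (M.φ.symm d)) = M.v d := fun d => by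
      rw [← M.v_φ, Equiv.apply_symm_apply]
    intro x z h1 h2'
    cases x <;> cases z <;> simp [V, a, vv, al] at h1 h2'
    all_goals rename_i d e
    · rw [M.simple d e h1 h2']
    · rw [h2']
    · rw [h2'] at h1; exact (nlφ _ h1).elim
    · rw [h1]
    · rw [h1, vs] at h2'; exact (nl _ h2'.symm).elim
    · rw [← h2'] at h1; exact (nlφ _ h1.symm).elim
    · rw [h2']
    · rw [h1]
    · rw [← h1] at h2'; exact (h2 _ h2'.symm).elim
    · rw [h1, vs] at h2'; exact (nl _ h2').elim
    · rw [h1]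
    · rw [h1] at h2'; exact (h2 _ h2').elim
    · rw [h1]
    · rw [h1]
    · rw [h2']
  have Hco : ∀ S : Set (KD D), S.Nonempty → (∀ d ∈ S, s d ∈ S) → (∀ d ∈ S, a d ∈ S) → S = univ := by
    intro S hne s1 s2
    have s3 : ∀ d ∈ S, rot d ∈ S := by
      intro d hd
      have := s1 _ (s2 _ hd)
      rwa [sa, ainv] at this
    have toA : ∀ d, A1 d ∈ S → A0 d ∈ S := fun d h => s3 _ (s3 _ h)
    have toB : ∀ d, B0 d ∈ S → A0 d ∈ S := fun d h => toA d (s2 _ (s3 _ (s3 _ h)))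
    have toC : ∀ d, C0 d ∈ S → A0 d ∈ S := fun d h => toB d (s3 _ (s3 _ (s2 _ h)))
    have key : ∃ d, A0 d ∈ S := by
      obtain ⟨x, hx⟩ := hne
      cases x with
      | A0 d => exact ⟨d, hx⟩
      | A1 d => exact ⟨d, toA d hx⟩
      | A2 d => exact ⟨d, s3 _ hx⟩
      | B0 d => exact ⟨d, toB d hx⟩
      | B1 d => exact ⟨d, toB d (s3 _ (s3 _ hx))⟩
      | B2 d => exact ⟨d, toB d (s3 _ hx)⟩
      | C0 d => exact ⟨d, toC d hx⟩
      | C1 d => exact ⟨d, toC d (s3 _ (s3 _ hx))⟩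
      | C2 d => exact ⟨d, toC d (s3 _ hx)⟩
    have all0 : ∀ d, A0 d ∈ S := by
      have := M.conn {d | A0 d ∈ S} key ?_ ?_
      · intro d
        have h : d ∈ {d | A0 d ∈ S} := by rw [this]; trivial
        exact h
      · intro d hd
        have h1 := s1 _ (s1 _ (s1 _ hd))
        have h2 : s (s (s (A0 d))) = A0 (M.φ (M.α d)) := rfl
        rw [h2, M.φ_apply, M.inv] at h1
        exact h1
      · intro d hd
        exact s2 _ hd
    have all1 : ∀ d, A1 d ∈ S := fun d => s3 _ (all0 d)
    have all2 : ∀ d, B2 d ∈ S := fun d => s2 _ (all1 d)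
    have all3 : ∀ d, B0 d ∈ S := fun d => s3 _ (all2 d)
    have all4 : ∀ d, B1 d ∈ S := fun d => s3 _ (all3 d)
    have all5 : ∀ d, C0 d ∈ S := fun d => s2 _ (all4 d)
    ext x
    simp only [mem_univ, iff_true]
    cases x with
    | A0 d => exact all0 d
    | A1 d => exact all1 d
    | A2 d => exact s3 _ (all1 d)
    | B0 d => exact all3 d
    | B1 d => exact all4 d
    | B2 d => exact all2 d
    | C0 d => exact all5 d
    | C1 d => exact s3 _ (all5 d)
    | C2 d => exact s3 _ (s3 _ (all5 d))
  refine ⟨Y, ⟨s, a, V, Hpl, ainv, Hcy, Hnl, Hsi, Hco⟩, ?_, fun d => rfl, fun d => rfl, ?_, ?_, ?_⟩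
  · intro x
    change s (a x) = _
    rw [sa, ainv]
  all_goals
    intro d w h
    simp [V, vv] at h

end

section
open Classical in
theorem coboundary {D A : Type} [Fintype D] [AddCommGroup A] (τ : Equiv.Perm D) (c : D → A)
    (hc : ∀ d, ∑ e with τ.SameCycle d e, c e = 0) : ∃ h : D → A, ∀ d, c d = h (τ d) - h d := by
  let r : D → D := fun d => (Quotient.out (Quotient.mk (Equiv.Perm.SameCycle.setoid τ) d))
  have hr : ∀ d, τ.SameCycle (r d) d := fun d => Quotient.eq.mp (Quotient.out_eq (Quotient.mk (Equiv.Perm.SameCycle.setoid τ) d))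
  have hr2 : ∀ d, r (τ d) = r d := by
    intro d
    have : Quotient.mk (Equiv.Perm.SameCycle.setoid τ) (τ d) = Quotient.mk (Equiv.Perm.SameCycle.setoid τ) d :=
      Quotient.sound (Equiv.Perm.sameCycle_apply_left.mpr (Equiv.Perm.SameCycle.refl _ _))
    simp only [r, this]
  have hn : ∀ d, ∃ n : ℕ, (τ ^ n) (r d) = d := by
    intro d
    obtain ⟨n, -, hn⟩ := (hr d).exists_pow_eq'
    exact ⟨n, hn⟩
  let n : D → ℕ := fun d => Nat.find (hn d)
  have n1 : ∀ d, (τ ^ n d) (r d) = d := fun d => Nat.find_spec (hn d)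
  have n2 : ∀ d m, (τ ^ m) (r d) = d → n d ≤ m := fun d m h => Nat.find_min' (hn d) h
  refine ⟨fun d => ∑ i ∈ Finset.range (n d), c ((τ ^ i) (r d)), fun d => ?_⟩
  simp only [hr2]
  by_cases h0 : n (τ d) = 0
  · have e1 : τ d = r d := by
      have := n1 (τ d); rw [h0, hr2] at this; exact this.symm
    rw [h0, Finset.range_zero, Finset.sum_empty]
    have inj : Set.InjOn (fun i => (τ ^ i) (r d)) (Finset.range (n d + 1)) := by
      have aux : ∀ i j, i < j → j ≤ n d → (τ ^ i) (r d) ≠ (τ ^ j) (r d) := by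
        intro i j hij hj h
        have : (τ ^ (n d - j + i)) (r d) = d := by
          rw [pow_add, Equiv.Perm.mul_apply, h, ← Equiv.Perm.mul_apply, ← pow_add,
            Nat.sub_add_cancel hj, n1]
        have := n2 d _ this
        omega
      intro i hi j hj h
      simp only [Finset.coe_range, mem_Iio] at hi hj
      rcases lt_trichotomy i j with h' | h' | h'
      · exact (aux i j h' (by omega) h).elim
      · exact h'
      · exact (aux j i h' (by omega) h.symm).elim
    have img : (Finset.range (n d + 1)).image (fun i => (τ ^ i) (r d)) =
        Finset.univ.filter (fun e => τ.SameCycle d e) := by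
      ext e
      simp only [Finset.mem_image, Finset.mem_range, Finset.mem_filter, Finset.mem_univ, true_and]
      constructor
      · rintro ⟨i, -, rfl⟩
        exact (hr d).symm.trans (Equiv.Perm.sameCycle_pow_right.mpr (Equiv.Perm.SameCycle.refl _ _))
      · intro he
        refine closed_sameCycle τ {e | ∃ a, a < n d + 1 ∧ (τ ^ a) (r d) = e} ?_ he
          ⟨n d, by omega, n1 d⟩
        rintro x ⟨a, ha, rfl⟩
        by_cases han : a = n d
        · refine ⟨0, by omega, ?_⟩
          rw [han, n1, e1]; rfl
        · exact ⟨a + 1, by omega, by rw [pow_succ', Equiv.Perm.mul_apply]⟩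
    have := hc d
    rw [← img, Finset.sum_image inj, Finset.sum_range_succ, n1] at this
    rw [zero_sub]
    exact eq_neg_of_add_eq_zero_right this
  · have e1 : n (τ d) = n d + 1 := by
      apply le_antisymm
      · apply n2; rw [hr2, pow_succ', Equiv.Perm.mul_apply, n1]
      · obtain ⟨m, hm⟩ := Nat.exists_eq_succ_of_ne_zero h0
        have := n1 (τ d)
        rw [hm, hr2, Nat.succ_eq_add_one, pow_succ', Equiv.Perm.mul_apply] at this
        have := n2 d m (τ.injective this)
        omega
    rw [e1, Finset.sum_range_succ, n1]; abel

theorem next_live {D : Type} [Finite D] (σ τ : Equiv.Perm D) (L : Set D)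
    (hτ : ∀ d, d ∉ L → τ d = σ d) (x y : D) (hy : y ∈ L) (hxy : y ≠ x) (hs : σ.SameCycle x y) :
    ∃ z ∈ L, z ≠ x ∧ σ.SameCycle x z ∧ τ.SameCycle (σ x) z := by
  classical
  have hm : ∃ m : ℕ, (σ ^ m) x = y := by
    obtain ⟨n, -, hn⟩ := hs.exists_pow_eq'
    exact ⟨n, hn⟩
  set m := Nat.find hm with hmdef
  have m1 : (σ ^ m) x = y := Nat.find_spec hm
  have m2 : ∀ k, (σ ^ k) x = y → m ≤ k := fun k h => Nat.find_min' hm h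
  have m0 : m ≠ 0 := by intro h; rw [h] at m1; exact hxy m1.symm
  have hn : ∃ n : ℕ, (σ ^ (n + 1)) x ∈ L := ⟨m - 1, by
    rw [Nat.sub_add_cancel (by omega), m1]; exact hy⟩
  set n := Nat.find hn with hndef
  have n1 : (σ ^ (n + 1)) x ∈ L := Nat.find_spec hn
  have n2 : ∀ k, k < n → (σ ^ (k + 1)) x ∉ L := fun k h => Nat.find_min hn h
  have n3 : n ≤ m - 1 := Nat.find_min' hn (by
    rw [Nat.sub_add_cancel (by omega), m1]; exact hy)
  refine ⟨_, n1, ?_, Equiv.Perm.sameCycle_pow_right.mpr (Equiv.Perm.SameCycle.refl _ _), ?_⟩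
  · intro h
    have : (σ ^ (m - (n + 1))) x = y := by
      rw [← m1]
      conv_rhs => rw [← Nat.sub_add_cancel (show n + 1 ≤ m by omega), pow_add, Equiv.Perm.mul_apply, h]
    have := m2 _ this
    omega
  · have : ∀ k, k ≤ n → τ.SameCycle (σ x) ((σ ^ (k + 1)) x) := by
      intro k
      induction k with
      | zero => intro _; simp [Equiv.Perm.SameCycle.refl]
      | succ k ih =>
        intro hk
        have h1 := ih (by omega)
        rw [pow_succ', Equiv.Perm.mul_apply, ← hτ _ (n2 k (by omega))]
        exact Equiv.Perm.sameCycle_apply_right.mpr h1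
    exact this n le_rfl

theorem lin_count {E F N : Type} [AddCommGroup E] [Module ℝ E] [FiniteDimensional ℝ E]
    [AddCommGroup F] [Module ℝ F] [FiniteDimensional ℝ F]
    [AddCommGroup N] [Module ℝ N] [FiniteDimensional ℝ N]
    (T : E →ₗ[ℝ] F) (R : N →ₗ[ℝ] E) (h : LinearMap.ker T ≤ LinearMap.range R)
    (s : F →ₗ[ℝ] ℝ) (hs : ∀ e, s (T e) = 0) (hs0 : s ≠ 0) (n0 : N) (hn : n0 ≠ 0) (hR : R n0 = 0) :
    Module.finrank ℝ E + 2 ≤ Module.finrank ℝ F + Module.finrank ℝ N := by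
  have h1 := LinearMap.finrank_range_add_finrank_ker T
  have h2 := LinearMap.finrank_range_add_finrank_ker R
  have h3 := LinearMap.finrank_range_add_finrank_ker s
  have h4 : Module.finrank ℝ (LinearMap.ker T) ≤ Module.finrank ℝ (LinearMap.range R) :=
    Submodule.finrank_mono h
  have h5 : 0 < Module.finrank ℝ (LinearMap.ker R) := by
    have : Nontrivial (LinearMap.ker R) := ⟨⟨⟨n0, hR⟩, 0, fun h => hn (congrArg Subtype.val h)⟩⟩
    exact Module.finrank_pos
  have h6 : Module.finrank ℝ (LinearMap.range T) ≤ Module.finrank ℝ (LinearMap.ker s) := by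
    apply Submodule.finrank_mono
    rintro _ ⟨e, rfl⟩
    exact hs e
  have h7 : 0 < Module.finrank ℝ (LinearMap.range s) := by
    obtain ⟨x, hx⟩ : ∃ x, s x ≠ 0 := by
      by_contra hcon; push Not at hcon; exact hs0 (LinearMap.ext hcon)
    have : Nontrivial (LinearMap.range s) := ⟨⟨⟨s x, x, rfl⟩, 0, fun h => hx (congrArg Subtype.val h)⟩⟩
    exact Module.finrank_pos
  omega

end

section
open Classical in
theorem SimpleMap.euler_le {D W : Type} [Fintype D] [Finite W] (M : SimpleMap D W) (L : Set D)
    (hne : L.Nonempty) (hα : ∀ d ∈ L, M.α d ∈ L)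
    (hL : ∀ d ∈ L, ∃ y ∈ L, y ≠ M.α d ∧ M.v y = M.v (M.α d)) :
    L.ncard + 12 ≤ 6 * (M.v '' L).ncard := by
  have hα' : ∀ d, M.α d ∈ L → d ∈ L := fun d h => by have := hα _ h; rwa [M.inv] at this
  let a : D → D := fun d => if d ∈ L then M.α d else d
  have aL : ∀ d ∈ L, a d = M.α d := fun d h => if_pos h
  have aN : ∀ d, d ∉ L → a d = d := fun d h => if_neg h
  have ainv : ∀ d, a (a d) = d := by
    intro d
    by_cases h : d ∈ L
    · rw [aL d h, aL _ (hα d h), M.inv]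
    · rw [aN d h, aN d h]
  have P : PlanarMap M.σ a := M.planar.delete M.inv ainv (fun d => by
    by_cases h : d ∈ L
    · exact Or.inr (aL d h)
    · exact Or.inl (aN d h))
  let τ : Equiv.Perm D := (Function.Involutive.toPerm a ainv).trans M.σ
  have τa : ∀ d, τ d = M.σ (a d) := fun d => rfl
  have τL : ∀ d ∈ L, τ d = M.σ (M.α d) := fun d h => by rw [τa, aL d h]
  have τN : ∀ d, d ∉ L → τ d = M.σ d := fun d h => by rw [τa, aN d h]
  let Q := Quotient (Equiv.Perm.SameCycle.setoid τ)
  let mk : D → Q := fun d => Quotient.mk _ d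
  have hmk : ∀ d e, mk d = mk e ↔ τ.SameCycle d e := fun d e => Quotient.eq
  let O : Set Q := mk '' L
  -- each orbit has at least three live darts
  have three : 3 * O.ncard ≤ L.ncard := by
    have nxt : ∀ d ∈ L, ∃ e ∈ L, e ≠ M.α d ∧ M.v e = M.v (M.α d) ∧ mk e = mk d := by
      intro d hd
      obtain ⟨y, hy, hy1, hy2⟩ := hL d hd
      obtain ⟨z, hz, hz1, hz2, hz3⟩ := next_live M.σ τ L τN (M.α d) y hy hy1 ((M.cyc _ _).2 hy2.symm)
      refine ⟨z, hz, hz1, ((M.cyc _ _).1 hz2).symm, ?_⟩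
      rw [← τL d hd] at hz3
      exact ((hmk _ _).2 (Equiv.Perm.sameCycle_apply_left.mp hz3)).symm
    have fib : ∀ q ∈ O.toFinset, 3 ≤ (L.toFinset.filter (fun d => mk d = q)).card := by
      intro q hq
      simp only [mem_toFinset] at hq
      obtain ⟨d, hd, rfl⟩ := hq
      obtain ⟨e, he, he1, he2, he3⟩ := nxt d hd
      obtain ⟨g, hg, hg1, hg2, hg3⟩ := nxt e he
      have n1 : e ≠ d := by rintro rfl; exact M.noloop _ he2.symm
      have n2 : g ≠ e := by rintro rfl; exact M.noloop _ hg2.symm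
      have n3 : g ≠ d := by
        rintro rfl
        exact he1 (M.simple _ _ he2 (by rw [M.inv, hg2]))
      have : ({d, e, g} : Finset D) ⊆ L.toFinset.filter (fun x => mk x = mk d) := by
        intro x hx
        simp only [Finset.mem_insert, Finset.mem_singleton] at hx
        simp only [Finset.mem_filter, mem_toFinset]
        rcases hx with rfl | rfl | rfl
        · exact ⟨hd, rfl⟩
        · exact ⟨he, he3⟩
        · exact ⟨hg, hg3.trans he3⟩
      have c3 : ({d, e, g} : Finset D).card = 3 := by
        rw [Finset.card_eq_three]
        exact ⟨d, e, g, n1.symm, n3.symm, n2.symm, rfl⟩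
      rw [← c3]; exact Finset.card_le_card this
    have := Finset.card_nsmul_le_sum O.toFinset _ 3 fib
    rw [← Finset.card_eq_sum_card_fiberwise] at this
    · rw [Set.ncard_eq_toFinset_card' O, Set.ncard_eq_toFinset_card' L]
      rw [smul_eq_mul] at this; omega
    · intro d hd
      simp only [coe_toFinset] at hd ⊢
      exact ⟨d, hd, rfl⟩
  -- orientation
  let idx := Fintype.equivFin D
  let Lp : Set D := {d | d ∈ L ∧ idx d < idx (M.α d)}
  have αne : ∀ d, M.α d ≠ d := fun d h => M.noloop d (by rw [h])
  have half : L.ncard = 2 * Lp.ncard := by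
    have e1 : L = Lp ∪ M.α '' Lp := by
      ext d
      constructor
      · intro hd
        rcases lt_trichotomy (idx d) (idx (M.α d)) with h | h | h
        · exact Or.inl ⟨hd, h⟩
        · exact (αne d (idx.injective h).symm).elim
        · exact Or.inr ⟨M.α d, ⟨hα d hd, by rw [M.inv]; exact h⟩, M.inv d⟩
      · rintro (h | ⟨e, he, rfl⟩)
        · exact h.1
        · exact hα _ he.1
    have e2 : Disjoint Lp (M.α '' Lp) := by
      rw [Set.disjoint_left]
      rintro _ h1 ⟨e, he, rfl⟩
      have := h1.2
      rw [M.inv] at this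
      exact lt_asymm this he.2
    have hinj : Function.Injective M.α := fun x y h => by rw [← M.inv x, h, M.inv]
    conv_lhs => rw [e1]
    rw [Set.ncard_union_eq e2, Set.ncard_image_of_injective _ hinj]; ring
  have LpL : ∀ d, d ∈ Lp → M.α d ∉ Lp := by
    intro d h1 h2
    have := h2.2
    rw [M.inv] at this
    exact lt_asymm this h1.2
  have Lpo : ∀ d ∈ L, d ∉ Lp → M.α d ∈ Lp := by
    intro d hd h
    refine ⟨hα d hd, ?_⟩
    rw [M.inv]
    rcases lt_trichotomy (idx d) (idx (M.α d)) with h' | h' | h'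
    · exact (h ⟨hd, h'⟩).elim
    · exact (αne d (idx.injective h').symm).elim
    · exact h'
  let hat : (Lp → ℝ) →ₗ[ℝ] (D → ℝ) :=
    { toFun := fun c d => if h : d ∈ Lp then c ⟨d, h⟩ else if h : M.α d ∈ Lp then - c ⟨M.α d, h⟩ else 0
      map_add' := by
        intro x y; ext d
        simp only [Pi.add_apply]
        split_ifs <;> simp [add_comm]
      map_smul' := by
        intro r x; ext d
        simp only [Pi.smul_apply, smul_eq_mul, RingHom.id_apply]
        split_ifs <;> simp }
  have hat1 : ∀ c (d : Lp), hat c d = c d := fun c d => by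
    have : d.1 ∈ Lp := d.2
    simp [hat]
  have hat2 : ∀ c d, hat c (M.α d) = - hat c d := by
    intro c d
    change dite _ _ _ = - dite _ _ _
    by_cases h1 : d ∈ Lp
    · have h2 := LpL d h1
      simp [h1, h2, M.inv]
    · by_cases h2 : M.α d ∈ Lp
      · simp [h1, h2]
      · simp [h1, h2, M.inv]
  have hat3 : ∀ c d, d ∉ L → hat c d = 0 := by
    intro c d hd
    have h1 : d ∉ Lp := fun h => hd h.1
    have h2 : M.α d ∉ Lp := fun h => hd (hα' d h.1)
    change dite _ _ _ = _
    simp [h1, h2]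
  let T : (Lp → ℝ) →ₗ[ℝ] (O → ℝ) :=
    { toFun := fun c o => ∑ d with mk d = o.1, hat c d
      map_add' := by
        intro x y; ext o
        simp only [map_add, Pi.add_apply, Finset.sum_add_distrib]
      map_smul' := by
        intro r x; ext o
        simp only [map_smul, Pi.smul_apply, smul_eq_mul, RingHom.id_apply, Finset.mul_sum] }
  have hT : ∀ c o, T c o = ∑ d with mk d = o.1, hat c d := fun c o => rfl
  let R : ((M.v '' L : Set W) → ℝ) →ₗ[ℝ] (Lp → ℝ) :=
    { toFun := fun p d => p ⟨M.v (M.α d), mem_image_of_mem M.v (hα _ d.2.1)⟩ - p ⟨M.v d, mem_image_of_mem M.v d.2.1⟩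
      map_add' := by
        intro x y; ext d
        simp only [Pi.add_apply]; ring
      map_smul' := by
        intro r x; ext o
        simp only [Pi.smul_apply, smul_eq_mul, RingHom.id_apply]; ring }
  have hR : ∀ p d, R p d = p ⟨M.v (M.α d), mem_image_of_mem M.v (hα _ d.2.1)⟩ - p ⟨M.v d, mem_image_of_mem M.v d.2.1⟩ :=
    fun p d => rfl
  let s : (O → ℝ) →ₗ[ℝ] ℝ :=
    { toFun := fun x => ∑ o, x o
      map_add' := by intro x y; simp [Finset.sum_add_distrib]
      map_smul' := by intro r x; simp [Finset.mul_sum] }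
  have out : ∀ c q, q ∉ O → ∑ d with mk d = q, hat c d = 0 := by
    intro c q hq
    apply Finset.sum_eq_zero
    intro d hd
    simp only [Finset.mem_filter, Finset.mem_univ, true_and] at hd
    apply hat3
    intro h; exact hq ⟨d, h, hd⟩
  have ker : LinearMap.ker T ≤ LinearMap.range R := by
    intro c hc
    have hc' : ∀ q, ∑ d with mk d = q, hat c d = 0 := by
      intro q
      by_cases hq : q ∈ O
      · rw [← hT c ⟨q, hq⟩, LinearMap.mem_ker.mp hc]; rfl
      · exact out c q hq
    obtain ⟨h, hh⟩ := coboundary τ (hat c) (fun d => by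
      rw [← hc' (mk d)]
      apply Finset.sum_congr _ (fun _ _ => rfl)
      ext e
      simp only [Finset.mem_filter, Finset.mem_univ, true_and]
      rw [hmk]; exact ⟨fun h => h.symm, fun h => h.symm⟩)
    obtain ⟨p, hp, hp2⟩ := P ℝ (hat c) h
      (by
        intro d hd
        apply hat3
        intro h; rw [aL d h] at hd; exact αne d hd)
      (by
        intro d
        by_cases hd : d ∈ L
        · rw [aL d hd, hat2]
        · rw [aN d hd, hat3 c d hd, neg_zero])
      hh
    have pv : ∀ d e, M.v d = M.v e → p d = p e := by
      intro d e hde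
      exact (closed_sameCycle M.σ {x | p x = p d} (fun x hx => by
        simp only [mem_ofPred_eq] at *; rw [hp, hx]) ((M.cyc d e).2 hde) rfl).symm
    refine ⟨fun w => p (Classical.choose w.2), ?_⟩
    ext d
    rw [hR, ← hat1 c d, hp2, aL _ d.2.1]
    have key : ∀ w : (M.v '' L : Set W), M.v (Classical.choose w.2) = w.1 := fun w =>
      (Classical.choose_spec w.2).2
    rw [pv _ _ (key ⟨M.v (M.α d), _⟩), pv _ _ (key ⟨M.v d, _⟩)]
  have hs : ∀ c, s (T c) = 0 := by
    intro c
    change ∑ o : O, (fun q => ∑ d with mk d = q, hat c d) o.1 = 0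
    rw [← Finset.sum_subtype O.toFinset (fun x => Set.mem_toFinset) (fun q => ∑ d with mk d = q, hat c d)]
    rw [Finset.sum_subset (Finset.subset_univ _) (fun q _ hq => out c q (fun h => hq (Set.mem_toFinset.mpr h)))]
    rw [Finset.sum_fiberwise]
    have e1 := Equiv.sum_comp (Function.Involutive.toPerm M.α M.inv) (hat c)
    have e2 : ∀ d, (Function.Involutive.toPerm M.α M.inv) d = M.α d := fun d => rfl
    simp only [e2, hat2, Finset.sum_neg_distrib] at e1
    linarith
  have fin := lin_count T R ker s hs ?_ 1 ?_ ?_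
  · have f1 : Module.finrank ℝ (Lp → ℝ) = Lp.ncard := by
      rw [Module.finrank_fintype_fun_eq_card, ← Nat.card_eq_fintype_card, Nat.card_coe_set_eq]
    have f2 : Module.finrank ℝ (O → ℝ) = O.ncard := by
      rw [Module.finrank_fintype_fun_eq_card, ← Nat.card_eq_fintype_card, Nat.card_coe_set_eq]
    have f3 : Module.finrank ℝ ((M.v '' L : Set W) → ℝ) = (M.v '' L).ncard := by
      rw [Module.finrank_fintype_fun_eq_card, ← Nat.card_eq_fintype_card, Nat.card_coe_set_eq]
    rw [f1, f2, f3] at fin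
    omega
  · obtain ⟨d, hd⟩ := hne
    intro h
    have h1 : s (Pi.single ⟨mk d, mem_image_of_mem mk hd⟩ 1) = 0 := by rw [h]; rfl
    have h2 : s (Pi.single ⟨mk d, mem_image_of_mem mk hd⟩ 1) = 1 := by
      change ∑ o : O, (Pi.single _ (1 : ℝ) : O → ℝ) o = 1
      simp
    rw [h1] at h2; exact zero_ne_one h2
  · obtain ⟨d, hd⟩ := hne
    intro h
    have := congrFun h ⟨M.v d, mem_image_of_mem M.v hd⟩
    simp at this
  · ext d
    rw [hR]; simp

end

section
/-- a simple plane triangulation -/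
structure Tri (D W F : Type) extends SimpleMap D W where
  f : D → F
  vsurj : Function.Surjective v
  fsurj : Function.Surjective f
  f_φ : ∀ d, f (toSimpleMap.φ d) = f d
  f_fib : ∀ d e, f d = f e → e = d ∨ e = toSimpleMap.φ d ∨ e = toSimpleMap.φ (toSimpleMap.φ d)
  φ3 : ∀ d, toSimpleMap.φ (toSimpleMap.φ (toSimpleMap.φ d)) = d

namespace Tri

variable {D W F : Type} (M : Tri D W F)

theorem αne (d : D) : M.α d ≠ d := fun h => M.noloop d (by rw [h])

theorem φne (d : D) : M.φ d ≠ d := fun h => M.noloop d (by rw [← M.v_φ, h])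

theorem φφne (d : D) : M.φ (M.φ d) ≠ d := fun h => M.φne (M.φ d) (by
  have := M.φ3 d
  have h2 := congrArg M.φ h
  rw [M.φ3] at h2
  rw [h, ← h2])

theorem φ_ne_α (d : D) : M.φ d ≠ M.α d := by
  intro h
  have h1 : M.v (M.φ (M.φ d)) = M.v d := by rw [M.v_φ, h, M.inv]
  have h2 : M.v (M.α (M.φ (M.φ d))) = M.v d := by rw [← M.v_φ, M.φ3]
  exact M.noloop _ (h2.trans h1.symm)

open Classical in
theorem fib_eq [Fintype D] (d : D) :
    Finset.univ.filter (fun e => M.f e = M.f d) = {d, M.φ d, M.φ (M.φ d)} := by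
  ext e
  simp only [Finset.mem_filter, Finset.mem_univ, true_and, Finset.mem_insert, Finset.mem_singleton]
  constructor
  · intro h; exact M.f_fib d e h.symm
  · rintro (rfl | rfl | rfl)
    · rfl
    · exact M.f_φ _
    · rw [M.f_φ, M.f_φ]

open Classical in
theorem sum_fib [Fintype D] {A : Type} [AddCommMonoid A] (c : D → A) (d : D) :
    ∑ e with M.f e = M.f d, c e = c d + c (M.φ d) + c (M.φ (M.φ d)) := by
  rw [M.fib_eq, Finset.sum_insert, Finset.sum_insert, Finset.sum_singleton, add_assoc]
  · simp only [Finset.mem_singleton]; exact fun h => M.φne _ h.symm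
  · simp only [Finset.mem_insert, Finset.mem_singleton, not_or]
    exact ⟨fun h => M.φne _ h.symm, fun h => M.φφne _ h.symm⟩

open Classical in
theorem card_fib [Fintype D] (x : F) : (Finset.univ.filter (fun e => M.f e = x)).card = 3 := by
  obtain ⟨d, rfl⟩ := M.fsurj x
  rw [Finset.card_eq_sum_ones, M.sum_fib]

open Classical in
theorem card_preimage [Fintype D] [Finite F] (B : Set F) : (M.f ⁻¹' B).ncard = 3 * B.ncard := by
  have := Fintype.ofFinite F
  have h := Finset.card_eq_sum_card_fiberwise (s := (M.f ⁻¹' B).toFinset) (t := B.toFinset) (f := M.f)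
    (by intro d hd; simpa using hd)
  rw [Set.ncard_eq_toFinset_card' B, Set.ncard_eq_toFinset_card' (M.f ⁻¹' B), h]
  rw [Finset.sum_congr rfl (g := fun _ => 3), Finset.sum_const, smul_eq_mul, mul_comm]
  intro x hx
  rw [← M.card_fib x]
  congr 1
  ext d
  simp only [mem_toFinset] at hx
  simp only [Finset.mem_filter, mem_toFinset, mem_preimage, Finset.mem_univ, true_and, and_iff_right_iff_imp]
  rintro rfl; exact hx

/-- faces with all vertices in `A` -/
def full (A : Set W) : Set F := {x | ∀ d, M.f d = x → M.v d ∈ A}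

theorem full_le [Fintype D] [Finite W] [Finite F] (A : Set W) (hne : (M.full A).Nonempty) :
    (M.full A).ncard + 4 ≤ 2 * A.ncard ∧ (A ≠ univ → (M.full A).ncard + 5 ≤ 2 * A.ncard) := by
  classical
  set B := M.full A with hB
  have hBv : ∀ d, M.f d ∈ B → M.v d ∈ A := fun d h => h d rfl
  let L : Set D := {d | M.f d ∈ B ∨ M.f (M.α d) ∈ B}
  have sub : M.f ⁻¹' B ⊆ L := fun d hd => Or.inl hd
  have vL : M.v '' L ⊆ A := by
    rintro _ ⟨d, h | h, rfl⟩
    · exact hBv d h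
    · have := hBv (M.φ (M.α d)) (by rw [M.f_φ]; exact h)
      rwa [M.v_φ, M.inv] at this
  have e := M.euler_le L ?_ ?_ ?_
  · have c1 := M.card_preimage B
    have c2 := Set.ncard_le_ncard sub (Set.toFinite _)
    have c3 := Set.ncard_le_ncard vL (Set.toFinite _)
    refine ⟨by omega, fun hA => ?_⟩
    by_contra hcon
    have heq : M.f ⁻¹' B = L := Set.eq_of_subset_of_ncard_le sub (by omega) (Set.toFinite _)
    have hα : ∀ d ∈ L, M.α d ∈ L := by
      rintro d (h | h)
      · exact Or.inr (by rw [M.inv]; exact h)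
      · exact Or.inl h
    have hφ : ∀ d ∈ L, M.φ d ∈ L := by
      intro d hd
      rw [← heq] at hd ⊢
      simp only [mem_preimage, M.f_φ]; exact hd
    have hu := M.conn L (by
      obtain ⟨x, hx⟩ := hne
      obtain ⟨d, rfl⟩ := M.fsurj x
      exact ⟨d, Or.inl hx⟩) (fun d hd => by
        have := hφ _ (hα _ hd)
        rwa [M.φ_apply, M.inv] at this) hα
    apply hA
    rw [hu, image_univ, M.vsurj.range_eq] at vL
    exact eq_univ_of_univ_subset vL
  · obtain ⟨x, hx⟩ := hne
    obtain ⟨d, rfl⟩ := M.fsurj x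
    exact ⟨d, Or.inl hx⟩
  · rintro d (h | h)
    · exact Or.inr (by rw [M.inv]; exact h)
    · exact Or.inl h
  · rintro d (h | h)
    · exact ⟨M.φ d, Or.inl (by rw [M.f_φ]; exact h), M.φ_ne_α d, M.v_φ d⟩
    · refine ⟨M.α (M.φ (M.φ (M.α d))), Or.inr ?_, ?_, ?_⟩
      · rw [M.inv, M.f_φ, M.f_φ]; exact h
      · intro h'
        have h2 := congrArg M.α h'
        rw [M.inv, M.inv] at h2
        have h3 := M.φ3 (M.α d)
        rw [h2] at h3
        exact M.φ_ne_α d h3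
      · rw [← M.v_φ, M.φ3]

theorem euler (M : Tri D W F) [Fintype D] [Finite W] [Finite F] [Nonempty D] : Nat.card F + 4 = 2 * Nat.card W := by
  classical
  have := Fintype.ofFinite W
  have := Fintype.ofFinite F
  have hD : Fintype.card D = 3 * Fintype.card F := by
    have := M.card_preimage univ
    rw [preimage_univ, ncard_univ, ncard_univ] at this
    simpa using this
  have h1 := (M.full_le univ ⟨M.f (Classical.arbitrary D), fun d _ => trivial⟩).1
  have hfull : M.full univ = univ := by ext x; simp [full]
  rw [hfull, ncard_univ, ncard_univ] at h1
  apply le_antisymm h1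
  let idx := Fintype.equivFin D
  let Lp : Set D := {d | idx d < idx (M.α d)}
  have half : Fintype.card D = 2 * Lp.ncard := by
    have e1 : univ = Lp ∪ M.α '' Lp := by
      ext d
      simp only [mem_univ, true_iff]
      rcases lt_trichotomy (idx d) (idx (M.α d)) with h | h | h
      · exact Or.inl h
      · exact (M.αne d (idx.injective h).symm).elim
      · refine Or.inr ⟨M.α d, ?_, M.inv d⟩
        change idx (M.α d) < idx (M.α (M.α d))
        rw [M.inv]; exact h
    have e2 : Disjoint Lp (M.α '' Lp) := by
      rw [Set.disjoint_left]
      rintro _ h1 ⟨e, he, rfl⟩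
      change idx (M.α e) < idx (M.α (M.α e)) at h1
      rw [M.inv] at h1
      exact lt_asymm h1 he
    have hinj : Function.Injective M.α := fun x y h => by rw [← M.inv x, h, M.inv]
    rw [← Nat.card_eq_fintype_card, ← Set.ncard_univ, e1, Set.ncard_union_eq e2,
      Set.ncard_image_of_injective _ hinj]; ring
  let d0 : D := Classical.arbitrary D
  let Φ : ((W → ℝ) × (F → ℝ)) →ₗ[ℝ] ((Lp → ℝ) × ℝ × ℝ) :=
    { toFun := fun x => (fun d => x.1 (M.v (M.α d)) - x.1 (M.v d) + (x.2 (M.f d) - x.2 (M.f (M.α d))),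
        x.1 (M.v d0), x.2 (M.f d0))
      map_add' := by
        intro x y; ext d <;> simp; ring
      map_smul' := by
        intro r x; ext d <;> simp; ring }
  have hΦ : Function.Injective Φ := by
    rw [injective_iff_map_eq_zero]
    rintro ⟨p, l⟩ h
    have hp0 : p (M.v d0) = 0 := congrArg (fun x => x.2.1) h
    have hl0 : l (M.f d0) = 0 := congrArg (fun x => x.2.2) h
    let r : D → ℝ := fun d => p (M.v (M.α d)) - p (M.v d)
    let s : D → ℝ := fun d => l (M.f d) - l (M.f (M.α d))
    have hLp : ∀ d ∈ Lp, r d + s d = 0 := fun d hd => congrFun (congrArg (fun x => x.1) h) ⟨d, hd⟩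
    have rα : ∀ d, r (M.α d) = - r d := fun d => by simp [r, M.inv]
    have sα : ∀ d, s (M.α d) = - s d := fun d => by simp [s, M.inv]
    have hall : ∀ d, r d + s d = 0 := by
      intro d
      rcases lt_trichotomy (idx d) (idx (M.α d)) with h | h | h
      · exact hLp d h
      · exact (M.αne d (idx.injective h).symm).elim
      · have := hLp (M.α d) (by change idx (M.α d) < idx (M.α (M.α d)); rw [M.inv]; exact h)
        rw [rα, sα] at this; linarith
    have orth : ∑ d, r d * s d = 0 := by
      have a1 : ∑ d, r d * l (M.f d) = 0 := by
        have := Equiv.sum_comp M.φ (fun d => p (M.v d) * l (M.f d))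
        have a2 : ∀ d, r d * l (M.f d) = p (M.v (M.φ d)) * l (M.f (M.φ d)) - p (M.v d) * l (M.f d) := by
          intro d; rw [M.v_φ, M.f_φ]; simp only [r]; ring
        rw [Finset.sum_congr rfl (fun d _ => a2 d), Finset.sum_sub_distrib, this, sub_self]
      have a3 : ∑ d, r d * l (M.f (M.α d)) = 0 := by
        have := Equiv.sum_comp (Function.Involutive.toPerm M.α M.inv) (fun d => r d * l (M.f (M.α d)))
        rw [← this, ← neg_eq_zero, ← Finset.sum_neg_distrib, ← a1]
        apply Finset.sum_congr rfl
        intro d _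
        change -(r (M.α d) * l (M.f (M.α (M.α d)))) = _
        rw [rα, M.inv]; ring
      simp only [s, mul_sub, Finset.sum_sub_distrib, a1, a3, sub_zero]
    have r0 : ∀ d, r d = 0 := by
      have : ∑ d, r d ^ 2 = 0 := by
        rw [← neg_eq_zero, ← Finset.sum_neg_distrib, ← orth]
        apply Finset.sum_congr rfl
        intro d _
        rw [show s d = - r d by linarith [hall d]]; ring
      intro d
      have := (Finset.sum_eq_zero_iff_of_nonneg (fun d _ => sq_nonneg (r d))).1 this d (Finset.mem_univ d)
      exact pow_eq_zero_iff (two_ne_zero) |>.1 this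
    have s0 : ∀ d, s d = 0 := fun d => by linarith [hall d, r0 d]
    have pz : ∀ d, p (M.v d) = 0 := by
      have := M.conn {d | p (M.v d) = 0} ⟨d0, hp0⟩ (fun d hd => by
        simp only [mem_ofPred_eq, M.v_σ] at *; exact hd) (fun d hd => by
        simp only [mem_ofPred_eq] at *
        have := r0 d
        simp only [r, hd] at this; linarith)
      intro d
      have h : d ∈ {d | p (M.v d) = 0} := by rw [this]; trivial
      exact h
    have lα : ∀ d, l (M.f d) = 0 → l (M.f (M.α d)) = 0 := by
      intro d hd
      have := s0 d
      simp only [s, hd] at this; linarith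
    have lz : ∀ d, l (M.f d) = 0 := by
      have := M.conn {d | l (M.f d) = 0} ⟨d0, hl0⟩ (fun d hd => by
        simp only [mem_ofPred_eq] at *
        have e1 : M.f (M.σ d) = M.f (M.α d) := by
          rw [← M.f_φ (M.α d), M.φ_apply, M.inv]
        rw [e1]; exact lα d hd) (fun d hd => lα d hd)
      intro d
      have h : d ∈ {d | l (M.f d) = 0} := by rw [this]; trivial
      exact h
    ext x
    · obtain ⟨d, rfl⟩ := M.vsurj x; exact pz d
    · obtain ⟨d, rfl⟩ := M.fsurj x; exact lz d
  have hfin := LinearMap.finrank_le_finrank_of_injective hΦ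
  have f1 : Module.finrank ℝ (Lp → ℝ) = Lp.ncard := by
    rw [Module.finrank_fintype_fun_eq_card, ← Nat.card_eq_fintype_card, Nat.card_coe_set_eq]
  rw [Module.finrank_prod, Module.finrank_prod, Module.finrank_prod, f1] at hfin
  simp only [Module.finrank_fintype_fun_eq_card, Module.finrank_self] at hfin
  rw [Nat.card_eq_fintype_card, Nat.card_eq_fintype_card]
  omega

end Tri

end

section
namespace Tri

variable {D W F : Type} (M : Tri D W F)

open Classical in
/-- the vertices of a face -/
def verts [Fintype D] (x : F) : Finset W := (Finset.univ.filter (fun d => M.f d = x)).image M.v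

theorem mem_verts [Fintype D] (d : D) : M.v d ∈ M.verts (M.f d) := by
  classical
  exact Finset.mem_image_of_mem _ (by simp)

theorem mem_verts_iff [Fintype D] (x : F) (w : W) : w ∈ M.verts x ↔ ∃ d, M.f d = x ∧ M.v d = w := by
  classical
  simp [verts]

theorem card_verts [Fintype D] (x : F) : (M.verts x).card = 3 := by
  classical
  unfold verts
  rw [Finset.card_image_of_injOn, M.card_fib]
  have step : ∀ d, M.v (M.φ d) ≠ M.v d := fun d => by rw [M.v_φ]; exact M.noloop d
  have step2 : ∀ d, M.v (M.φ (M.φ d)) ≠ M.v d := fun d h => by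
    apply step (M.φ (M.φ d)); rw [M.φ3, h]
  intro d hd e he hde
  simp only [Finset.coe_filter, Finset.mem_univ, true_and, mem_ofPred_eq] at hd he
  rcases M.f_fib d e (hd.trans he.symm) with h | h | h
  · exact h.symm
  · exact (step d (by rw [← h, hde])).elim
  · exact (step2 d (by rw [← h, hde])).elim

open Classical in
theorem count_le [Fintype D] [Fintype F] (A : Finset W) (B : Finset F) :
    (Finset.univ.filter (fun d => M.v d ∈ A ∧ M.f d ∈ B)).card ≤
      2 * B.card + (B.filter (fun x => x ∈ M.full (A : Set W))).card := by
  rw [Finset.card_eq_sum_card_fiberwise (t := B) (f := M.f) (by intro d hd; simp at hd; exact hd.2)]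
  rw [Finset.card_filter, mul_comm, ← smul_eq_mul, ← Finset.sum_const, ← Finset.sum_add_distrib]
  apply Finset.sum_le_sum
  intro x hx
  by_cases h : x ∈ M.full (A : Set W)
  · rw [if_pos h, show 2 + 1 = 3 from rfl, ← M.card_fib x]
    apply Finset.card_le_card
    intro d hd
    simp at hd ⊢; exact hd.2
  · rw [if_neg h]
    simp only [full, mem_ofPred_eq, not_forall] at h
    obtain ⟨d, hd, hA⟩ := h
    rw [add_zero, ← Nat.lt_succ_iff, Nat.succ_eq_add_one, show 2 + 1 = 3 from rfl, ← M.card_fib x]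
    apply Finset.card_lt_card
    rw [Finset.ssubset_iff_of_subset]
    · exact ⟨d, by simpa using hd, by simp; intro h; exact (hA h).elim⟩
    · intro d hd
      simp at hd ⊢; exact hd.2

open Classical in
theorem hall [Fintype D] [Fintype W] [Fintype F] (f0 : F) (A : Finset W) (B : Finset F)
    (hB : f0 ∉ B) (hne : A.Nonempty ∨ B.Nonempty) (hprop : A = Finset.univ → ∃ x ≠ f0, x ∉ B) :
    ((Finset.univ.filter (fun d => M.v d ∈ A ∧ M.f d ∈ B)).card : ℝ) <
      2 * A.card - 5 / 3 * (A ∩ M.verts f0).card + 2 * B.card := by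
  obtain ⟨d0, hd0⟩ := M.fsurj f0
  have : Nonempty D := ⟨d0⟩
  have key : ((B.filter (fun x => x ∈ M.full (A : Set W))).card : ℝ) <
      2 * A.card - 5 / 3 * (A ∩ M.verts f0).card ∨ A = ∅ := by
    rcases A.eq_empty_or_nonempty with hA | hA
    · exact Or.inr hA
    left
    have o3 : (A ∩ M.verts f0).card ≤ 3 := by
      rw [← M.card_verts f0]; exact Finset.card_le_card Finset.inter_subset_right
    have oA : (A ∩ M.verts f0).card ≤ A.card := Finset.card_le_card Finset.inter_subset_left
    have Apos := hA.card_pos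
    by_cases hU : A = Finset.univ
    · have hx := hprop hU
      obtain ⟨x, hx0, hxB⟩ := hx
      have e := M.euler
      rw [Nat.card_eq_fintype_card, Nat.card_eq_fintype_card] at e
      have c1 : (B.filter (fun x => x ∈ M.full (A : Set W))).card ≤ B.card := Finset.card_filter_le _ _
      have c2 : (insert x (insert f0 B)).card ≤ Fintype.card F := Finset.card_le_univ _
      rw [Finset.card_insert_of_notMem (by simp [hx0, hxB]), Finset.card_insert_of_notMem hB] at c2
      have c3 : A.card = Fintype.card W := by rw [hU]; rfl
      have : (B.filter (fun x => x ∈ M.full (A : Set W))).card + 6 ≤ 2 * A.card := by omega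
      have h1 : ((B.filter (fun x => x ∈ M.full (A : Set W))).card : ℝ) + 6 ≤ 2 * A.card := by
        exact_mod_cast this
      have h2 : ((A ∩ M.verts f0).card : ℝ) ≤ 3 := by exact_mod_cast o3
      linarith
    · rcases (M.full (A : Set W)).eq_empty_or_nonempty with hf | hf
      · rw [hf]
        have h2 : ((A ∩ M.verts f0).card : ℝ) ≤ A.card := by exact_mod_cast oA
        have h3 : (0 : ℝ) < A.card := by exact_mod_cast Apos
        simp; linarith
      · have e := (M.full_le (A : Set W) hf).2 (by
          intro h; apply hU; exact_mod_cast h)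
        rw [Set.ncard_coe_finset] at e
        have sub : (B.filter (fun x => x ∈ M.full (A : Set W))) ⊆ (M.full (A : Set W)).toFinset := by
          intro x hx; simp at hx ⊢; exact hx.2
        rw [Set.ncard_eq_toFinset_card'] at e
        by_cases ho : (A ∩ M.verts f0).card = 3
        · have hfull : f0 ∈ M.full (A : Set W) := by
            have : A ∩ M.verts f0 = M.verts f0 :=
              Finset.eq_of_subset_of_card_le Finset.inter_subset_right (by rw [M.card_verts, ho])
            rintro d rfl
            have h := M.mem_verts d
            rw [← this] at h
            exact_mod_cast (Finset.mem_inter.1 h).1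
          have : (B.filter (fun x => x ∈ M.full (A : Set W))).card < (M.full (A : Set W)).toFinset.card := by
            apply Finset.card_lt_card
            rw [Finset.ssubset_iff_of_subset sub]
            exact ⟨f0, by simpa using hfull, by simp [hB]⟩
          have h1 : (B.filter (fun x => x ∈ M.full (A : Set W))).card + 6 ≤ 2 * A.card := by omega
          have h1 : ((B.filter (fun x => x ∈ M.full (A : Set W))).card : ℝ) + 6 ≤ 2 * A.card := by
            exact_mod_cast h1
          rw [ho]; push_cast; linarith
        · have c := Finset.card_le_card sub
          have h1 : (B.filter (fun x => x ∈ M.full (A : Set W))).card + 5 ≤ 2 * A.card := by omega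
          have h1 : ((B.filter (fun x => x ∈ M.full (A : Set W))).card : ℝ) + 5 ≤ 2 * A.card := by
            exact_mod_cast h1
          have o2 : (A ∩ M.verts f0).card ≤ 2 := by omega
          have h2 : ((A ∩ M.verts f0).card : ℝ) ≤ 2 := by exact_mod_cast o2
          linarith
  rcases key with key | rfl
  · have h := M.count_le A B
    have h : ((Finset.univ.filter (fun d => M.v d ∈ A ∧ M.f d ∈ B)).card : ℝ) ≤
      2 * B.card + (B.filter (fun x => x ∈ M.full (A : Set W))).card := by exact_mod_cast h
    linarith
  · have : B.Nonempty := by simpa using hne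
    simpa using this

end Tri

end

section
namespace Ang

def P (s : ℝ) : ℝ := ∫ τ in (0:ℝ)..s, 2 * Real.arctan (Real.exp τ)

theorem P_deriv (s : ℝ) : HasDerivAt P (2 * Real.arctan (Real.exp s)) s := by
  have hc : Continuous (fun τ => 2 * Real.arctan (Real.exp τ)) := by fun_prop
  exact intervalIntegral.integral_hasDerivAt_right (hc.intervalIntegrable _ _)
    (hc.stronglyMeasurableAtFilter _ _) hc.continuousAt

theorem P_zero : P 0 = 0 := by simp [P]

theorem P_cont : Continuous P := continuous_iff_continuousAt.2 (fun s => (P_deriv s).continuousAt)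

theorem arctan_le (x : ℝ) (hx : 0 ≤ x) : Real.arctan x ≤ x := by
  rcases hx.eq_or_lt with rfl | h
  · simp
  · have := Real.lt_tan (Real.arctan_pos.2 h) (Real.arctan_lt_pi_div_two x)
    rw [Real.tan_arctan] at this; exact this.le

theorem P_ge0 (s : ℝ) : -2 ≤ P s := by
  have hd : ∀ x, HasDerivAt (fun s => P s - 2 * Real.exp s) (2 * Real.arctan (Real.exp x) - 2 * Real.exp x) x :=
    fun x => (P_deriv x).sub ((Real.hasDerivAt_exp x).const_mul 2)
  have anti : Antitone (fun s => P s - 2 * Real.exp s) := antitone_of_hasDerivAt_nonpos hd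
    (fun x => by have := arctan_le _ (Real.exp_pos x).le; simp; linarith)
  have mono : Monotone P := monotone_of_hasDerivAt_nonneg P_deriv
    (fun x => by have := Real.arctan_nonneg.2 (Real.exp_pos x).le; exact mul_nonneg zero_le_two this)
  rcases le_total s 0 with h | h
  · have := anti h
    simp only [P_zero, Real.exp_zero] at this
    have := Real.exp_pos s
    linarith
  · have := mono h
    rw [P_zero] at this; linarith

theorem P_geπ (s : ℝ) : Real.pi * s - 2 ≤ P s := by
  have hd : ∀ x, HasDerivAt (fun s => P s - Real.pi * s - 2 * Real.exp (-s))
      (2 * Real.arctan (Real.exp x) - Real.pi - 2 * (-Real.exp (-x))) x := fun x => by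
    have h1 := (hasDerivAt_id x).const_mul Real.pi
    have h2 := ((hasDerivAt_id x).neg.exp).const_mul 2
    simp only [id, mul_one, mul_neg] at h1 h2 ⊢
    exact ((P_deriv x).sub h1).sub h2
  have mono := monotone_of_hasDerivAt_nonneg hd (fun x => by
    have := arctan_le _ (Real.exp_pos (-x)).le
    rw [Real.exp_neg, Real.arctan_inv_of_pos (Real.exp_pos x), ← Real.exp_neg] at this
    simp; linarith)
  rcases le_total s 0 with h | h
  · have := P_ge0 s
    have : Real.pi * s ≤ 0 := mul_nonpos_of_nonneg_of_nonpos Real.pi_pos.le h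
    linarith
  · have := mono h
    simp [P_zero] at this
    have := Real.exp_pos (-s)
    linarith

set_option linter.unusedSectionVars false

variable {ι D : Type} [Fintype ι] [Fintype D] [DecidableEq ι] (s t : D → ι) (T : ι → ℝ)

def Lam (u : ι → ℝ) : ℝ := ∑ x, T x * u x - Real.pi * ∑ d, min (u (s d)) (u (t d))

def Phi (u : ι → ℝ) : ℝ := ∑ d, (P (u (t d) - u (s d)) - Real.pi * u (t d)) + ∑ x, T x * u x

theorem Lam_cont : Continuous (Lam s t T) := by unfold Lam; fun_prop

theorem Phi_cont : Continuous (Phi s t T) := by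
  unfold Phi
  refine Continuous.add (continuous_finsetSum _ fun d _ => ?_) (by fun_prop)
  exact (P_cont.comp (by fun_prop)).sub (by fun_prop)

variable {s t T}

theorem Lam_shift (htot : Real.pi * Fintype.card D = ∑ x, T x) (u : ι → ℝ) (a : ℝ) : Lam s t T (fun x => u x + a) = Lam s t T u := by
  simp only [Lam, mul_add, min_add_add_right, Finset.sum_add_distrib, ← Finset.sum_mul, ← htot]
  simp
  ring

theorem Phi_shift (htot : Real.pi * Fintype.card D = ∑ x, T x) (u : ι → ℝ) (a : ℝ) : Phi s t T (fun x => u x + a) = Phi s t T u := by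
  simp only [Phi, add_sub_add_right_eq_sub]
  simp only [mul_add, Finset.sum_add_distrib, ← Finset.sum_mul, ← htot, ← sub_sub,
    Finset.sum_sub_distrib]
  simp
  ring

theorem Phi_ge (u : ι → ℝ) : Lam s t T u - 2 * Fintype.card D ≤ Phi s t T u := by
  have h : ∀ d, -Real.pi * min (u (s d)) (u (t d)) - 2 ≤ P (u (t d) - u (s d)) - Real.pi * u (t d) := by
    intro d
    rcases le_total (u (s d)) (u (t d)) with h | h
    · rw [min_eq_left h]
      have := P_geπ (u (t d) - u (s d))
      nlinarith
    · rw [min_eq_right h]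
      have := P_ge0 (u (t d) - u (s d))
      nlinarith
  have := Finset.sum_le_sum (fun d (_ : d ∈ Finset.univ) => h d)
  simp only [Finset.sum_sub_distrib, ← Finset.mul_sum] at this
  simp at this
  simp only [Lam, Phi, Finset.sum_sub_distrib, ← Finset.mul_sum]
  linarith

theorem Lam_pos_aux (hS : ∀ S : Finset ι, S.Nonempty → S ≠ Finset.univ →
    Real.pi * (Finset.univ.filter (fun d => s d ∈ S ∧ t d ∈ S)).card < ∑ x ∈ S, T x) (n : ℕ) :
    ∀ u : ι → ℝ, (∀ x, 0 ≤ u x) → (∃ x, u x = 0) → (Finset.univ.filter (fun x => 0 < u x)).card = n →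
      0 ≤ Lam s t T u ∧ (0 < n → 0 < Lam s t T u) := by
  induction n using Nat.strong_induction_on with
  | _ n ih =>
  rintro u hu ⟨x0, hx0⟩ hn
  set S := Finset.univ.filter (fun x => 0 < u x) with hSdef
  rcases S.eq_empty_or_nonempty with h | h
  · have hz : u = fun _ => 0 := by
      funext x
      have : x ∉ S := by rw [h]; simp
      simp [hSdef] at this
      exact le_antisymm this (hu x)
    subst hz
    rw [h] at hn
    simp at hn
    exact ⟨by simp [Lam], fun h => by omega⟩
  · obtain ⟨y, hyS, hy⟩ := S.exists_min_image u h
    have hg : 0 < u y := by simpa [hSdef] using hyS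
    set u' : ι → ℝ := fun x => if x ∈ S then u x - u y else u x with hu'
    have hx0S : x0 ∉ S := by simp [hSdef, hx0]
    have z : ∀ x, x ∉ S → u x = 0 := by
      intro x hx; simp [hSdef] at hx; exact le_antisymm hx (hu x)
    have hu'0 : ∀ x, 0 ≤ u' x := by
      intro x
      simp only [hu']; split_ifs with hx
      · linarith [hy x hx]
      · exact hu x
    have hlt : (Finset.univ.filter (fun x => 0 < u' x)).card < n := by
      rw [← hn]
      apply Finset.card_lt_card
      rw [Finset.ssubset_iff_of_subset]
      · exact ⟨y, hyS, by simp [hu', hyS]⟩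
      · intro x hx
        by_contra hxS
        simp [hu', hxS, z x hxS] at hx
    have h1 := (ih _ hlt u' hu'0 ⟨x0, by simp [hu', hx0S, hx0]⟩ rfl).1
    have h2 := hS S h (fun h => hx0S (by rw [h]; simp))
    have key : Lam s t T u = Lam s t T u' + u y * (∑ x ∈ S, T x -
        Real.pi * (Finset.univ.filter (fun d => s d ∈ S ∧ t d ∈ S)).card) := by
      have e1 : ∀ x, u x = u' x + u y * (if x ∈ S then 1 else 0) := by
        intro x; simp only [hu']; split_ifs <;> ring
      have e2 : ∀ d, min (u (s d)) (u (t d)) = min (u' (s d)) (u' (t d)) +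
          u y * (if s d ∈ S ∧ t d ∈ S then 1 else 0) := by
        intro d
        by_cases a : s d ∈ S <;> by_cases b : t d ∈ S <;> simp only [hu', a, b, if_true, if_false, and_true, and_false, mul_one, mul_zero, add_zero]
        · rw [min_sub_sub_right]; ring
        · rw [z _ b, min_eq_right (hu _), min_eq_right]; linarith [hy _ a]
        · rw [z _ a, min_eq_left (hu _), min_eq_left]; linarith [hy _ b]
      simp only [Lam]
      rw [Finset.sum_congr rfl (fun d _ => e2 d), Finset.sum_congr rfl (fun x _ => by rw [e1 x])]
      simp only [mul_add, Finset.sum_add_distrib, Finset.card_filter, ← Finset.mul_sum]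
      have : ∑ i, T i * (u y * if i ∈ S then 1 else 0) = u y * ∑ x ∈ S, T x := by
        rw [Finset.mul_sum, ← Finset.sum_filter_add_sum_filter_not Finset.univ (fun i => i ∈ S)]
        rw [Finset.sum_eq_zero (s := Finset.univ.filter (fun i => i ∉ S)), add_zero]
        · simp only [Finset.filter_mem_eq_inter, Finset.univ_inter]
          exact Finset.sum_congr rfl (fun i hi => by rw [if_pos hi]; ring)
        · intro i hi
          simp at hi
          simp [hi]
      rw [this]; push_cast; ring
    have : 0 < Lam s t T u := by
      rw [key]
      have := mul_pos hg (sub_pos.2 h2)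
      linarith
    exact ⟨this.le, fun _ => this⟩

theorem Lam_pos (htot : Real.pi * Fintype.card D = ∑ x, T x) (hS : ∀ S : Finset ι, S.Nonempty → S ≠ Finset.univ →
    Real.pi * (Finset.univ.filter (fun d => s d ∈ S ∧ t d ∈ S)).card < ∑ x ∈ S, T x)
    (u : ι → ℝ) (x y : ι) (h : u x ≠ u y) : 0 < Lam s t T u := by
  have : Nonempty ι := ⟨x⟩
  obtain ⟨z, -, hz⟩ := Finset.univ.exists_min_image u ⟨x, by simp⟩
  rw [← Lam_shift htot u (- u z)]
  refine (Lam_pos_aux hS _ _ (fun w => ?_) ⟨z, by simp⟩ rfl).2 ?_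
  · linarith [hz w (by simp)]
  · rw [Finset.card_pos]
    by_contra hcon
    rw [Finset.not_nonempty_iff_eq_empty, Finset.filter_eq_empty_iff] at hcon
    have a := hcon (Finset.mem_univ x)
    have b := hcon (Finset.mem_univ y)
    have := hz x (by simp)
    have := hz y (by simp)
    apply h; linarith

theorem exists_angles [Nonempty ι] (htot : Real.pi * Fintype.card D = ∑ x, T x)
    (hS : ∀ S : Finset ι, S.Nonempty → S ≠ Finset.univ →
    Real.pi * (Finset.univ.filter (fun d => s d ∈ S ∧ t d ∈ S)).card < ∑ x ∈ S, T x) :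
    ∃ r : ι → ℝ, (∀ x, 0 < r x) ∧ ∀ x,
      ∑ d with s d = x, 2 * Real.arctan (r (t d) / r x) + ∑ d with t d = x, 2 * Real.arctan (r (s d) / r x) = T x := by
  let x0 : ι := Classical.arbitrary ι
  let K : Set (ι → ℝ) := {u | u x0 = 0} ∩ Metric.sphere 0 1
  have hclosed : IsClosed {u : ι → ℝ | u x0 = 0} := isClosed_eq (continuous_apply x0) continuous_const
  have hK : IsCompact K := (isCompact_sphere 0 1).inter_left hclosed
  have hc : ∃ c > 0, ∀ u ∈ K, c ≤ Lam s t T u := by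
    rcases K.eq_empty_or_nonempty with h | h
    · exact ⟨1, one_pos, by simp [h]⟩
    · obtain ⟨u, hu, hmin⟩ := hK.exists_isMinOn h (Lam_cont s t T).continuousOn
      refine ⟨Lam s t T u, ?_, hmin⟩
      have : ∃ y, u y ≠ 0 := by
        by_contra! hcon
        have : u = 0 := funext hcon
        have h1 := hu.2
        simp [this] at h1
      obtain ⟨y, hy⟩ := this
      exact Lam_pos htot hS u y x0 (by rw [hu.1]; exact hy)
  obtain ⟨c, hc, hcK⟩ := hc
  have hlow : ∀ u : ι → ℝ, u x0 = 0 → c * ‖u‖ ≤ Lam s t T u := by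
    intro u hu
    rcases eq_or_ne u 0 with rfl | hne
    · simp [Lam]
    · have hp := norm_pos_iff.2 hne
      have := hcK (fun x => ‖u‖⁻¹ * u x) ⟨by simp [hu], by
        have : (fun x => ‖u‖⁻¹ * u x) = ‖u‖⁻¹ • u := rfl
        rw [mem_sphere_zero_iff_norm, this, norm_smul, norm_inv, norm_norm, inv_mul_cancel₀ hp.ne']⟩
      have e : Lam s t T (fun x => ‖u‖⁻¹ * u x) = ‖u‖⁻¹ * Lam s t T u := by
        simp only [Lam, mul_sub, Finset.mul_sum]
        congr 1
        · exact Finset.sum_congr rfl (fun x _ => by ring)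
        · refine Finset.sum_congr rfl (fun x _ => ?_)
          rw [← mul_min_of_nonneg _ _ (inv_pos.2 hp).le]; ring
      rw [e, inv_mul_eq_div, le_div_iff₀ hp] at this
      exact this
  let R : ℝ := (2 * Fintype.card D + 1) / c
  have hR : c * R = 2 * Fintype.card D + 1 := by simp only [R]; field_simp
  have hR0 : 0 ≤ R := by positivity
  obtain ⟨u, hu, hmin⟩ := ((isCompact_closedBall (0 : ι → ℝ) R).inter_left hclosed).exists_isMinOn
    ⟨0, by simp, by simp [hR0]⟩ (Phi_cont s t T).continuousOn
  have hPhi0 : Phi s t T 0 = 0 := by simp [Phi, P_zero]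
  have glob : ∀ w, Phi s t T u ≤ Phi s t T w := by
    intro w
    rw [← Phi_shift htot w (- w x0)]
    by_cases hw : ‖fun x => w x + - w x0‖ ≤ R
    · exact hmin ⟨by simp, by simpa using hw⟩
    · push Not at hw
      have h0 : Phi s t T u ≤ Phi s t T 0 := hmin ⟨by simp, by simp [hR0]⟩
      have h1 := Phi_ge (s := s) (t := t) (T := T) (fun x => w x + - w x0)
      have h2 := hlow (fun x => w x + - w x0) (by simp)
      have h3 := mul_lt_mul_of_pos_left hw hc
      linarith
  refine ⟨fun x => Real.exp (u x), fun x => Real.exp_pos _, fun x => ?_⟩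
  let δ : ι → ℝ := fun y => if y = x then 1 else 0
  have hd : HasDerivAt (fun y : ℝ => Phi s t T (fun z => u z + y * δ z))
      (∑ d, (2 * Real.arctan (Real.exp (u (t d) - u (s d))) * (δ (t d) - δ (s d)) - Real.pi * δ (t d))
        + ∑ z, T z * δ z) 0 := by
    have lin : ∀ z, HasDerivAt (fun y : ℝ => u z + y * δ z) (δ z) 0 := fun z => by
      simpa using ((hasDerivAt_id (0:ℝ)).mul_const (δ z)).const_add (u z)
    unfold Phi
    refine HasDerivAt.add ?_ ?_
    · refine HasDerivAt.fun_sum (fun d _ => ?_)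
      refine HasDerivAt.sub ?_ ((lin _).const_mul _)
      have := P_deriv ((u (t d) + 0 * δ (t d)) - (u (s d) + 0 * δ (s d)))
      have h2 := HasDerivAt.comp (0 : ℝ) this ((lin (t d)).sub (lin (s d)))
      simp only [zero_mul, add_zero] at h2
      exact h2
    · exact HasDerivAt.fun_sum (fun z _ => (lin z).const_mul _)
  have hz := IsLocalMin.hasDerivAt_eq_zero (Filter.Eventually.of_forall (fun y => by
    simpa using glob _)) hd
  have eT : ∑ z, T z * δ z = T x := by simp [δ]
  rw [eT] at hz
  have pt : ∀ d, 2 * Real.arctan (Real.exp (u (t d) - u (s d))) * (δ (t d) - δ (s d)) - Real.pi * δ (t d)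
      = - ((if s d = x then 2 * Real.arctan (Real.exp (u (t d)) / Real.exp (u x)) else 0) +
        (if t d = x then 2 * Real.arctan (Real.exp (u (s d)) / Real.exp (u x)) else 0)) := by
    intro d
    have e1 : Real.exp (u (t d) - u (s d)) = Real.exp (u (t d)) / Real.exp (u (s d)) := Real.exp_sub _ _
    have e2 : Real.arctan (Real.exp (u (s d)) / Real.exp (u (t d))) =
        Real.pi / 2 - Real.arctan (Real.exp (u (t d)) / Real.exp (u (s d))) := by
      rw [← Real.arctan_inv_of_pos (by positivity), inv_div]
    rw [e1]
    simp only [δ]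
    by_cases a : s d = x <;> by_cases b : t d = x <;> simp only [a, b, if_true, if_false] <;>
      (try rw [a] at e2) <;> (try rw [b] at e2) <;> linarith
  rw [Finset.sum_congr rfl (fun d _ => pt d), Finset.sum_neg_distrib, Finset.sum_add_distrib] at hz
  rw [Finset.sum_filter, Finset.sum_filter]
  linarith

end Ang

end

section
namespace Tri

variable {D W F : Type}

theorem sum_sub {D : Type} [Fintype D] (p q : D → Prop) [DecidablePred p] [DecidablePred q] (g : D → ℝ) :
    ∑ e : {d // p d} with q e.1, g e.1 = ∑ d with q d, if p d then g d else 0 := by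
  rw [Finset.sum_filter, Finset.sum_filter,
    ← Finset.sum_subtype (Finset.univ.filter p) (by simp) (fun d => if q d then g d else 0), Finset.sum_filter]
  refine Finset.sum_congr rfl (fun d _ => ?_)
  split_ifs <;> rfl

open Classical in
theorem exists_radii [Fintype D] [Fintype W] [Fintype F] (M : Tri D W F) (f0 : F) :
    ∃ (R : W → ℝ) (ρ : F → ℝ), (∀ w, 0 < R w) ∧ (∀ x, 0 < ρ x) ∧
      (∀ x, x ≠ f0 → ∑ d with M.f d = x, 2 * Real.arctan (ρ (M.f d) / R (M.v d)) = Real.pi) ∧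
      (∀ w, ∑ d with M.v d = w, (if M.f d ≠ f0 then 2 * Real.arctan (ρ (M.f d) / R (M.v d)) else 5 * Real.pi / 3)
        = 2 * Real.pi) := by
  obtain ⟨d0, hd0⟩ := M.fsurj f0
  have : Nonempty D := ⟨d0⟩
  let E := {d // M.f d ≠ f0}
  let X := {x // x ≠ f0}
  have : Nonempty (W ⊕ X) := ⟨Sum.inl (M.v d0)⟩
  let s : E → W ⊕ X := fun d => Sum.inl (M.v d.1)
  let t : E → W ⊕ X := fun d => Sum.inr ⟨M.f d.1, d.2⟩
  let T : W ⊕ X → ℝ := Sum.elim (fun w => Real.pi * (2 - if w ∈ M.verts f0 then 5 / 3 else 0)) (fun _ => Real.pi * 2)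
  have hTS : ∀ S : Finset (W ⊕ X), ∑ x ∈ S, T x = Real.pi * (2 * S.toLeft.card - 5 / 3 * (S.toLeft ∩ M.verts f0).card
      + 2 * S.toRight.card) := by
    intro S
    rw [Finset.sum_sum_eq_sum_toLeft_add_sum_toRight]
    simp only [T, Sum.elim_inl, Sum.elim_inr, ← Finset.mul_sum, Finset.sum_sub_distrib, Finset.sum_const,
      nsmul_eq_mul, Finset.sum_ite_mem]
    ring
  have e := M.euler
  rw [Nat.card_eq_fintype_card, Nat.card_eq_fintype_card] at e
  have cX : (Fintype.card X) + 1 = Fintype.card F := by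
    have := Fintype.card_subtype_compl (fun x => x = f0)
    have h2 : 0 < Fintype.card F := Fintype.card_pos_iff.2 ⟨f0⟩
    simp only [Fintype.card_subtype_eq] at this
    change Fintype.card X = _ at this
    omega
  have cE : Fintype.card E = 3 * Fintype.card X := by
    have h1 : Fintype.card E = (M.f ⁻¹' {x | x ≠ f0}).ncard := by
      rw [← Nat.card_eq_fintype_card]; rfl
    have h2 : Fintype.card X = ({x : F | x ≠ f0}).ncard := by
      rw [← Nat.card_eq_fintype_card]; rfl
    rw [h1, M.card_preimage, h2]
  have key := Ang.exists_angles (s := s) (t := t) (T := T) ?_ ?_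
  · obtain ⟨r, hr, hrT⟩ := key
    let ρ : F → ℝ := fun x => if h : x ≠ f0 then r (Sum.inr ⟨x, h⟩) else 1
    refine ⟨fun w => r (Sum.inl w), ρ, fun w => hr _, fun x => ?_, fun x hx => ?_, fun w => ?_⟩
    · simp only [ρ]; split_ifs
      · exact hr _
      · exact one_pos
    · have h := hrT (Sum.inr ⟨x, hx⟩)
      rw [Finset.sum_eq_zero (s := Finset.univ.filter (fun d => s d = Sum.inr ⟨x, hx⟩)) (by intro d hd; simp [s] at hd),
        zero_add] at h
      have h2 : ∑ d with t d = Sum.inr ⟨x, hx⟩, 2 * Real.arctan (r (s d) / r (Sum.inr ⟨x, hx⟩)) =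
          ∑ e : E with M.f e.1 = x, (fun d => 2 * Real.arctan (r (Sum.inl (M.v d)) / ρ x)) e.1 := by
        refine Finset.sum_congr ?_ (fun d hd => ?_)
        · ext d; simp only [Finset.mem_filter, Finset.mem_univ, true_and, t, Sum.inr.injEq]; exact Subtype.ext_iff
        · simp [s, ρ, hx]
      replace h := (sum_sub (fun d => M.f d ≠ f0) (fun d => M.f d = x)
        (fun d => 2 * Real.arctan (r (Sum.inl (M.v d)) / ρ x))).symm.trans (h2.symm.trans h)
      have hρ : 0 < ρ x := by simp only [ρ, dif_pos hx]; exact hr _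
      have h3 : ∑ d with M.f d = x, (if M.f d ≠ f0 then 2 * Real.arctan (r (Sum.inl (M.v d)) / ρ x) else 0) =
          ∑ d with M.f d = x, (Real.pi - 2 * Real.arctan (ρ (M.f d) / r (Sum.inl (M.v d)))) := by
        refine Finset.sum_congr rfl (fun d hd => ?_)
        simp only [Finset.mem_filter, Finset.mem_univ, true_and] at hd
        rw [if_pos (by rw [hd]; exact hx), hd, ← inv_div, Real.arctan_inv_of_pos (div_pos hρ (hr _))]
        ring
      rw [h3, Finset.sum_sub_distrib, Finset.sum_const, M.card_fib] at h
      simp only [T, Sum.elim_inr] at h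
      simp only [nsmul_eq_mul, Nat.cast_ofNat] at h
      linarith
    · have h := hrT (Sum.inl w)
      rw [Finset.sum_eq_zero (s := Finset.univ.filter (fun d => t d = Sum.inl w)) (by intro d hd; simp [t] at hd),
        add_zero] at h
      have h2 : ∑ d with s d = Sum.inl w, 2 * Real.arctan (r (t d) / r (Sum.inl w)) =
          ∑ e : E with M.v e.1 = w, (fun d => 2 * Real.arctan (ρ (M.f d) / r (Sum.inl (M.v d)))) e.1 := by
        refine Finset.sum_congr ?_ (fun d hd => ?_)
        · ext d; simp [s]
        · simp only [Finset.mem_filter, Finset.mem_univ, true_and, s, Sum.inl.injEq] at hd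
          simp only [t, ρ, dif_pos d.2, hd]
      replace h := (sum_sub (fun d => M.f d ≠ f0) (fun d => M.v d = w)
        (fun d => 2 * Real.arctan (ρ (M.f d) / r (Sum.inl (M.v d))))).symm.trans (h2.symm.trans h)
      have h3 : ∀ d, (if M.f d ≠ f0 then 2 * Real.arctan (ρ (M.f d) / r (Sum.inl (M.v d))) else 5 * Real.pi / 3)
          = (if M.f d ≠ f0 then 2 * Real.arctan (ρ (M.f d) / r (Sum.inl (M.v d))) else 0)
           + (if M.f d = f0 then 5 * Real.pi / 3 else 0) := by
        intro d
        by_cases hh : M.f d = f0 <;> simp [hh]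
      rw [Finset.sum_congr rfl (fun d _ => h3 d), Finset.sum_add_distrib, h]
      have h4 : ∑ d with M.v d = w, (if M.f d = f0 then 5 * Real.pi / 3 else 0) =
          if w ∈ M.verts f0 then 5 * Real.pi / 3 else 0 := by
        rw [← Finset.sum_filter, Finset.filter_filter]
        split_ifs with hw
        · rw [M.mem_verts_iff] at hw
          obtain ⟨d, hd, rfl⟩ := hw
          have : Finset.univ.filter (fun e => M.v e = M.v d ∧ M.f e = f0) = {d} := by
            have cv := M.card_verts f0
            have cf := M.card_fib f0
            unfold verts at cv
            rw [← cf, Finset.card_image_iff] at cv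
            ext e
            simp only [Finset.mem_filter, Finset.mem_univ, true_and, Finset.mem_singleton]
            constructor
            · rintro ⟨h1, h2⟩
              exact cv (by simpa using h2) (by simpa using hd) h1
            · rintro rfl; exact ⟨rfl, hd⟩
          rw [this, Finset.sum_singleton]
        · rw [Finset.sum_eq_zero]
          intro d hd
          simp only [Finset.mem_filter, Finset.mem_univ, true_and] at hd
          exact (hw ((M.mem_verts_iff _ _).2 ⟨d, hd.2, hd.1⟩)).elim
      rw [h4]
      simp only [T, Sum.elim_inl]
      split_ifs <;> ring
  · rw [hTS, cE]
    simp only [Finset.toLeft_univ, Finset.toRight_univ, Finset.univ_inter, M.card_verts, Finset.card_univ]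
    have h1 : (Fintype.card X : ℝ) + 5 = 2 * Fintype.card W := by
      have : Fintype.card X + 5 = 2 * Fintype.card W := by omega
      exact_mod_cast this
    push_cast
    rw [← h1]
    ring
  · intro S hS hSu
    rw [hTS]
    refine mul_lt_mul_of_pos_left ?_ Real.pi_pos
    have h := M.hall f0 S.toLeft (S.toRight.map ⟨fun x : X => x.1, Subtype.val_injective⟩) (by simp [X]) ?_ ?_
    · rw [Finset.card_map] at h
      refine lt_of_le_of_lt ?_ h
      norm_cast
      rw [← Finset.card_map ⟨fun e : E => e.1, Subtype.val_injective⟩]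
      apply Finset.card_le_card
      intro d hd
      simp only [Finset.mem_map, Finset.mem_filter, Finset.mem_univ, true_and, Function.Embedding.coeFn_mk] at hd ⊢
      obtain ⟨e, ⟨h1, h2⟩, rfl⟩ := hd
      exact ⟨Finset.mem_toLeft.2 h1, ⟨⟨M.f e.1, e.2⟩, Finset.mem_toRight.2 h2, rfl⟩⟩
    · obtain ⟨x | x, hx⟩ := hS
      · exact Or.inl ⟨x, Finset.mem_toLeft.2 hx⟩
      · refine Or.inr ⟨x.1, ?_⟩
        simp only [Finset.mem_map, Function.Embedding.coeFn_mk]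
        exact ⟨x, Finset.mem_toRight.2 hx, rfl⟩
    · intro hA
      by_contra! hcon
      apply hSu
      rw [Finset.eq_univ_iff_forall]
      rintro (w | x)
      · rw [← Finset.mem_toLeft, hA]; simp
      · have := hcon x.1 x.2
        simp only [Finset.mem_map, Function.Embedding.coeFn_mk] at this
        obtain ⟨y, hy, hxy⟩ := this
        rw [← Subtype.ext hxy]
        exact Finset.mem_toRight.1 hy

end Tri

end

section
namespace Tri

variable {D W F : Type}

theorem integrate [Fintype D] (M : Tri D W F) {A : Type} [AddCommGroup A] (g : D → A)
    (h1 : ∀ d, g (M.α d) = - g d) (h2 : ∀ d, g d + g (M.φ d) + g (M.φ (M.φ d)) = 0) :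
    ∃ p : W → A, ∀ d, g d = p (M.v (M.α d)) - p (M.v d) := by
  classical
  have ex := coboundary M.φ g ?_
  · obtain ⟨h, hh⟩ := ex
    obtain ⟨p, hp, hp2⟩ := M.planar A g h (fun d hd => (M.αne d hd).elim) h1 hh
    have const : ∀ d e, M.v d = M.v e → p d = p e := by
      intro d e hde
      have := closed_sameCycle M.σ {x | p x = p e} (fun x hx => by
        simp only [mem_ofPred_eq, hp] at *; exact hx) ((M.cyc e d).2 hde.symm) rfl
      exact this
    refine ⟨fun w => p (Classical.choose (M.vsurj w)), fun d => ?_⟩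
    rw [hp2 d]
    congr 1
    · exact const _ _ (Classical.choose_spec (M.vsurj (M.v (M.α d)))).symm
    · exact const _ _ (Classical.choose_spec (M.vsurj (M.v d))).symm
  · intro d
    rw [← h2 d, ← M.sum_fib]
    congr 1
    ext e
    simp only [Finset.mem_filter, Finset.mem_univ, true_and]
    constructor
    · intro h
      exact closed_sameCycle M.φ {x | M.f x = M.f d} (fun x hx => by
        simp only [mem_ofPred_eq, M.f_φ] at *; exact hx) h rfl
    · intro h
      rcases M.f_fib d e h.symm with rfl | rfl | rfl
      · exact Equiv.Perm.SameCycle.refl _ _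
      · exact ⟨1, by simp⟩
      · exact ⟨2, by simp [pow_two]⟩

theorem two_arctan (r ρ : ℝ) (hr : 0 < r) :
    Complex.exp ((2 * Real.arctan (ρ / r) : ℝ) * Complex.I) * (r - ρ * Complex.I) = r + ρ * Complex.I := by
  have hq : 0 < √(1 + (ρ / r) ^ 2) := by positivity
  have h1 : Complex.exp ((Real.arctan (ρ / r) : ℝ) * Complex.I) = (r + ρ * Complex.I) / (r * √(1 + (ρ / r) ^ 2) : ℝ) := by
    rw [Complex.exp_mul_I, ← Complex.ofReal_cos, ← Complex.ofReal_sin, Real.cos_arctan, Real.sin_arctan]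
    have h1 : (r : ℂ) ≠ 0 := by exact_mod_cast hr.ne'
    have h2 : ((√(1 + (ρ / r) ^ 2) : ℝ) : ℂ) ≠ 0 := by exact_mod_cast hq.ne'
    push_cast at *
    field_simp
  have h2 : (r * √(1 + (ρ / r) ^ 2)) ^ 2 = r ^ 2 + ρ ^ 2 := by
    rw [mul_pow, Real.sq_sqrt (by positivity)]; field_simp
  have h3 : Complex.exp ((2 * Real.arctan (ρ / r) : ℝ) * Complex.I) = (r + ρ * Complex.I) ^ 2 / (r ^ 2 + ρ ^ 2 : ℝ) := by
    rw [← h2, Complex.ofReal_pow, ← div_pow, ← h1, ← Complex.exp_nat_mul]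
    congr 1; push_cast; ring
  rw [h3]
  have h4 : ((r ^ 2 + ρ ^ 2 : ℝ) : ℂ) ≠ 0 := by
    have : r ^ 2 + ρ ^ 2 ≠ 0 := by positivity
    exact_mod_cast this
  have h5 : ((r : ℂ) + ρ * Complex.I) * (r - ρ * Complex.I) = (r ^ 2 + ρ ^ 2 : ℝ) := by
    push_cast; ring_nf; rw [Complex.I_sq]; ring
  field_simp
  rw [← h5]; ring

/-- planar layout of a triangulation with circles -/
structure Layout [Fintype D] (M : Tri D W F) (f0 : F) where
  R : W → ℝ
  ρ : F → ℝ
  b : D → ℝ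
  U : D → ℂ
  c : W → ℂ
  Rpos : ∀ w, 0 < R w
  ρpos : ∀ x, 0 < ρ x
  b_in : ∀ d, M.f d ≠ f0 → b d = 2 * Real.arctan (ρ (M.f d) / R (M.v d))
  b_out : ∀ d, M.f d = f0 → b d = 5 * Real.pi / 3
  U_norm : ∀ d, ‖U d‖ = 1
  U_α : ∀ d, U (M.α d) = - U d
  U_σ : ∀ d, U (M.σ d) = U d * Complex.exp (b (M.σ d) * Complex.I)
  c_α : ∀ d, c (M.v (M.α d)) = c (M.v d) + (R (M.v d) + R (M.v (M.α d))) * U d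
  b_sum : ∀ d, ∑ e ∈ (Set.toFinite {e | M.v e = M.v d}).toFinset, b e = 2 * Real.pi

theorem exists_layout [Fintype D] [Finite W] [Finite F] (M : Tri D W F) (f0 : F) : Nonempty (M.Layout f0) := by
  classical
  have := Fintype.ofFinite W
  have := Fintype.ofFinite F
  obtain ⟨R, ρ, Rpos, ρpos, hface, hvert⟩ := M.exists_radii f0
  set b : D → ℝ := fun d => if M.f d ≠ f0 then 2 * Real.arctan (ρ (M.f d) / R (M.v d)) else 5 * Real.pi / 3 with hb
  have hb1 : ∀ d, M.f d ≠ f0 → b d = 2 * Real.arctan (ρ (M.f d) / R (M.v d)) := fun d h => by simp [hb, h]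
  have hb2 : ∀ d, M.f d = f0 → b d = 5 * Real.pi / 3 := fun d h => by simp [hb, h]
  have ex := coboundary M.σ (fun d => ((b (M.σ d) : ℝ) : Real.Angle)) ?_
  · obtain ⟨ω0, hω0⟩ := ex
    have ππ : (Real.pi : Real.Angle) + Real.pi = 0 := Real.Angle.coe_pi_add_coe_pi
    have fsum : ∀ d, ((b d + b (M.φ d) + b (M.φ (M.φ d)) : ℝ) : Real.Angle) = Real.pi := by
      intro d
      by_cases h : M.f d = f0
      · rw [hb2 d h, hb2 _ (by rw [M.f_φ]; exact h), hb2 _ (by rw [M.f_φ, M.f_φ]; exact h)]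
        rw [Real.Angle.angle_eq_iff_two_pi_dvd_sub]
        exact ⟨2, by push_cast; ring⟩
      · have h' := hface _ h
        rw [M.sum_fib] at h'
        rw [hb1 d h, hb1 _ (by rw [M.f_φ]; exact h), hb1 _ (by rw [M.f_φ, M.f_φ]; exact h), h']
    have ex2 := M.integrate (fun d => (Real.pi : Real.Angle) + (ω0 d - ω0 (M.α d))) ?_ ?_
    · obtain ⟨p, hp⟩ := ex2
      set ω : D → Real.Angle := fun d => ω0 d + p (M.v d) with hω
      have ωα : ∀ d, ω (M.α d) = ω d + Real.pi := by
        intro d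
        have := hp d
        rw [eq_sub_iff_add_eq] at this
        simp only [hω, ← this]; abel
      have ωσ : ∀ d, ω (M.σ d) = ω d + b (M.σ d) := by
        intro d
        have := hω0 d
        simp only [hω, M.v_σ, this]; abel
      set U : D → ℂ := fun d => ((ω d).toCircle : ℂ) with hU
      have Uα : ∀ d, U (M.α d) = - U d := fun d => by
        simp only [hU, ωα, Real.Angle.toCircle_add, Circle.coe_mul, Real.Angle.toCircle_coe, Circle.coe_exp]
        simp
      have Uσ : ∀ d, U (M.σ d) = U d * Complex.exp (b (M.σ d) * Complex.I) := fun d => by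
        simp only [hU, ωσ, Real.Angle.toCircle_add, Circle.coe_mul, Real.Angle.toCircle_coe, Circle.coe_exp]
      let g : D → ℂ := fun d => (R (M.v d) + R (M.v (M.α d))) * U d
      have gα : ∀ d, g (M.α d) = - g d := fun d => by
        simp only [g, M.inv, Uα]; ring
      have gin : ∀ d, M.f d ≠ f0 → g d + g (M.φ d) + g (M.φ (M.φ d)) = 0 := by
        have stp : ∀ d, M.f d ≠ f0 → g d = U d * (R (M.v d) - ρ (M.f d) * Complex.I) -
            U (M.φ d) * (R (M.v (M.φ d)) - ρ (M.f (M.φ d)) * Complex.I) := by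
          intro d hd
          have hd' : M.f (M.φ d) ≠ f0 := by rw [M.f_φ]; exact hd
          have h1 : U (M.φ d) = - U d * Complex.exp (b (M.φ d) * Complex.I) := by
            rw [M.φ_apply, Uσ, Uα]
          rw [h1, hb1 _ hd', mul_assoc, two_arctan _ _ (Rpos _), M.f_φ, M.v_φ]
          simp only [g]; ring
        intro d hd
        have h1 := stp d hd
        have h2 := stp (M.φ d) (by rw [M.f_φ]; exact hd)
        have h3 := stp (M.φ (M.φ d)) (by rw [M.f_φ, M.f_φ]; exact hd)
        rw [M.φ3] at h3
        rw [h1, h2, h3]; ring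
      have ex3 := M.integrate g gα ?_
      · obtain ⟨c, hc⟩ := ex3
        refine ⟨⟨R, ρ, b, U, c, Rpos, ρpos, hb1, hb2, fun d => ?_, Uα, Uσ, fun d => ?_, fun d => ?_⟩⟩
        · exact Circle.norm_coe _
        · have := hc d
          rw [eq_sub_iff_add_eq] at this
          rw [← this]; simp only [g]; ring
        · rw [← hvert (M.v d)]
          refine Finset.sum_congr ?_ (fun e _ => rfl)
          ext e; simp
      · intro d
        by_cases hd : M.f d = f0
        · have tot : ∑ d, g d = 0 := by
            have := Equiv.sum_comp (Function.Involutive.toPerm M.α M.inv) g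
            have h2 : ∑ d, g ((Function.Involutive.toPerm M.α M.inv) d) = - ∑ d, g d := by
              rw [← Finset.sum_neg_distrib]
              exact Finset.sum_congr rfl (fun d _ => gα d)
            rw [h2] at this
            exact self_eq_neg.1 this.symm
          rw [← Finset.sum_fiberwise Finset.univ M.f, Finset.sum_eq_single f0] at tot
          · rw [← hd, M.sum_fib] at tot; exact tot
          · intro x _ hx
            obtain ⟨e, rfl⟩ := M.fsurj x
            rw [M.sum_fib]; exact gin e hx
          · simp
        · exact gin d hd
    · intro d
      simp only [M.inv]
      rw [eq_neg_iff_add_eq_zero, ← ππ]; abel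
    · intro d
      have stp : ∀ d, (Real.pi : Real.Angle) + (ω0 d - ω0 (M.α d)) = Real.pi + b (M.φ d) + (ω0 d - ω0 (M.φ d)) := by
        intro d
        have := hω0 (M.α d)
        rw [M.φ_apply, this]; abel
      rw [stp d, stp (M.φ d), stp (M.φ (M.φ d)), M.φ3]
      have := fsum d
      rw [Real.Angle.coe_add, Real.Angle.coe_add] at this
      have h4 : (Real.pi : Real.Angle) + Real.pi + (Real.pi + (b d + b (M.φ d) + b (M.φ (M.φ d)))) = 0 := by
        rw [this, ππ, zero_add]
      rw [← h4]; abel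
  · intro d
    have h1 : ∀ e, M.σ.SameCycle d e ↔ M.v e = M.v d := fun e => by rw [M.cyc, eq_comm]
    simp only [h1]
    have h2 : ∑ e with M.v e = M.v d, ((b (M.σ e) : ℝ) : Real.Angle) = ∑ e with M.v e = M.v d, ((b e : ℝ) : Real.Angle) := by
      rw [Finset.sum_filter, Finset.sum_filter, ← Equiv.sum_comp M.σ (fun e => if M.v e = M.v d then ((b e : ℝ) : Real.Angle) else 0)]
      simp only [M.v_σ]
    have h3 := hvert (M.v d)
    rw [h2]
    have := congrArg (fun x : ℝ => (x : Real.Angle)) h3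
    simp only [Real.Angle.coe_two_pi] at this
    rw [← this]
    exact (map_sum Real.Angle.coeHom _ _).symm

end Tri

end

section
/-- twice the signed area of the triangle `p a b` -/
def cr (p a b : ℂ) : ℝ := (starRingEnd ℂ (a - p) * (b - p)).im

theorem cr_eq (p a b : ℂ) : cr p a b = (a.re - p.re) * (b.im - p.im) - (a.im - p.im) * (b.re - p.re) := by
  simp [cr]; ring

def wnd (p a b : ℂ) : ℝ := Complex.arg ((b - p) / (a - p))

theorem cr_im (p a b : ℂ) : ((b - p) / (a - p)).im = cr p a b / Complex.normSq (a - p) := by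
  rw [cr_eq, Complex.div_im]; simp only [Complex.sub_re, Complex.sub_im]; ring

theorem cr_ne {p a b : ℂ} (h : cr p a b ≠ 0) : a - p ≠ 0 ∧ b - p ≠ 0 := by
  constructor <;> (intro h0; apply h; simp [cr, h0])

theorem wnd_abs {p a b : ℂ} (h : cr p a b ≠ 0) : |wnd p a b| < Real.pi := by
  have h1 := (cr_ne h).1
  have : ((b - p) / (a - p)).im ≠ 0 := by
    rw [cr_im]; exact div_ne_zero h (by simpa using h1)
  rw [abs_lt]
  exact ⟨Complex.neg_pi_lt_arg _, Complex.arg_lt_pi_iff.2 (Or.inr this)⟩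

theorem wnd_neg {p a b : ℂ} (h : cr p a b ≠ 0) : wnd p b a = - wnd p a b := by
  have := wnd_abs h
  unfold wnd at *
  rw [← inv_div, Complex.arg_inv, if_neg]
  intro h; rw [h, abs_of_pos Real.pi_pos] at this; exact lt_irrefl _ this

theorem wnd_pos {p a b : ℂ} (h : 0 < cr p a b) : 0 < wnd p a b := by
  have h1 := (cr_ne h.ne').1
  have h2 : 0 < ((b - p) / (a - p)).im := by
    rw [cr_im]; exact div_pos h (by simpa [Complex.normSq_pos] using h1)
  refine lt_of_le_of_ne (Complex.arg_nonneg_iff.2 h2.le) (fun h => ?_)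
  have := (Complex.arg_eq_zero_iff.1 h.symm).2
  exact h2.ne' this

theorem wnd_sum {p a b c : ℂ} (h1 : a - p ≠ 0) (h2 : b - p ≠ 0) (h3 : c - p ≠ 0) :
    ∃ k : ℤ, wnd p a b + wnd p b c + wnd p c a = 2 * Real.pi * k := by
  have : ((wnd p a b + wnd p b c + wnd p c a : ℝ) : Real.Angle) = (0 : ℝ) := by
    unfold wnd
    rw [Real.Angle.coe_add, Real.Angle.coe_add, ← Complex.arg_mul_coe_angle (div_ne_zero h2 h1) (div_ne_zero h3 h2),
      ← Complex.arg_mul_coe_angle (mul_ne_zero (div_ne_zero h2 h1) (div_ne_zero h3 h2)) (div_ne_zero h1 h3)]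
    have : (b - p) / (a - p) * ((c - p) / (b - p)) * ((a - p) / (c - p)) = 1 := by field_simp
    rw [this]; simp
  rw [Real.Angle.angle_eq_iff_two_pi_dvd_sub] at this
  simpa using this

theorem tri_pos {p a b c : ℂ} (h1 : 0 < cr p a b) (h2 : 0 < cr p b c) (h3 : 0 < cr p c a) :
    2 * Real.pi ≤ wnd p a b + wnd p b c + wnd p c a := by
  obtain ⟨k, hk⟩ := wnd_sum (cr_ne h1.ne').1 (cr_ne h2.ne').1 (cr_ne h3.ne').1
  have p1 := wnd_pos h1
  have p2 := wnd_pos h2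
  have p3 := wnd_pos h3
  have hp := Real.pi_pos
  have : (0 : ℝ) < k := by
    by_contra hcon
    push Not at hcon
    nlinarith
  have : (1 : ℤ) ≤ k := by exact_mod_cast this
  have : (1 : ℝ) ≤ k := by exact_mod_cast this
  rw [hk]; nlinarith

theorem tri_nonneg {p a b c : ℂ} (h : 0 < cr a b c) (h1 : cr p a b ≠ 0) (h2 : cr p b c ≠ 0) (h3 : cr p c a ≠ 0) :
    0 ≤ wnd p a b + wnd p b c + wnd p c a := by
  obtain ⟨k, hk⟩ := wnd_sum (cr_ne h1).1 (cr_ne h2).1 (cr_ne h3).1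
  have a1 := abs_lt.1 (wnd_abs h1)
  have a2 := abs_lt.1 (wnd_abs h2)
  have a3 := abs_lt.1 (wnd_abs h3)
  have hp := Real.pi_pos
  have tot : cr p a b + cr p b c + cr p c a = cr a b c := by simp only [cr_eq]; ring
  rw [hk]
  by_contra hcon
  push Not at hcon
  have : (k : ℝ) < 0 := by by_contra hk0; push Not at hk0; nlinarith
  have : k ≤ -1 := by
    have : k < 0 := by exact_mod_cast this
    omega
  have : (k : ℝ) ≤ -1 := by exact_mod_cast this
  have hs : wnd p a b + wnd p b c + wnd p c a ≤ - (2 * Real.pi) := by rw [hk]; nlinarith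
  have ex : 0 < cr p a b ∨ 0 < cr p b c ∨ 0 < cr p c a := by
    by_contra! hc
    linarith [hc.1, hc.2.1, hc.2.2]
  rcases ex with e | e | e <;> have := wnd_pos e <;> linarith

theorem cr_distinct {a b c : ℂ} (h : 0 < cr a b c) : a ≠ b ∧ b ≠ c ∧ c ≠ a := by
  refine ⟨?_, ?_, ?_⟩ <;> (rintro rfl; simp [cr_eq] at h)
  all_goals exact absurd h (by ring_nf; simp)

theorem exists_generic (S : Set ℂ) (hS : S.Finite) (O : Set ℂ) (hO : IsOpen O) (hne : O.Nonempty) :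
    ∃ p ∈ O, ∀ a ∈ S, ∀ b ∈ S, a ≠ b → cr p a b ≠ 0 := by
  have hfin := hS.to_subtype
  let f : S × S → Set ℂ := fun x => {p | x.1.1 ≠ x.2.1 → cr p x.1.1 x.2.1 ≠ 0}
  have hcont : ∀ a b, Continuous (fun p => cr p a b) := by
    intro a b; unfold cr; fun_prop
  have hopen : ∀ x, IsOpen (f x) := by
    intro x
    by_cases h : x.1.1 = x.2.1
    · simp [f, h]
    · have : f x = {p | cr p x.1.1 x.2.1 ≠ 0} := by ext p; simp [f, h]
      rw [this]
      exact isOpen_ne_fun (hcont _ _) continuous_const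
  have hdense : ∀ x, Dense (f x) := by
    rintro ⟨⟨a, ha⟩, ⟨b, hb⟩⟩
    intro p
    by_cases h : a = b
    · simp [f, h]
    by_cases hp : cr p a b = 0
    · rw [mem_closure_iff_seq_limit]
      refine ⟨fun n => p + ((1 / ((n : ℝ) + 1) : ℝ) : ℂ) * (Complex.I * (b - a)), fun n hab => ?_, ?_⟩
      · simp only
        have e : cr (p + ((1 / ((n : ℝ) + 1) : ℝ) : ℂ) * (Complex.I * (b - a))) a b =
            cr p a b + (1 / ((n : ℝ) + 1)) * Complex.normSq (b - a) := by
          generalize (1 / ((n : ℝ) + 1) : ℝ) = t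
          simp [cr_eq, Complex.normSq_apply]; ring
        rw [e, hp, zero_add]
        have : b - a ≠ 0 := sub_ne_zero.2 (Ne.symm h)
        have h2 : (0 : ℝ) < 1 / ((n : ℝ) + 1) := by positivity
        exact mul_ne_zero h2.ne' (by simpa using this)
      · have h1 : Filter.Tendsto (fun n : ℕ => 1 / ((n : ℝ) + 1)) Filter.atTop (nhds 0) :=
          tendsto_one_div_add_atTop_nhds_zero_nat
        have h2 : Continuous (fun t : ℝ => p + (t : ℂ) * (Complex.I * (b - a))) := by fun_prop
        have := (h2.tendsto 0).comp h1
        simp only [Complex.ofReal_zero, zero_mul, add_zero] at this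
        exact this
    · exact subset_closure (fun _ => hp)
  have hd := dense_iInter_of_isOpen hopen hdense
  obtain ⟨p, hpO, hp⟩ := hd.inter_open_nonempty O hO hne
  refine ⟨p, hpO, fun a ha b hb hab => ?_⟩
  exact (mem_iInter.1 hp ⟨⟨a, ha⟩, ⟨b, hb⟩⟩) hab

end

section
namespace Tri
namespace Layout

variable {D W F : Type} [Fintype D] {M : Tri D W F} {f0 : F} (L : M.Layout f0)

/-- incenter -/
def C (d : D) : ℂ := L.c (M.v d) + L.U d * (L.R (M.v d) - L.ρ (M.f d) * Complex.I)

theorem C_eq' (d : D) : L.C d = L.c (M.v (M.α d)) + L.U (M.α d) * (L.R (M.v (M.α d)) + L.ρ (M.f d) * Complex.I) := by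
  rw [C, L.c_α, L.U_α]; ring

theorem U_φ (d : D) : L.U (M.φ d) = L.U (M.α d) * Complex.exp (L.b (M.φ d) * Complex.I) := by
  rw [M.φ_apply, L.U_σ]

theorem C_φ (d : D) (hd : M.f d ≠ f0) : L.C (M.φ d) = L.C d := by
  rw [C_eq' L d, C, U_φ, L.b_in _ (by rw [M.f_φ]; exact hd), mul_assoc, two_arctan _ _ (L.Rpos _), M.v_φ, M.f_φ]

theorem U_ne (d : D) : L.U d ≠ 0 := by
  intro h; have := L.U_norm d; rw [h] at this; simp at this

theorem cr_local (c u p a b : ℂ) (hu : ‖u‖ = 1) : cr (c + u * p) (c + u * a) (c + u * b) = cr p a b := by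
  have h : Complex.normSq u = 1 := by rw [Complex.normSq_eq_norm_sq, hu]; norm_num
  rw [Complex.normSq_apply] at h
  simp only [cr_eq, Complex.add_re, Complex.add_im, Complex.mul_re, Complex.mul_im]
  linear_combination ((a.re - p.re) * (b.im - p.im) - (a.im - p.im) * (b.re - p.re)) * h

theorem area (d : D) : 0 < cr (L.c (M.v d)) (L.C d) (L.c (M.v (M.α d))) := by
  rw [C, L.c_α]
  have := cr_local (L.c (M.v d)) (L.U d) 0 (L.R (M.v d) - L.ρ (M.f d) * Complex.I)
    (L.R (M.v d) + L.R (M.v (M.α d))) (L.U_norm d)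
  rw [mul_zero, add_zero, mul_comm _ ((L.R (M.v d) : ℂ) + _)] at this
  rw [this, cr_eq]
  simp
  have := L.Rpos (M.v d); have := L.Rpos (M.v (M.α d)); have := L.ρpos (M.f d)
  positivity

/-- `p` lies in the triangle of the dart `d` -/
def In (d : D) (p : ℂ) : Prop := 0 < cr p (L.c (M.v d)) (L.C d) ∧ 0 < cr p (L.C d) (L.c (M.v (M.α d))) ∧
  0 < cr p (L.c (M.v (M.α d))) (L.c (M.v d))

def Gen (p : ℂ) : Prop := ∀ a ∈ range L.c ∪ range L.C, ∀ b ∈ range L.c ∪ range L.C, a ≠ b → cr p a b ≠ 0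

open Classical in
theorem unique_tri [Fintype F] (p : ℂ) (hp : L.Gen p) (d e : D) (hd : M.f d ≠ f0) (he : M.f e ≠ f0)
    (h1 : L.In d p) (h2 : L.In e p) : d = e := by
  let S : D → ℝ := fun d => wnd p (L.c (M.v d)) (L.C d) + wnd p (L.C d) (L.c (M.v (M.α d))) +
    wnd p (L.c (M.v (M.α d))) (L.c (M.v d))
  have gen : ∀ d, cr p (L.c (M.v d)) (L.C d) ≠ 0 ∧ cr p (L.C d) (L.c (M.v (M.α d))) ≠ 0 ∧
      cr p (L.c (M.v (M.α d))) (L.c (M.v d)) ≠ 0 := by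
    intro d
    obtain ⟨a1, a2, a3⟩ := cr_distinct (L.area d)
    exact ⟨hp _ (Or.inl ⟨_, rfl⟩) _ (Or.inr ⟨_, rfl⟩) a1, hp _ (Or.inr ⟨_, rfl⟩) _ (Or.inl ⟨_, rfl⟩) a2,
      hp _ (Or.inl ⟨_, rfl⟩) _ (Or.inl ⟨_, rfl⟩) a3⟩
  have S0 : ∀ d, 0 ≤ S d := fun d => tri_nonneg (L.area d) (gen d).1 (gen d).2.1 (gen d).2.2
  have Sd : 2 * Real.pi ≤ S d := tri_pos h1.1 h1.2.1 h1.2.2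
  have Se : 2 * Real.pi ≤ S e := tri_pos h2.1 h2.2.1 h2.2.2
  by_contra hde
  let w : D → ℝ := fun d => wnd p (L.c (M.v (M.α d))) (L.c (M.v d))
  let y : D → ℝ := fun d => wnd p (L.c (M.v d)) (L.C d)
  have hS : ∀ d, M.f d ≠ f0 → S d = y d - y (M.φ d) + w d := by
    intro d hd
    have : wnd p (L.C d) (L.c (M.v (M.α d))) = - y (M.φ d) := by
      simp only [y]
      rw [L.C_φ d hd, M.v_φ, wnd_neg (gen d).2.1, neg_neg]
    simp only [S, this]; ring
  have sum1 : ∑ d with M.f d ≠ f0, (y d - y (M.φ d)) = 0 := by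
    rw [Finset.sum_sub_distrib, Finset.sum_filter, Finset.sum_filter,
      ← Equiv.sum_comp M.φ (fun d => if M.f d ≠ f0 then y d else 0)]
    simp only [M.f_φ, sub_self]
  have sum2 : ∑ d, w d = 0 := by
    have := Equiv.sum_comp (Function.Involutive.toPerm M.α M.inv) w
    have h2 : ∑ d, w ((Function.Involutive.toPerm M.α M.inv) d) = - ∑ d, w d := by
      rw [← Finset.sum_neg_distrib]
      refine Finset.sum_congr rfl (fun d _ => ?_)
      change wnd p (L.c (M.v (M.α (M.α d)))) (L.c (M.v (M.α d))) = _
      rw [M.inv, wnd_neg (gen d).2.2]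
    rw [h2] at this
    linarith
  have sum3 : ∑ d with M.f d ≠ f0, w d = - ∑ d with M.f d = f0, w d := by
    have := Finset.sum_filter_add_sum_filter_not Finset.univ (fun d => M.f d = f0) w
    rw [sum2] at this
    linarith
  have sum4 : |∑ d with M.f d = f0, w d| < 3 * Real.pi := by
    obtain ⟨d0, rfl⟩ := M.fsurj f0
    rw [M.sum_fib]
    have a1 := abs_lt.1 (wnd_abs (gen d0).2.2)
    have a2 := abs_lt.1 (wnd_abs (gen (M.φ d0)).2.2)
    have a3 := abs_lt.1 (wnd_abs (gen (M.φ (M.φ d0))).2.2)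
    rw [abs_lt]
    constructor <;> simp only [w] <;> linarith
  have sum5 : ∑ d with M.f d ≠ f0, S d < 3 * Real.pi := by
    rw [Finset.sum_congr rfl (fun d hd => hS d (by simpa using hd)), Finset.sum_add_distrib, sum1, sum3]
    have := abs_lt.1 sum4
    linarith
  have sum6 : S d + S e ≤ ∑ d with M.f d ≠ f0, S d := by
    have : ∑ x ∈ ({d, e} : Finset D), S x ≤ ∑ d with M.f d ≠ f0, S d := by
      refine Finset.sum_le_sum_of_subset_of_nonneg ?_ (fun i _ _ => S0 i)
      intro x hx
      simp only [Finset.mem_insert, Finset.mem_singleton] at hx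
      rcases hx with rfl | rfl <;> simpa
    rwa [Finset.sum_pair hde] at this
  have := Real.pi_pos
  linarith

theorem in_right (d : D) (x y : ℝ) (hy : y < 0) (hx : x < L.R (M.v d))
    (h : 0 < L.R (M.v d) * y + L.ρ (M.f d) * x) : L.In d (L.c (M.v d) + L.U d * (x + y * Complex.I)) := by
  have hc : L.c (M.v d) = L.c (M.v d) + L.U d * 0 := by ring
  have hC : L.C d = L.c (M.v d) + L.U d * (L.R (M.v d) - L.ρ (M.f d) * Complex.I) := rfl
  have hc' : L.c (M.v (M.α d)) = L.c (M.v d) + L.U d * (L.R (M.v d) + L.R (M.v (M.α d))) := by rw [L.c_α]; ring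
  have p1 := L.Rpos (M.v d); have p2 := L.Rpos (M.v (M.α d)); have p3 := L.ρpos (M.f d)
  rw [In, hc', hC]
  refine ⟨?_, ?_, ?_⟩
  · nth_rewrite 2 [hc]
    rw [cr_local _ _ _ _ _ (L.U_norm d), cr_eq]
    simp; nlinarith
  · rw [cr_local _ _ _ _ _ (L.U_norm d), cr_eq]
    simp
    set R := L.R (M.v d); set R' := L.R (M.v (M.α d)); set ρ := L.ρ (M.f d)
    have : 0 < R * (R' * (y + ρ) - ρ * (x - R)) := by
      have h1 : 0 < R' * (R * y + ρ * x) := by positivity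
      have h2 : 0 < ρ * (R + R') * (R - x) := mul_pos (by positivity) (by linarith)
      linarith
    have := (mul_pos_iff_of_pos_left p1).1 this
    linarith
  · nth_rewrite 3 [hc]
    rw [cr_local _ _ _ _ _ (L.U_norm d), cr_eq]
    simp; nlinarith

theorem in_left (d : D) (x y : ℝ) (hy : 0 < y) (hx : x < L.R (M.v (M.α d)))
    (h : 0 < L.ρ (M.f d) * x - L.R (M.v (M.α d)) * y) :
    L.In d (L.c (M.v (M.α d)) + L.U (M.α d) * (x + y * Complex.I)) := by
  have hc : L.c (M.v (M.α d)) = L.c (M.v (M.α d)) + L.U (M.α d) * 0 := by ring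
  have hC := L.C_eq' d
  have hc' : L.c (M.v d) = L.c (M.v (M.α d)) + L.U (M.α d) * (L.R (M.v (M.α d)) + L.R (M.v d)) := by
    rw [L.c_α, L.U_α]; ring
  have p1 := L.Rpos (M.v d); have p2 := L.Rpos (M.v (M.α d)); have p3 := L.ρpos (M.f d)
  rw [In, hc', hC]
  refine ⟨?_, ?_, ?_⟩
  · rw [cr_local _ _ _ _ _ (L.U_norm _), cr_eq]
    simp
    set R := L.R (M.v (M.α d)); set R' := L.R (M.v d); set ρ := L.ρ (M.f d)
    have : 0 < R * ((R + R' - x) * (ρ - y) - (-y) * (R - x)) := by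
      have h1 : 0 < R' * (ρ * x - R * y) := by positivity
      have h2 : 0 < ρ * (R + R') * (R - x) := mul_pos (by positivity) (by linarith)
      linarith
    have := (mul_pos_iff_of_pos_left p2).1 this
    linarith
  · nth_rewrite 3 [hc]
    rw [cr_local _ _ _ _ _ (L.U_norm _), cr_eq]
    simp; nlinarith
  · nth_rewrite 2 [hc]
    rw [cr_local _ _ _ _ _ (L.U_norm _), cr_eq]
    simp; nlinarith

end Layout
end Tri

end

section
theorem exp_unique {x y : ℝ} (hx : x ∈ Ico 0 (2 * Real.pi)) (hy : y ∈ Ico 0 (2 * Real.pi))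
    (h : Complex.exp (x * Complex.I) = Complex.exp (y * Complex.I)) : x = y := by
  rw [Complex.exp_eq_exp_iff_exists_int] at h
  obtain ⟨n, hn⟩ := h
  have h2 : x = y + n * (2 * Real.pi) := by
    have : (x : ℂ) * Complex.I = ((y + n * (2 * Real.pi) : ℝ) : ℂ) * Complex.I := by
      rw [hn]; push_cast; ring
    exact_mod_cast mul_right_cancel₀ Complex.I_ne_zero this
  have hp := Real.pi_pos
  have h3 : (n : ℝ) < 1 := by
    by_contra hc; push Not at hc; nlinarith [hx.2, hy.1]
  have h4 : (-1 : ℝ) < n := by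
    by_contra hc; push Not at hc; nlinarith [hx.1, hy.2]
  have h5 : n < 1 := by exact_mod_cast h3
  have h6 : -1 < n := by exact_mod_cast h4
  have : n = 0 := by omega
  rw [h2, this]; simp

theorem exists_angle (z : ℂ) : ∃ β ∈ Ico 0 (2 * Real.pi), z = ‖z‖ * Complex.exp (β * Complex.I) := by
  refine ⟨toIcoMod Real.two_pi_pos 0 (Complex.arg z), by simpa using toIcoMod_mem_Ico Real.two_pi_pos 0 _, ?_⟩
  conv_lhs => rw [← Complex.norm_mul_exp_arg_mul_I z]
  congr 1
  rw [Complex.exp_eq_exp_iff_exists_int]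
  refine ⟨toIcoDiv Real.two_pi_pos 0 (Complex.arg z), ?_⟩
  rw [toIcoMod]
  push_cast [zsmul_eq_mul]; ring

namespace Tri
namespace Layout

variable {D W F : Type} [Fintype D] {M : Tri D W F} {f0 : F} (L : M.Layout f0)

theorem b_pos (d : D) (hd : M.f d ≠ f0) : 0 < L.b d := by
  rw [L.b_in d hd]
  exact mul_pos two_pos (Real.arctan_pos.2 (div_pos (L.ρpos _) (L.Rpos _)))

theorem sector (w : W) (hw : ∀ d, M.v d = w → M.f d ≠ f0) (z : ℂ) (hz0 : z ≠ 0) :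
    ∃ d, M.v d = w ∧ ∃ β, 0 ≤ β ∧ β < L.b d ∧ z = ‖z‖ * (L.U (M.σ.symm d) * Complex.exp (β * Complex.I)) := by
  classical
  have key : ∀ d, ∃ β ∈ Ico 0 (2 * Real.pi), z = ‖z‖ * (L.U (M.σ.symm d) * Complex.exp (β * Complex.I)) := by
    intro d
    obtain ⟨β, hβ, h⟩ := exists_angle (z / L.U (M.σ.symm d))
    refine ⟨β, hβ, ?_⟩
    rw [norm_div, L.U_norm, div_one] at h
    have := L.U_ne (M.σ.symm d)
    field_simp at h
    rw [h]; simp [L.U_norm]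
    ring
  choose β hβ hz using key
  obtain ⟨d0, hd0⟩ := M.vsurj w
  obtain ⟨d, hd, hmin⟩ := (Finset.univ.filter (fun d => M.v d = w)).exists_min_image β ⟨d0, by simpa using hd0⟩
  simp only [Finset.mem_filter, Finset.mem_univ, true_and] at hd hmin
  refine ⟨d, hd, β d, (hβ d).1, ?_, hz d⟩
  by_contra hcon
  push Not at hcon
  have hb := L.b_pos d (hw d hd)
  have h1 := hz d
  have h2 := hz (M.σ d)
  rw [Equiv.symm_apply_apply] at h2
  have h3 : L.U d = L.U (M.σ.symm d) * Complex.exp (L.b d * Complex.I) := by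
    have := L.U_σ (M.σ.symm d)
    rwa [Equiv.apply_symm_apply] at this
  have h4 : Complex.exp (β (M.σ d) * Complex.I) = Complex.exp ((β d - L.b d : ℝ) * Complex.I) := by
    have hn : (‖z‖ : ℂ) ≠ 0 := by exact_mod_cast (norm_pos_iff.2 hz0).ne'
    have h5 := h1.symm.trans h2
    rw [h3] at h5
    have h6 := mul_left_cancel₀ hn h5
    rw [mul_assoc] at h6
    have h7 := mul_left_cancel₀ (L.U_ne _) h6
    have : ((β d - L.b d : ℝ) : ℂ) * Complex.I = β d * Complex.I - L.b d * Complex.I := by push_cast; ring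
    rw [this, Complex.exp_sub, h7, mul_div_cancel_left₀ _ (Complex.exp_ne_zero _)]
  have h5 := exp_unique (hβ _) ⟨by linarith, by linarith [(hβ d).2]⟩ h4
  have h6 := hmin (M.σ d) (by rw [M.v_σ]; exact hd)
  linarith

theorem cover (w : W) (hw : ∀ d, M.v d = w → M.f d ≠ f0) (p : ℂ) (hg : L.Gen p)
    (hp : p ∈ Metric.ball (L.c w) (L.R w)) :
    ∃ d, M.f d ≠ f0 ∧ (M.v d = w ∨ M.v (M.α d) = w) ∧ L.In d p := by
  have hz0 : p - L.c w ≠ 0 := by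
    rw [sub_ne_zero]
    rintro rfl
    obtain ⟨d, hd⟩ := M.vsurj w
    have h1 := (cr_distinct (L.area d)).1
    have := hg _ (Or.inl ⟨M.v d, rfl⟩) _ (Or.inr ⟨d, rfl⟩) h1
    rw [hd] at this
    simp [cr] at this
  obtain ⟨d, hd, β, h0, hβ, hz⟩ := L.sector w hw (p - L.c w) hz0
  have hf := hw d hd
  have hs : ‖p - L.c w‖ < L.R w := by rwa [← dist_eq_norm]
  set s := ‖p - L.c w‖ with hsdef
  rw [L.b_in d hf] at hβ
  have hR := L.Rpos w
  have hρ := L.ρpos (M.f d)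
  set a := Real.arctan (L.ρ (M.f d) / L.R (M.v d)) with ha
  have ha0 : 0 < a := Real.arctan_pos.2 (div_pos (L.ρpos _) (L.Rpos _))
  have ha1 : a < Real.pi / 2 := Real.arctan_lt_pi_div_two _
  have htan : Real.tan a = L.ρ (M.f d) / L.R w := by rw [ha, Real.tan_arctan, hd]
  have cosa : 0 < Real.cos a := Real.cos_pos_of_mem_Ioo ⟨by linarith, ha1⟩
  have trig : ∀ γ, L.ρ (M.f d) * Real.cos γ - L.R w * Real.sin γ = L.R w / Real.cos a * Real.sin (a - γ) := by
    intro γ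
    rw [Real.tan_eq_sin_div_cos, div_eq_div_iff cosa.ne' hR.ne'] at htan
    rw [Real.sin_sub]; field_simp
    linear_combination (- Real.cos γ) * htan
  -- the dart on the left
  set e := M.φ.symm d with he
  have hφe : M.φ e = d := Equiv.apply_symm_apply _ _
  have hαe : M.α e = M.σ.symm d := by
    rw [← hφe, M.φ_apply, Equiv.symm_apply_apply]
  have hve : M.v (M.α e) = w := by rw [← M.v_φ, hφe, hd]
  have hfe : M.f e = M.f d := by rw [← hφe, M.f_φ]
  have hbd : L.b d = 2 * a := L.b_in d hf
  have hpz : p = L.c w + L.U (M.α e) * ((s * Real.cos β : ℝ) + (s * Real.sin β : ℝ) * Complex.I) := by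
    rw [← sub_eq_iff_eq_add', hz, hαe, Complex.exp_mul_I]; push_cast; ring
  have hpz2 : p = L.c w + L.U d * ((s * Real.cos (2 * a - β) : ℝ) + (- (s * Real.sin (2 * a - β)) : ℝ) * Complex.I) := by
    have h3 : L.U d = L.U (M.σ.symm d) * Complex.exp (L.b d * Complex.I) := by
      have := L.U_σ (M.σ.symm d)
      rwa [Equiv.apply_symm_apply] at this
    have h4 : Complex.exp (β * Complex.I) = Complex.exp (L.b d * Complex.I) * Complex.exp ((β - 2 * a : ℝ) * Complex.I) := by
      rw [← Complex.exp_add, hbd]; congr 1; push_cast; ring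
    rw [← sub_eq_iff_eq_add', hz, h4, Complex.exp_mul_I ((β - 2 * a : ℝ) : ℂ), h3, ← Complex.ofReal_cos, ← Complex.ofReal_sin,
      ← neg_sub (2 * a) β, Real.cos_neg, Real.sin_neg]
    push_cast; ring
  have hspos : 0 < s := by
    rw [hsdef, norm_pos_iff]; exact hz0
  have xle : ∀ γ, s * Real.cos γ < L.R w := fun γ => by
    have := Real.cos_le_one γ
    nlinarith
  -- excluded angles
  have b0 : β ≠ 0 := by
    intro hb
    have h1 := (cr_distinct (L.area e)).2.2
    have := hg _ (Or.inl ⟨_, rfl⟩) _ (Or.inl ⟨_, rfl⟩) h1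
    apply this
    have h2 : L.c (M.v e) = L.c w + L.U (M.α e) * (L.R w + L.R (M.v e)) := by
      rw [← hve, L.c_α, L.U_α]; ring
    have h3 : L.c (M.v (M.α e)) = L.c w + L.U (M.α e) * 0 := by rw [hve]; ring
    rw [h3, h2, hpz, cr_local _ _ _ _ _ (L.U_norm _), hb, cr_eq]
    simp
  have ba : β ≠ a := by
    intro hb
    have h1 := (cr_distinct (L.area d)).1
    have := hg _ (Or.inl ⟨M.v d, rfl⟩) _ (Or.inr ⟨d, rfl⟩) h1
    apply this
    have h3 : L.c (M.v d) = L.c w + L.U d * 0 := by rw [hd]; ring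
    rw [C, h3, hpz2, hd, mul_zero, add_zero, ← add_zero (L.c w), ← mul_zero (L.U d), add_assoc, ← mul_add,  add_assoc, ← mul_add, cr_local _ _ _ _ _ (L.U_norm _), hb, cr_eq]
    rw [show 2 * a - a = a by ring]
    have := trig a
    rw [sub_self, Real.sin_zero, mul_zero] at this
    generalize Real.cos a = X at *
    generalize Real.sin a = Y at *
    simp
    linear_combination s * this
  rcases lt_or_gt_of_ne ba with hlt | hgt
  · refine ⟨e, by rw [hfe]; exact hf, Or.inr hve, ?_⟩
    have := L.in_left e (s * Real.cos β) (s * Real.sin β) (mul_pos hspos (Real.sin_pos_of_pos_of_lt_pi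
      (lt_of_le_of_ne h0 b0.symm) (by linarith))) (by rw [hve]; exact xle _) (by
        rw [hfe, hve]
        have h1 := trig β
        have h2 : 0 < Real.sin (a - β) := Real.sin_pos_of_pos_of_lt_pi (by linarith) (by linarith)
        have h3 : 0 < s * (L.R w / Real.cos a * Real.sin (a - β)) := by positivity
        rw [← h1] at h3
        linarith)
    rw [hve, ← hpz] at this
    exact this
  · refine ⟨d, hf, Or.inl hd, ?_⟩
    have := L.in_right d (s * Real.cos (2 * a - β)) (-(s * Real.sin (2 * a - β))) (neg_neg_of_pos
      (mul_pos hspos (Real.sin_pos_of_pos_of_lt_pi (by linarith) (by linarith)))) (by rw [hd]; exact xle _) (by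
        rw [hd]
        have h1 := trig (2 * a - β)
        have h2 : 0 < Real.sin (a - (2 * a - β)) := Real.sin_pos_of_pos_of_lt_pi (by linarith) (by linarith)
        have h3 : 0 < s * (L.R w / Real.cos a * Real.sin (a - (2 * a - β))) := by positivity
        rw [← h1] at h3
        linarith)
    rw [hd, ← hpz2] at this
    exact this

theorem dist_adj (d : D) : dist (L.c (M.v d)) (L.c (M.v (M.α d))) = L.R (M.v d) + L.R (M.v (M.α d)) := by
  rw [L.c_α, dist_eq_norm]
  have := L.Rpos (M.v d); have := L.Rpos (M.v (M.α d))
  rw [sub_add_cancel_left, norm_neg, norm_mul, L.U_norm, mul_one, ← Complex.ofReal_add, Complex.norm_real,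
    Real.norm_of_nonneg (by positivity)]

theorem packing [Fintype F] [Finite W] (w w' : W) (hne : w ≠ w') (hw : ∀ d, M.v d = w → M.f d ≠ f0)
    (hw' : ∀ d, M.v d = w' → M.f d ≠ f0) : L.R w + L.R w' ≤ dist (L.c w) (L.c w') := by
  rw [← disjoint_ball_ball_iff (L.Rpos w) (L.Rpos w')]
  by_contra hcon
  rw [Set.not_disjoint_iff_nonempty_inter] at hcon
  obtain ⟨p, ⟨hp, hp'⟩, hg⟩ := exists_generic (range L.c ∪ range L.C)
    ((Set.finite_range _).union (Set.finite_range _)) _ (Metric.isOpen_ball.inter Metric.isOpen_ball) hcon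
  obtain ⟨d, hd, h1, h2⟩ := L.cover w hw p hg hp
  obtain ⟨e, he, h1', h2'⟩ := L.cover w' hw' p hg hp'
  have := L.unique_tri p hg d e hd he h2 h2'
  subst this
  have hdist : dist (L.c w) (L.c w') = L.R w + L.R w' := by
    have := L.dist_adj d
    rcases h1 with rfl | rfl <;> rcases h1' with h | h
    · exact (hne h).elim
    · rw [← h]; exact this
    · rw [← h, dist_comm, this, add_comm]
    · exact (hne h).elim
  have := dist_triangle_right (L.c w) (L.c w') p
  rw [Metric.mem_ball, dist_comm] at hp hp'
  linarith

end Layout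
end Tri

end

section
/-- restrict the vertex type to the range -/
def SimpleMap.restrict {D W : Type} (M : SimpleMap D W) : SimpleMap D (range M.v) where
  σ := M.σ
  α := M.α
  v := fun d => ⟨M.v d, mem_range_self d⟩
  planar := M.planar
  inv := M.inv
  cyc := fun d e => (M.cyc d e).trans Subtype.mk_eq_mk.symm
  noloop := fun d h => M.noloop d (Subtype.mk.inj h)
  simple := fun d e h h' => M.simple d e (Subtype.mk.inj h) (Subtype.mk.inj h')
  conn := M.conn

theorem koebe {D W : Type} [Finite D] [Nonempty D] (M : SimpleMap D W)
    (h3 : ∀ d : D, ∃ e, M.v e ≠ M.v d ∧ M.v e ≠ M.v (M.α d)) :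
    ∃ (c : W → ℂ) (r : W → ℝ), (∀ d, 0 < r (M.v d)) ∧
      (∀ d e, M.v d ≠ M.v e → r (M.v d) + r (M.v e) ≤ dist (c (M.v d)) (c (M.v e))) ∧
      ∀ d, dist (c (M.v d)) (c (M.v (M.α d))) = r (M.v d) + r (M.v (M.α d)) := by
  classical
  obtain ⟨Y, K, hφ, hA, hA', hC0, hC1, hC2⟩ := exists_kmap M (M.φφ_ne h3)
  have := Fintype.ofFinite (KD D)
  have := Fintype.ofFinite D
  have hφ' : ∀ x, K.restrict.φ x = KD.rot x := hφ
  let T : Tri (KD D) (range K.v) (D × Fin 3) :=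
    { K.restrict with
      f := KD.ff
      vsurj := by rintro ⟨_, d, rfl⟩; exact ⟨d, rfl⟩
      fsurj := by
        rintro ⟨d, k⟩
        fin_cases k
        · exact ⟨.A0 d, rfl⟩
        · exact ⟨.B0 d, rfl⟩
        · exact ⟨.C0 d, rfl⟩
      f_φ := fun d => by
        rw [hφ']; cases d <;> rfl
      f_fib := fun d e => by
        simp only [hφ']; cases d <;> cases e <;> simp [KD.ff, KD.rot] <;> tauto
      φ3 := fun d => by
        simp only [hφ', KD.rot3] }
  let d0 : D := Classical.arbitrary D
  obtain ⟨L⟩ := T.exists_layout (d0, 2)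
  have : Finite (range K.v) := inferInstance
  have hv : ∀ d, Sum.inl (M.v d) ∈ range K.v := fun d => ⟨_, hA d⟩
  let ι : W → range K.v := fun w => if h : Sum.inl w ∈ range K.v then ⟨_, h⟩ else ⟨_, hv d0⟩
  have hι : ∀ d, ι (M.v d) = ⟨_, hv d⟩ := fun d => dif_pos (hv d)
  have outer : ∀ d x, T.v x = ι (M.v d) → T.f x ≠ (d0, 2) := by
    intro d x hx hf
    rw [hι] at hx
    have hx' : K.v x = Sum.inl (M.v d) := Subtype.mk.inj hx
    change KD.ff x = (d0, 2) at hf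
    cases x <;> simp [KD.ff] at hf
    · exact hC0 _ _ hx'
    · exact hC1 _ _ hx'
    · exact hC2 _ _ hx'
  refine ⟨fun w => L.c (ι w), fun w => L.R (ι w), fun d => L.Rpos _, fun d e hne => ?_, fun d => ?_⟩
  · refine L.packing _ _ (fun h => ?_) (outer d) (outer e)
    rw [hι, hι, Subtype.mk.injEq] at h
    exact hne (Sum.inl_injective h)
  · have h := L.dist_adj (KD.A0 d)
    have e1 : T.v (KD.A0 d) = ι (M.v d) := by rw [hι]; exact Subtype.ext (hA d)
    have e2 : T.v (T.α (KD.A0 d)) = ι (M.v (M.α d)) := by rw [hι]; exact Subtype.ext (hA' d)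
    rw [e1, e2] at h
    exact h

end

section
/-- closed cell of the grid of mesh `1/N` -/
def cell (N : ℝ) (z : ℤ × ℤ) : Set ℂ :=
  {x | (z.1 ≤ N * x.re ∧ N * x.re ≤ z.1 + 1) ∧ (z.2 ≤ N * x.im ∧ N * x.im ≤ z.2 + 1)}

def cells (N : ℝ) (X : Set ℂ) : Set (ℤ × ℤ) := {z | (cell N z ∩ X).Nonempty}

theorem mem_cell_floor (N : ℝ) (x : ℂ) : x ∈ cell N (⌊N * x.re⌋, ⌊N * x.im⌋) :=
  ⟨⟨Int.floor_le _, (Int.lt_floor_add_one _).le⟩, ⟨Int.floor_le _, (Int.lt_floor_add_one _).le⟩⟩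

theorem cells_mono (N : ℝ) {X Y : Set ℂ} (h : X ⊆ Y) : cells N X ⊆ cells N Y :=
  fun _ ⟨x, hx, hX⟩ => ⟨x, hx, h hX⟩

theorem cells_nonempty (N : ℝ) {X : Set ℂ} (h : X.Nonempty) : (cells N X).Nonempty := by
  obtain ⟨x, hx⟩ := h
  exact ⟨_, x, mem_cell_floor N x, hx⟩

theorem isClosed_cell (N : ℝ) (z : ℤ × ℤ) : IsClosed (cell N z) := by
  have h1 : Continuous fun x : ℂ => N * x.re := by fun_prop
  have h2 : Continuous fun x : ℂ => N * x.im := by fun_prop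
  exact ((isClosed_le continuous_const h1).inter (isClosed_le h1 continuous_const)).inter
    ((isClosed_le continuous_const h2).inter (isClosed_le h2 continuous_const))

theorem cells_finite (N : ℝ) (hN : 0 < N) {X : Set ℂ} (h : Bornology.IsBounded X) : (cells N X).Finite := by
  obtain ⟨R, hR⟩ := h.exists_norm_le
  have hfin : (Set.Icc (⌊-(N * R)⌋ - 1) ⌈N * R⌉ ×ˢ Set.Icc (⌊-(N * R)⌋ - 1) ⌈N * R⌉ : Set (ℤ × ℤ)).Finite :=
    (Set.finite_Icc _ _).prod (Set.finite_Icc _ _)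
  refine hfin.subset ?_
  have key : ∀ (a : ℤ) (t : ℝ), |t| ≤ R → (a ≤ N * t ∧ N * t ≤ a + 1) → a ∈ Set.Icc (⌊-(N * R)⌋ - 1) ⌈N * R⌉ := by
    intro a t ht ⟨h1, h2⟩
    have := abs_le.1 ht
    constructor
    · have h3 : -(N * R) ≤ a + 1 := by nlinarith
      have h4 : (⌊-(N * R)⌋ : ℝ) ≤ a + 1 := (Int.floor_le _).trans h3
      have : ⌊-(N * R)⌋ ≤ a + 1 := by exact_mod_cast h4
      omega
    · have h3 : (a : ℝ) ≤ N * R := by nlinarith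
      have h4 : (a : ℝ) ≤ ⌈N * R⌉ := h3.trans (Int.le_ceil _)
      exact_mod_cast h4
  rintro z ⟨x, ⟨h1, h2⟩, hx⟩
  exact ⟨key _ _ ((Complex.abs_re_le_norm x).trans (hR x hx)) h1,
    key _ _ ((Complex.abs_im_le_norm x).trans (hR x hx)) h2⟩

theorem cells_conn (N : ℝ) (hN : 0 < N) {X : Set ℂ} (hb : Bornology.IsBounded X) (hX : IsPreconnected X)
    (S : Set (ℤ × ℤ)) (hS : S ⊆ cells N X) (hne : S.Nonempty)
    (hcl : ∀ z ∈ S, ∀ k, z + gridE k ∈ cells N X → z + gridE k ∈ S) : S = cells N X := by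
  have hfin := cells_finite N hN hb
  refine hS.antisymm ?_
  by_contra hcon
  obtain ⟨w, hw, hwS⟩ := Set.not_subset.1 hcon
  have step1 : ∀ a a' b : ℤ, |a - a'| ≤ 1 → (a, b) ∈ S → (a', b) ∈ cells N X → (a', b) ∈ S := by
    intro a a' b h h1 h2
    have : a' = a ∨ a' = a + 1 ∨ a' = a - 1 := by have := abs_le.1 h; omega
    rcases this with rfl | rfl | rfl
    · exact h1
    · simpa [gridE] using hcl _ h1 0 (by simpa [gridE] using h2)
    · simpa [gridE, sub_eq_add_neg] using hcl _ h1 2 (by simpa [gridE, sub_eq_add_neg] using h2)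
  have step2 : ∀ a b b' : ℤ, |b - b'| ≤ 1 → (a, b) ∈ S → (a, b') ∈ cells N X → (a, b') ∈ S := by
    intro a b b' h h1 h2
    have : b' = b ∨ b' = b + 1 ∨ b' = b - 1 := by have := abs_le.1 h; omega
    rcases this with rfl | rfl | rfl
    · exact h1
    · simpa [gridE] using hcl _ h1 1 (by simpa [gridE] using h2)
    · simpa [gridE, sub_eq_add_neg] using hcl _ h1 3 (by simpa [gridE, sub_eq_add_neg] using h2)
  have close : ∀ (a a' : ℤ) (t : ℝ), (a ≤ t ∧ t ≤ a + 1) → (a' ≤ t ∧ t ≤ a' + 1) → |a - a'| ≤ 1 := by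
    rintro a a' t ⟨h1, h2⟩ ⟨h3, h4⟩
    have h5 : (a : ℝ) ≤ a' + 1 := by linarith
    have h6 : (a' : ℝ) ≤ a + 1 := by linarith
    have h5' : a ≤ a' + 1 := by exact_mod_cast h5
    have h6' : a' ≤ a + 1 := by exact_mod_cast h6
    rw [abs_le]; omega
  have h := isPreconnected_closed_iff.1 hX (⋃ z ∈ S, cell N z) (⋃ z ∈ cells N X \ S, cell N z)
    ((hfin.subset hS).isClosed_biUnion fun z _ => isClosed_cell N z)
    ((hfin.subset sdiff_subset).isClosed_biUnion fun z _ => isClosed_cell N z) ?_ ?_ ?_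
  · obtain ⟨x, hx, h1, h2⟩ := h
    simp only [mem_iUnion] at h1 h2
    obtain ⟨⟨a, b⟩, hz, hxz⟩ := h1
    obtain ⟨⟨a', b'⟩, ⟨hz1, hz2⟩, hxz'⟩ := h2
    have m : (a', b) ∈ S := step1 a a' b (close _ _ _ hxz.1 hxz'.1) hz ⟨x, ⟨hxz'.1, hxz.2⟩, hx⟩
    exact hz2 (step2 a' b b' (close _ _ _ hxz.2 hxz'.2) m ⟨x, hxz', hx⟩)
  · intro x hx
    have hc : (⌊N * x.re⌋, ⌊N * x.im⌋) ∈ cells N X := ⟨x, mem_cell_floor N x, hx⟩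
    by_cases hs : (⌊N * x.re⌋, ⌊N * x.im⌋) ∈ S
    · left; simp only [mem_iUnion]; exact ⟨_, hs, mem_cell_floor N x⟩
    · right; simp only [mem_iUnion]; exact ⟨_, ⟨hc, hs⟩, mem_cell_floor N x⟩
  · obtain ⟨z, hz⟩ := hne
    obtain ⟨x, h1, h2⟩ := hS hz
    refine ⟨x, h2, ?_⟩
    simp only [mem_iUnion]; exact ⟨z, hz, h1⟩
  · obtain ⟨x, h1, h2⟩ := hw
    refine ⟨x, h2, ?_⟩
    simp only [mem_iUnion]; exact ⟨w, ⟨⟨x, h1, h2⟩, hwS⟩, h1⟩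

theorem cells_fine {X Y : Set ℂ} (hX : IsCompact X) (hY : IsCompact Y) (h : Disjoint X Y) :
    ∀ᶠ N in Filter.atTop, Disjoint (cells N X) (cells N Y) := by
  obtain ⟨δ, hδ, hd⟩ := Metric.exists_pos_forall_lt_edist hX hY.isClosed h
  filter_upwards [Filter.eventually_gt_atTop (0 : ℝ), Filter.eventually_ge_atTop (2 / (δ : ℝ))] with N hN hN2
  rw [Set.disjoint_left]
  rintro z ⟨x, ⟨⟨a1, a2⟩, a3, a4⟩, hx⟩ ⟨y, ⟨⟨b1, b2⟩, b3, b4⟩, hy⟩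
  have h1 := hd x hx y hy
  have hδ' : (0 : ℝ) < δ := hδ
  have h2 : (δ : ℝ) < dist x y := by
    rw [edist_nndist] at h1
    rw [← coe_nndist]; exact_mod_cast h1
  have h3 : N * dist x y ≤ 2 := by
    rw [dist_eq_norm]
    have e1 := Complex.norm_le_abs_re_add_abs_im (x - y)
    rw [Complex.sub_re, Complex.sub_im] at e1
    have e2 : N * |x.re - y.re| ≤ 1 := by
      rw [show N * |x.re - y.re| = |N * (x.re - y.re)| by rw [abs_mul, abs_of_pos hN], abs_le]
      constructor <;> linarith
    have e3 : N * |x.im - y.im| ≤ 1 := by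
      rw [show N * |x.im - y.im| = |N * (x.im - y.im)| by rw [abs_mul, abs_of_pos hN], abs_le]
      constructor <;> linarith
    have := mul_le_mul_of_nonneg_left e1 hN.le
    linarith
  rw [div_le_iff₀ hδ'] at hN2
  have := mul_lt_mul_of_pos_left h2 hN
  linarith

theorem packing_of_sets (n : ℕ) (K : Fin n → Set ℂ) (M : Fin n → Fin n → Set ℂ) (adj : Fin n → Fin n → Prop)
    (hKc : ∀ i, IsCompact (K i)) (hKp : ∀ i, IsPreconnected (K i)) (hKn : ∀ i, (K i).Nonempty)
    (hMc : ∀ i j, IsCompact (M i j)) (hMp : ∀ i j, IsPreconnected (M i j))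
    (hKK : ∀ i j, i ≠ j → Disjoint (K i) (K j))
    (hMK : ∀ i j k, adj i j → i < j → k ≠ i → k ≠ j → Disjoint (M i j) (K k))
    (hMM : ∀ i j i' j', adj i j → i < j → adj i' j' → i' < j' → (i, j) ≠ (i', j') → Disjoint (M i j) (M i' j'))
    (h1 : ∀ i j, adj i j → i < j → (M i j ∩ K i).Nonempty)
    (h2 : ∀ i j, adj i j → i < j → (M i j ∩ K j).Nonempty) :
    ∃ (c : Fin n → ℂ) (r : Fin n → ℝ), (∀ i, 0 < r i) ∧ (∀ i j, i ≠ j → r i + r j ≤ dist (c i) (c j)) ∧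
      ∀ i j, adj i j → i < j → dist (c i) (c j) = r i + r j := by
  classical
  obtain ⟨N, hN, fKK, fMK, fMM⟩ : ∃ N : ℝ, 0 < N ∧ (∀ i j, i ≠ j → Disjoint (cells N (K i)) (cells N (K j))) ∧
      (∀ i j k, adj i j → i < j → k ≠ i → k ≠ j → Disjoint (cells N (M i j)) (cells N (K k))) ∧
      (∀ i j i' j', adj i j → i < j → adj i' j' → i' < j' → (i, j) ≠ (i', j') →
        Disjoint (cells N (M i j)) (cells N (M i' j'))) := by
    refine Filter.Eventually.exists (f := Filter.atTop) ((Filter.eventually_gt_atTop 0).and (.and ?_ (.and ?_ ?_))) <;>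
    simp only [Filter.eventually_all]
    · exact fun i j h => cells_fine (hKc i) (hKc j) (hKK i j h)
    · exact fun i j k a b c d => cells_fine (hMc i j) (hKc k) (hMK i j k a b c d)
    · exact fun i j i' j' a b c d e => cells_fine (hMc i j) (hMc i' j') (hMM i j i' j' a b c d e)
  set Kc : Fin n → Set (ℤ × ℤ) := fun i => cells N (K i) with hKcdef
  set Mc : Fin n → Fin n → Set (ℤ × ℤ) := fun i j => cells N (M i j) with hMcdef
  let A : Fin n → Set (ℤ × ℤ) := fun i => {z | ∃ j, adj i j ∧ i < j ∧ z ∈ Mc i j ∧ z ∉ Kc j}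
  let Cl : Fin n → Set (ℤ × ℤ) → Prop := fun i S => Kc i ⊆ S ∧ ∀ z ∈ S, ∀ k, z + gridE k ∈ A i → z + gridE k ∈ S
  let Bs : Fin n → Set (ℤ × ℤ) := fun i => {z | ∀ S, Cl i S → z ∈ S}
  have Bmin : ∀ i S, Cl i S → Bs i ⊆ S := fun i S hS z hz => hz S hS
  have BK : ∀ i, Kc i ⊆ Bs i := fun i z hz S hS => hS.1 hz
  have BA : ∀ i, ∀ z ∈ Bs i, ∀ k, z + gridE k ∈ A i → z + gridE k ∈ Bs i := fun i z hz k hk S hS =>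
    hS.2 z (hz S hS) k hk
  have Bsub : ∀ i, Bs i ⊆ Kc i ∪ A i := fun i => Bmin i _ ⟨subset_union_left, fun z _ k hk => Or.inr hk⟩
  have KAdis : ∀ i j, i ≠ j → ∀ z, z ∈ Kc i → z ∈ A j → False := by
    rintro i j hij z hz ⟨k, h1, h2, h3, h4⟩
    by_cases hik : i = k
    · subst hik; exact h4 hz
    · exact Set.disjoint_left.1 (fMK j k i h1 h2 hij hik) h3 hz
  have Bdis : ∀ i j, i ≠ j → ∀ z, z ∈ Bs i → z ∈ Bs j → False := by
    intro i j hij z hi hj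
    rcases Bsub i hi with hi | hi <;> rcases Bsub j hj with hj | hj
    · exact Set.disjoint_left.1 (fKK i j hij) hi hj
    · exact KAdis i j hij z hi hj
    · exact KAdis j i hij.symm z hj hi
    · obtain ⟨k, a1, a2, a3, a4⟩ := hi
      obtain ⟨l, b1, b2, b3, b4⟩ := hj
      exact Set.disjoint_left.1 (fMM i k j l a1 a2 b1 b2 (by simp [hij])) a3 b3
  let ℓ : ℤ × ℤ → Fin n ⊕ (ℤ × ℤ) := fun z => if h : ∃ i, z ∈ Bs i then Sum.inl h.choose else Sum.inr z
  have ℓl : ∀ z i, ℓ z = Sum.inl i ↔ z ∈ Bs i := by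
    intro z i
    by_cases h : ∃ i, z ∈ Bs i
    · simp only [ℓ, dif_pos h, Sum.inl.injEq]
      constructor
      · rintro rfl; exact h.choose_spec
      · intro hz; by_contra hne; exact Bdis _ _ hne z h.choose_spec hz
    · simp only [ℓ, dif_neg h, reduceCtorEq, false_iff]
      exact fun h' => h ⟨_, h'⟩
  have ℓr : ∀ z w, ℓ z = Sum.inr w → z = w := by
    intro z w h
    by_cases h' : ∃ i, z ∈ Bs i
    · simp [ℓ, dif_pos h'] at h
    · simpa [ℓ, dif_neg h'] using h
  -- finiteness
  have Bfin : (⋃ i, Bs i).Finite := by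
    refine Set.finite_iUnion fun i => Set.Finite.subset ?_ (Bsub i)
    refine (cells_finite N hN (hKc i).isBounded).union ?_
    refine Set.Finite.subset (Set.finite_iUnion fun j => cells_finite N hN (hMc i j).isBounded) ?_
    rintro z ⟨j, _, _, h, _⟩
    exact mem_iUnion.2 ⟨j, h⟩
  obtain ⟨T, hT, hTcard⟩ := (Bfin.infinite_compl).exists_subset_card_eq 3
  have Ffin : ((⋃ i, Bs i) ∪ (T : Set (ℤ × ℤ))).Finite := Bfin.union T.finite_toSet
  let pt : ℤ × ℤ → ℂ := fun z => ⟨z.1 / N, z.2 / N⟩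
  have hpt : ∀ z, pt z ∈ cell N z := by
    intro z
    simp only [pt, cell, mem_ofPred_eq]
    rw [mul_div_cancel₀ _ hN.ne', mul_div_cancel₀ _ hN.ne']
    refine ⟨⟨le_rfl, by linarith⟩, le_rfl, by linarith⟩
  obtain ⟨R, hR⟩ := (Ffin.image pt).isBounded.exists_norm_le
  set B := cells N (Metric.closedBall 0 R) with hBdef
  have FB : (⋃ i, Bs i) ∪ (T : Set (ℤ × ℤ)) ⊆ B := fun z hz => ⟨pt z, hpt z, by
    simpa using hR _ (mem_image_of_mem _ hz)⟩
  have BB : ∀ i, Bs i ⊆ B := fun i z hz => FB (Or.inl (mem_iUnion.2 ⟨i, hz⟩))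
  have neg : ∀ k, ∃ k', gridE k + gridE k' = 0 := by
    intro k
    refine ⟨k + 2, ?_⟩
    fin_cases k <;> simp [gridE] <;> rfl
  have ex := map_of_grid B (cells_finite N hN Metric.isBounded_closedBall) ℓ ?_
    (cells_conn N hN Metric.isBounded_closedBall (convex_closedBall 0 R).isPreconnected)
  · obtain ⟨D, W, hD, Map, v1, v2⟩ := ex
    have Tl : ∀ z ∈ T, ℓ z = Sum.inr z := by
      intro z hz
      have : ¬ ∃ i, z ∈ Bs i := fun ⟨i, hi⟩ => hT hz (mem_iUnion.2 ⟨i, hi⟩)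
      simp [ℓ, dif_neg this]
    have h3 : ∀ a b : (Fin n ⊕ (ℤ × ℤ)) ⊕ W, ∃ e, Map.v e ≠ a ∧ Map.v e ≠ b := by
      intro a b
      let g : ℤ × ℤ → (Fin n ⊕ (ℤ × ℤ)) ⊕ W := fun z => Sum.inl (Sum.inr z)
      have : ∃ z ∈ T, g z ≠ a ∧ g z ≠ b := by
        by_contra hcon
        push Not at hcon
        have hsub : T.image g ⊆ {a, b} := by
          intro y hy
          obtain ⟨z, hz, rfl⟩ := Finset.mem_image.1 hy
          have := hcon z hz
          simp only [Finset.mem_insert, Finset.mem_singleton]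
          tauto
        have := Finset.card_le_card hsub
        rw [Finset.card_image_of_injective _ (show Function.Injective g from Sum.inl_injective.comp Sum.inr_injective), hTcard] at this
        have := this.trans Finset.card_le_two
        omega
      obtain ⟨z, hz, h⟩ := this
      obtain ⟨e, he⟩ := v1 z (FB (Or.inr hz))
      rw [Tl z hz] at he
      exact ⟨e, by rw [he]; exact h.1, by rw [he]; exact h.2⟩
    have hne : Nonempty D := by
      have : T.Nonempty := Finset.card_pos.1 (by omega)
      obtain ⟨z, hz⟩ := this
      obtain ⟨e, he⟩ := v1 z (FB (Or.inr hz))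
      exact ⟨e⟩
    obtain ⟨c, r, rpos, hpack, htan⟩ := koebe Map (fun d => h3 _ _)
    have hv : ∀ i, ∃ d, Map.v d = Sum.inl (Sum.inl i) := by
      intro i
      obtain ⟨z, hz⟩ := cells_nonempty N (hKn i)
      have hz := BK i hz
      obtain ⟨d, hd⟩ := v1 z (BB i hz)
      rw [(ℓl z i).2 hz] at hd
      exact ⟨d, hd⟩
    refine ⟨fun i => c (Sum.inl (Sum.inl i)), fun i => r (Sum.inl (Sum.inl i)), fun i => ?_, fun i j hij => ?_,
      fun i j ha hij => ?_⟩
    · obtain ⟨d, hd⟩ := hv i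
      beta_reduce; rw [← hd]; exact rpos d
    · obtain ⟨d, hd⟩ := hv i
      obtain ⟨e, he⟩ := hv j
      beta_reduce; rw [← hd, ← he]
      refine hpack d e ?_
      rw [hd, he]; simpa using hij
    · have : ∃ z ∈ Bs i, ∃ k, z + gridE k ∈ Bs j := by
        by_contra hcon
        push Not at hcon
        have hS := cells_conn N hN (hMc i j).isBounded (hMp i j) (Bs i ∩ Mc i j) inter_subset_right ?_ ?_
        · obtain ⟨x, hxM, hxK⟩ := h2 i j ha hij
          have hc := mem_cell_floor N x
          have : (⌊N * x.re⌋, ⌊N * x.im⌋) ∈ Bs i ∩ Mc i j := by rw [hS]; exact ⟨x, hc, hxM⟩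
          exact Bdis i j hij.ne _ this.1 (BK j ⟨x, hc, hxK⟩)
        · obtain ⟨x, hxM, hxK⟩ := h1 i j ha hij
          have hc := mem_cell_floor N x
          exact ⟨_, BK i ⟨x, hc, hxK⟩, ⟨x, hc, hxM⟩⟩
        · rintro z ⟨hz, hz'⟩ k hk
          exact ⟨BA i z hz k ⟨j, ha, hij, hk, fun h => hcon z hz k (BK j h)⟩, hk⟩
      obtain ⟨z, hz, k, hk⟩ := this
      have e1 := (ℓl z i).2 hz
      have e2 := (ℓl _ j).2 hk
      obtain ⟨d, hd, hd'⟩ := v2 z (BB i hz) k (BB j hk) (by rw [e1, e2]; simpa using hij.ne')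
      have := htan d
      rw [hd, hd', e1, e2] at this
      exact this
  · intro S hSB hcl z hz w hw hzw
    rcases hl : ℓ z with i | y
    · rw [hl] at hzw
      rw [ℓl] at hl hzw
      have stepS : ∀ x ∈ S, x ∈ Bs i → ∀ k, x + gridE k ∈ Bs i → x + gridE k ∈ S := by
        intro x hx hxi k hk
        exact hcl x hx k (BB i hk) (by rw [(ℓl _ _).2 hk, (ℓl _ _).2 hxi])
      by_cases hK : (S ∩ Kc i).Nonempty
      · have hKS : Kc i ⊆ S := by
          have := cells_conn N hN (hKc i).isBounded (hKp i) (S ∩ Kc i) inter_subset_right hK ?_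
          · exact fun x hx => (this.symm.subset hx).1
          · rintro x ⟨hx, hx'⟩ k hk
            exact ⟨stepS x hx (BK i hx') k (BK i hk), hk⟩
        exact (Bmin i (S ∩ Bs i) ⟨subset_inter hKS (BK i), fun x hx k hk =>
          ⟨stepS x hx.1 hx.2 k (BA i x hx.2 k hk), BA i x hx.2 k hk⟩⟩ hzw).1
      · exfalso
        refine (Bmin i (Bs i \ S) ⟨fun x hx => ⟨BK i hx, fun hS => hK ⟨x, hS, hx⟩⟩, fun x hx k hk =>
          ⟨BA i x hx.1 k hk, fun hS => ?_⟩⟩ hl).2 hz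
        obtain ⟨k', hk'⟩ := neg k
        have e : x + gridE k + gridE k' = x := by rw [add_assoc, hk', add_zero]
        have := stepS _ hS (BA i x hx.1 k hk) k' (by rw [e]; exact hx.1)
        rw [e] at this
        exact hx.2 this
    · rw [hl] at hzw
      rw [ℓr _ _ hzw, ← ℓr _ _ hl]; exact hz

end

section
theorem packing_of_drawing {V : Type*} [Fintype V] (G : SimpleGraph V) (D : GraphDrawing V G) (hD : D.NonCrossing) :
    ∃ (c : V → ℂ) (r : V → ℝ), (∀ i, 0 < r i) ∧ (∀ i j, i ≠ j → r i + r j ≤ dist (c i) (c j)) ∧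
      ∀ i j, G.Adj i j → dist (c i) (c j) = r i + r j := by
  classical
  let e := Fintype.equivFin V
  set I1 : Set ℝ := Icc 0 (1/3) with hI1
  set I2 : Set ℝ := Icc (1/3) (2/3) with hI2
  have I1s : I1 ⊆ Icc 0 1 := Icc_subset_Icc le_rfl (by norm_num)
  have I2s : I2 ⊆ Icc 0 1 := Icc_subset_Icc (by norm_num) (by norm_num)
  let H : V → V → Set ℂ := fun u v => if h : G.Adj u v then D.curve h '' I1 else {D.pos u}
  let M : V → V → Set ℂ := fun u v => if h : G.Adj u v then D.curve h '' I2 else {D.pos u}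
  let K : V → Set ℂ := fun u => {D.pos u} ∪ ⋃ v, H u v
  have Hc : ∀ u v, IsCompact (H u v) := by
    intro u v
    by_cases h : G.Adj u v
    · simp only [H, dif_pos h]; exact isCompact_Icc.image_of_continuousOn ((D.cont h).mono I1s)
    · simp only [H, dif_neg h]; exact isCompact_singleton
  have Hp : ∀ u v, IsPreconnected (H u v) := by
    intro u v
    by_cases h : G.Adj u v
    · simp only [H, dif_pos h]; exact isPreconnected_Icc.image _ ((D.cont h).mono I1s)
    · simp only [H, dif_neg h]; exact isPreconnected_singleton
  have Hm : ∀ u v, D.pos u ∈ H u v := by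
    intro u v
    by_cases h : G.Adj u v
    · simp only [H, dif_pos h]; exact ⟨0, ⟨le_rfl, by norm_num⟩, D.source_eq h⟩
    · simp only [H, dif_neg h]; exact mem_singleton _
  have Hi : ∀ u v x, x ∈ H u v → x = D.pos u ∨ ∃ h : G.Adj u v, ∃ t ∈ I1, D.curve h t = x := by
    intro u v x hx
    by_cases h : G.Adj u v
    · simp only [H, dif_pos h] at hx; exact Or.inr ⟨h, hx⟩
    · simp only [H, dif_neg h] at hx; exact Or.inl hx
  have Ki : ∀ u x, x ∈ K u → x = D.pos u ∨ ∃ v, ∃ h : G.Adj u v, ∃ t ∈ I1, D.curve h t = x := by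
    rintro u x (hx | hx)
    · exact Or.inl hx
    · obtain ⟨v, hv⟩ := mem_iUnion.1 hx
      rcases Hi u v x hv with h | h
      · exact Or.inl h
      · exact Or.inr ⟨v, h⟩
  -- endpoint values
  have at0 : ∀ {u v} (h : G.Adj u v), ∀ t ∈ Icc (0:ℝ) 1, D.curve h t = D.pos u → t = 0 := by
    intro u v h t ht he
    exact D.simple h ht ⟨le_rfl, zero_le_one⟩ (by rw [he, D.source_eq])
  have at1 : ∀ {u v} (h : G.Adj u v), ∀ t ∈ Icc (0:ℝ) 1, D.curve h t = D.pos v → t = 1 := by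
    intro u v h t ht he
    exact D.simple h ht ⟨zero_le_one, le_rfl⟩ (by rw [he, D.target_eq])
  -- a vertex on an edge
  have von : ∀ {u v} (h : G.Adj u v), ∀ t ∈ Icc (0:ℝ) 1, ∀ w, D.curve h t = D.pos w → (w = u ∧ t = 0) ∨ (w = v ∧ t = 1) := by
    intro u v h t ht w he
    rcases D.vertexFree h w ⟨t, ht, he⟩ with rfl | rfl
    · exact Or.inl ⟨rfl, at0 h t ht he⟩
    · exact Or.inr ⟨rfl, at1 h t ht he⟩
  -- two edges meeting
  have meet : ∀ {u v u' v'} (h : G.Adj u v) (h' : G.Adj u' v'), ∀ t ∈ Icc (0:ℝ) 1, ∀ t' ∈ Icc (0:ℝ) 1,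
      D.curve h t = D.curve h' t' → (u = u' ∧ v = v' ∧ t = t') ∨ (u = v' ∧ v = u' ∧ t = 1 - t') ∨
        ((t = 0 ∨ t = 1) ∧ (t' = 0 ∨ t' = 1) ∧ ∃ w, D.curve h t = D.pos w) := by
    intro u v u' v' h h' t ht t' ht' he
    by_cases hs : s(u, v) = s(u', v')
    · rcases Sym2.eq_iff.1 hs with ⟨rfl, rfl⟩ | ⟨rfl, rfl⟩
      · exact Or.inl ⟨rfl, rfl, D.simple h ht ht' he⟩
      · right; left
        refine ⟨rfl, rfl, ?_⟩
        have : D.curve h' t' = D.curve h (1 - t') := D.symm h t'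
        rw [this] at he
        exact D.simple h ht ⟨by linarith [ht'.2], by linarith [ht'.1]⟩ he
    · right; right
      have := hD h h' hs ⟨⟨t, ht, rfl⟩, ⟨t', ht', he.symm⟩⟩
      obtain ⟨w, hw⟩ : ∃ w, D.curve h t = D.pos w := by
        rcases this.1 with h | h
        · exact ⟨_, h⟩
        · exact ⟨_, h⟩
      refine ⟨?_, ?_, w, hw⟩
      · rcases von h t ht w hw with h | h
        · exact Or.inl h.2
        · exact Or.inr h.2
      · rcases von h' t' ht' w (he ▸ hw) with h | h
        · exact Or.inl h.2
        · exact Or.inr h.2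
  have KK : ∀ u w, u ≠ w → Disjoint (K u) (K w) := by
    intro u w huw
    rw [Set.disjoint_left]
    intro x hx hx'
    have aux : ∀ a b, a ≠ b → ∀ v, ∀ h : G.Adj a v, ∀ t ∈ I1, D.curve h t ≠ D.pos b := by
      intro a b hab v h t ht he
      rcases von h t (I1s ht) b he with h | h
      · exact hab h.1.symm
      · have := ht.2; rw [h.2] at this; norm_num at this
    rcases Ki u x hx with rfl | ⟨v, h, t, ht, rfl⟩ <;> rcases Ki w _ hx' with h' | ⟨v', h', t', ht', he⟩
    · exact huw (D.inj h')
    · exact aux w u huw.symm v' h' t' ht' he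
    · exact aux u w huw v h t ht h'
    · rcases meet h h' t (I1s ht) t' (I1s ht') he.symm with a | a | a
      · exact huw a.1
      · have := a.2.2; have := ht.2; have := ht'.2; linarith
      · obtain ⟨a1, a2, y, a3⟩ := a
        have ht0 : t = 0 := by
          rcases a1 with h | h
          · exact h
          · have := ht.2; rw [h] at this; norm_num at this
        rw [ht0, D.source_eq] at he
        exact aux w u huw.symm v' h' t' ht' he
  have MK : ∀ i j k, G.Adj i j → k ≠ i → k ≠ j → Disjoint (M i j) (K k) := by
    intro i j k h hi hj
    rw [Set.disjoint_left]
    intro x hx hx'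
    simp only [M, dif_pos h] at hx
    obtain ⟨t, ht, rfl⟩ := hx
    rcases Ki k _ hx' with h' | ⟨v', h', t', ht', he⟩
    · rcases von h t (I2s ht) k h' with a | a
      · exact hi a.1
      · exact hj a.1
    · rcases meet h h' t (I2s ht) t' (I1s ht') he.symm with a | a | a
      · exact hi a.1.symm
      · exact hj a.2.1.symm
      · have := ht.1; have := ht.2
        rcases a.1 with a | a <;> rw [a] at ht <;> norm_num [hI2] at ht
  have MM : ∀ i j i' j', G.Adj i j → G.Adj i' j' → s(i, j) ≠ s(i', j') → Disjoint (M i j) (M i' j') := by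
    intro i j i' j' h h' hne
    rw [Set.disjoint_left]
    intro x hx hx'
    simp only [M, dif_pos h] at hx
    simp only [M, dif_pos h'] at hx'
    obtain ⟨t, ht, rfl⟩ := hx
    obtain ⟨t', ht', he⟩ := hx'
    rcases meet h h' t (I2s ht) t' (I2s ht') he.symm with a | a | a
    · exact hne (by rw [a.1, a.2.1])
    · exact hne (by rw [a.1, a.2.1, Sym2.eq_swap])
    · rcases a.1 with a | a <;> rw [a] at ht <;> norm_num [hI2] at ht
  obtain ⟨c, r, h1, h2, h3⟩ := packing_of_sets (Fintype.card V) (fun i => K (e.symm i)) (fun i j => M (e.symm i) (e.symm j))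
    (fun i j => G.Adj (e.symm i) (e.symm j))
    (fun i => isCompact_singleton.union (isCompact_iUnion fun v => Hc _ v))
    (fun i => by
      have : K (e.symm i) = ⋃ v : Option V, (v.elim {D.pos (e.symm i)} (H (e.symm i))) := by
        rw [Set.iUnion_option]; rfl
      beta_reduce
      rw [this]
      refine isPreconnected_iUnion ⟨D.pos (e.symm i), ?_⟩ ?_
      · simp only [mem_iInter]
        rintro (_ | v)
        · exact mem_singleton _
        · exact Hm _ v
      · rintro (_ | v)
        · exact isPreconnected_singleton
        · exact Hp _ v)
    (fun i => ⟨_, Or.inl rfl⟩)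
    (fun i j => by
      by_cases h : G.Adj (e.symm i) (e.symm j)
      · simp only [M, dif_pos h]; exact isCompact_Icc.image_of_continuousOn ((D.cont h).mono I2s)
      · simp only [M, dif_neg h]; exact isCompact_singleton)
    (fun i j => by
      by_cases h : G.Adj (e.symm i) (e.symm j)
      · simp only [M, dif_pos h]; exact isPreconnected_Icc.image _ ((D.cont h).mono I2s)
      · simp only [M, dif_neg h]; exact isPreconnected_singleton)
    (fun i j hij => KK _ _ (e.symm.injective.ne hij))
    (fun i j k h _ hi hj => MK _ _ _ h (e.symm.injective.ne hi) (e.symm.injective.ne hj))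
    (fun i j i' j' h hij h' hij' hne => MM _ _ _ _ h h' (by
      intro hs
      rcases Sym2.eq_iff.1 hs with ⟨a, b⟩ | ⟨a, b⟩
      · exact hne (by rw [e.symm.injective a, e.symm.injective b])
      · rw [e.symm.injective a, e.symm.injective b] at hij
        exact lt_asymm hij hij'))
    (fun i j h _ => ⟨D.curve h (1/3), by
      simp only [M, dif_pos h]; exact ⟨1/3, by norm_num [hI2], rfl⟩,
      Or.inr (mem_iUnion.2 ⟨e.symm j, by simp only [H, dif_pos h]; exact ⟨1/3, by norm_num [hI1], rfl⟩⟩)⟩)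
    (fun i j h _ => ⟨D.curve h (2/3), by
      simp only [M, dif_pos h]; exact ⟨2/3, by norm_num [hI2], rfl⟩,
      Or.inr (mem_iUnion.2 ⟨e.symm i, by
        simp only [H, dif_pos h.symm]
        refine ⟨1/3, by norm_num [hI1], ?_⟩
        rw [D.symm h]; norm_num⟩)⟩)
  refine ⟨fun v => c (e v), fun v => r (e v), fun v => h1 _, fun u v huv => h2 _ _ (e.injective.ne huv), fun u v h => ?_⟩
  rcases lt_or_gt_of_ne (e.injective.ne h.ne) with hlt | hlt
  · exact h3 _ _ (by simpa using h) hlt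
  · have := h3 _ _ (by simpa using h.symm) hlt
    rw [dist_comm, this, add_comm]

end

section
/-- normalized circular arc from `0` to `1` -/
def arcE (κ t : ℝ) : ℂ := if κ = 0 then (t : ℂ) else
  (Complex.exp ((2 * κ * t : ℝ) * Complex.I) - 1) / (Complex.exp ((2 * κ : ℝ) * Complex.I) - 1)

def arcE' (κ t : ℝ) : ℂ := if κ = 0 then 1 else
  ((2 * κ : ℝ) * Complex.I * Complex.exp ((2 * κ * t : ℝ) * Complex.I)) / (Complex.exp ((2 * κ : ℝ) * Complex.I) - 1)

theorem exp_two_sub (x : ℝ) : Complex.exp ((2 * x : ℝ) * Complex.I) - 1 =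
    2 * Complex.I * (Real.sin x : ℝ) * Complex.exp (x * Complex.I) := by
  have h1 : Complex.exp ((2 * x : ℝ) * Complex.I) = Complex.exp (x * Complex.I) * Complex.exp (x * Complex.I) := by
    rw [← Complex.exp_add]; congr 1; push_cast; ring
  have h2 : ((Real.sin x : ℝ) : ℂ) ^ 2 + ((Real.cos x : ℝ) : ℂ) ^ 2 = 1 := by
    exact_mod_cast Real.sin_sq_add_cos_sq x
  rw [h1, Complex.exp_mul_I, ← Complex.ofReal_cos, ← Complex.ofReal_sin]
  generalize ((Real.sin x : ℝ) : ℂ) = S at *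
  generalize ((Real.cos x : ℝ) : ℂ) = C at *
  linear_combination (1:ℂ) * h2 + (-S ^ 2) * Complex.I_sq

theorem sin_ne {κ : ℝ} (h : κ ∈ Ioo (-Real.pi) Real.pi) (h0 : κ ≠ 0) : Real.sin κ ≠ 0 := by
  rcases lt_or_gt_of_ne h0 with h1 | h1
  · exact (Real.sin_neg_of_neg_of_neg_pi_lt h1 h.1).ne
  · exact (Real.sin_pos_of_pos_of_lt_pi h1 h.2).ne'

theorem den_ne {κ : ℝ} (h : κ ∈ Ioo (-Real.pi) Real.pi) (h0 : κ ≠ 0) :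
    Complex.exp ((2 * κ : ℝ) * Complex.I) - 1 ≠ 0 := by
  rw [exp_two_sub]
  have := sin_ne h h0
  have h2 : ((Real.sin κ : ℝ) : ℂ) ≠ 0 := by exact_mod_cast this
  exact mul_ne_zero (mul_ne_zero (mul_ne_zero two_ne_zero Complex.I_ne_zero) h2) (Complex.exp_ne_zero _)

theorem arcE_zero (κ : ℝ) : arcE κ 0 = 0 := by unfold arcE; split_ifs <;> simp

theorem arcE_one {κ : ℝ} (h : κ ∈ Ioo (-Real.pi) Real.pi) : arcE κ 1 = 1 := by
  unfold arcE; split_ifs with h0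
  · simp
  · rw [mul_one, div_self (den_ne h h0)]

theorem arcE_deriv (κ t : ℝ) : HasDerivAt (arcE κ) (arcE' κ t) t := by
  unfold arcE arcE'
  split_ifs with h0
  · exact Complex.ofRealCLM.hasDerivAt
  · have h1 : HasDerivAt (fun t : ℝ => ((2 * κ * t : ℝ) : ℂ)) ((2 * κ : ℝ) : ℂ) t := by
      have : HasDerivAt (fun t : ℝ => 2 * κ * t) (2 * κ) t := by simpa using (hasDerivAt_id t).const_mul (2 * κ)
      exact this.ofReal_comp
    have h2 := ((h1.mul_const Complex.I).cexp.sub_const 1).div_const (Complex.exp ((2 * κ : ℝ) * Complex.I) - 1)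
    refine h2.congr_deriv ?_
    congr 1
    ring

theorem arcE'_cont (κ : ℝ) : Continuous (arcE' κ) := by
  unfold arcE'
  split_ifs with h0
  · exact continuous_const
  · fun_prop

theorem arcE_cont (κ : ℝ) : Continuous (arcE κ) :=
  continuous_iff_continuousAt.2 fun t => (arcE_deriv κ t).continuousAt

theorem arcE'_ne {κ : ℝ} (h : κ ∈ Ioo (-Real.pi) Real.pi) (t : ℝ) : arcE' κ t ≠ 0 := by
  unfold arcE'
  split_ifs with h0
  · exact one_ne_zero
  · refine div_ne_zero (mul_ne_zero (mul_ne_zero ?_ Complex.I_ne_zero) (Complex.exp_ne_zero _)) (den_ne h h0)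
    exact_mod_cast mul_ne_zero two_ne_zero h0

theorem arcE'_ends {κ : ℝ} (h : κ ∈ Ioo (-Real.pi) Real.pi) : ∃ σ : ℝ, 0 < σ ∧
    arcE' κ 0 = σ * Complex.exp (-(κ * Complex.I)) ∧ arcE' κ 1 = σ * Complex.exp (κ * Complex.I) := by
  by_cases h0 : κ = 0
  · refine ⟨1, one_pos, ?_, ?_⟩ <;> simp [arcE', h0]
  · have hs := sin_ne h h0
    refine ⟨κ / Real.sin κ, ?_, ?_, ?_⟩
    · rcases lt_or_gt_of_ne h0 with h1 | h1
      · exact div_pos_of_neg_of_neg h1 (Real.sin_neg_of_neg_of_neg_pi_lt h1 h.1)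
      · exact div_pos h1 (Real.sin_pos_of_pos_of_lt_pi h1 h.2)
    all_goals
      have hs' : ((Real.sin κ : ℝ) : ℂ) ≠ 0 := by exact_mod_cast hs
      have he := Complex.exp_ne_zero (κ * Complex.I)
      have hI := Complex.I_ne_zero
      simp only [arcE', if_neg h0, exp_two_sub, mul_zero, Complex.ofReal_zero, zero_mul, Complex.exp_zero, mul_one]
      rw [Complex.ofReal_div]
      generalize ((Real.sin κ : ℝ) : ℂ) = S at *
    · rw [Complex.exp_neg]; push_cast; field_simp
    · have : Complex.exp ((2 * κ : ℝ) * Complex.I) = Complex.exp (κ * Complex.I) * Complex.exp (κ * Complex.I) := by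
        rw [← Complex.exp_add]; congr 1; push_cast; ring
      rw [this]; push_cast; field_simp

theorem arcE_ratio {κ : ℝ} (h : κ ∈ Ioo (-Real.pi) Real.pi) {t : ℝ} (ht : t ∈ Ioo (0 : ℝ) 1) :
    ∃ s : ℝ, 0 < s ∧ arcE κ t ≠ 0 ∧ 1 - arcE κ t = s * Complex.exp (κ * Complex.I) * arcE κ t := by
  by_cases h0 : κ = 0
  · refine ⟨(1 - t) / t, div_pos (by linarith [ht.2]) ht.1, ?_, ?_⟩
    · simp [arcE, h0, ht.1.ne']
    · have : (t : ℂ) ≠ 0 := by exact_mod_cast ht.1.ne'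
      simp [arcE, h0]; field_simp
  · have hs := sin_ne h h0
    have hmem : ∀ x ∈ Ioo (0:ℝ) 1, κ * x ∈ Ioo (-Real.pi) Real.pi ∧ κ * x ≠ 0 := by
      intro x hx
      have habs : |κ * x| < Real.pi := by
        rw [abs_mul, abs_of_pos hx.1]
        have : |κ| < Real.pi := abs_lt.2 h
        nlinarith [abs_nonneg κ, hx.2]
      exact ⟨abs_lt.1 habs, mul_ne_zero h0 hx.1.ne'⟩
    obtain ⟨m1, n1⟩ := hmem t ht
    obtain ⟨m2, n2⟩ := hmem (1 - t) ⟨by linarith [ht.2], by linarith [ht.1]⟩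
    have s1 := sin_ne m1 n1
    have s2 := sin_ne m2 n2
    have hE : arcE κ t = Complex.exp (-(κ * (1 - t) : ℝ) * Complex.I) * ((Real.sin (κ * t) : ℝ) : ℂ) / ((Real.sin κ : ℝ) : ℂ) := by
      have hs' : ((Real.sin κ : ℝ) : ℂ) ≠ 0 := by exact_mod_cast hs
      have he := Complex.exp_ne_zero (κ * Complex.I)
      have hI := Complex.I_ne_zero
      have : Complex.exp (-(κ * (1 - t) : ℝ) * Complex.I) = Complex.exp ((κ * t : ℝ) * Complex.I) / Complex.exp (κ * Complex.I) := by
        rw [← Complex.exp_sub]; congr 1; push_cast; ring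
      rw [arcE, if_neg h0, mul_assoc 2 κ t, exp_two_sub, exp_two_sub, this]
      field_simp
    refine ⟨Real.sin (κ * (1 - t)) / Real.sin (κ * t), ?_, ?_, ?_⟩
    · rcases lt_or_gt_of_ne h0 with h1 | h1
      · exact div_pos_of_neg_of_neg (Real.sin_neg_of_neg_of_neg_pi_lt (mul_neg_of_neg_of_pos h1 (by linarith [ht.2])) m2.1)
          (Real.sin_neg_of_neg_of_neg_pi_lt (mul_neg_of_neg_of_pos h1 ht.1) m1.1)
      · exact div_pos (Real.sin_pos_of_pos_of_lt_pi (mul_pos h1 (by linarith [ht.2])) m2.2)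
          (Real.sin_pos_of_pos_of_lt_pi (mul_pos h1 ht.1) m1.2)
    · rw [hE]
      refine div_ne_zero (mul_ne_zero (Complex.exp_ne_zero _) ?_) ?_
      · exact_mod_cast s1
      · exact_mod_cast hs
    · have hs' : ((Real.sin κ : ℝ) : ℂ) ≠ 0 := by exact_mod_cast hs
      have s1' : ((Real.sin (κ * t) : ℝ) : ℂ) ≠ 0 := by exact_mod_cast s1
      have key : ((Real.sin κ : ℝ) : ℂ) = Complex.exp (-(κ * (1 - t) : ℝ) * Complex.I) * ((Real.sin (κ * t) : ℝ) : ℂ) +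
          ((Real.sin (κ * (1 - t)) : ℝ) : ℂ) * Complex.exp ((κ * t : ℝ) * Complex.I) := by
        rw [neg_mul, Complex.exp_neg, ← Complex.exp_neg, ← neg_mul, ← Complex.ofReal_neg, Complex.exp_mul_I, Complex.exp_mul_I,
          ← Complex.ofReal_cos, ← Complex.ofReal_sin, ← Complex.ofReal_cos, ← Complex.ofReal_sin, Real.cos_neg, Real.sin_neg]
        have : Real.sin κ = Real.sin (κ * t) * Real.cos (κ * (1 - t)) + Real.cos (κ * t) * Real.sin (κ * (1 - t)) := by
          rw [← Real.sin_add]; congr 1; ring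
        rw [this]
        generalize Real.sin (κ * t) = a
        generalize Real.sin (κ * (1 - t)) = b
        generalize Real.cos (κ * t) = c
        generalize Real.cos (κ * (1 - t)) = d
        push_cast; ring
      have e2 : Complex.exp (κ * Complex.I) * Complex.exp (-(κ * (1 - t) : ℝ) * Complex.I) = Complex.exp ((κ * t : ℝ) * Complex.I) := by
        rw [← Complex.exp_add]; congr 1; push_cast; ring
      rw [hE, Complex.ofReal_div]
      generalize ((Real.sin (κ * t) : ℝ) : ℂ) = a at *
      generalize ((Real.sin (κ * (1 - t)) : ℝ) : ℂ) = b at *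
      generalize ((Real.sin κ : ℝ) : ℂ) = S at *
      generalize Complex.exp (-(κ * (1 - t) : ℝ) * Complex.I) = x1 at *
      generalize Complex.exp ((κ * t : ℝ) * Complex.I) = x2 at *
      generalize Complex.exp (κ * Complex.I) = x3 at *
      field_simp
      linear_combination key - b * e2

theorem arcE_inj {κ : ℝ} (h : κ ∈ Ioo (-Real.pi) Real.pi) : InjOn (arcE κ) (Icc 0 1) := by
  intro x hx y hy hxy
  by_cases h0 : κ = 0
  · simpa [arcE, h0] using hxy
  · simp only [arcE, if_neg h0] at hxy
    rw [div_left_inj' (den_ne h h0), sub_left_inj, Complex.exp_eq_exp_iff_exists_int] at hxy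
    obtain ⟨n, hn⟩ := hxy
    have h2 : κ * (x - y) = n * Real.pi := by
      have : ((2 * κ * x : ℝ) : ℂ) * Complex.I = ((2 * κ * y + 2 * n * Real.pi : ℝ) : ℂ) * Complex.I := by
        rw [hn]; push_cast; ring
      have := mul_right_cancel₀ Complex.I_ne_zero this
      have : 2 * κ * x = 2 * κ * y + 2 * n * Real.pi := by exact_mod_cast this
      linarith
    have habs : |κ * (x - y)| < Real.pi := by
      rw [abs_mul]
      have h1 : |κ| < Real.pi := abs_lt.2 h
      have h3 : |x - y| ≤ 1 := abs_le.2 ⟨by linarith [hx.1, hy.2], by linarith [hx.2, hy.1]⟩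
      nlinarith [abs_nonneg κ, abs_nonneg (x - y)]
    rw [h2, abs_mul, abs_of_pos Real.pi_pos] at habs
    have h4 : |(n : ℝ)| < 1 := by
      by_contra hc; push Not at hc; nlinarith [Real.pi_pos]
    have h5 : |n| < 1 := by exact_mod_cast h4
    have : n = 0 := Int.abs_lt_one_iff.1 h5
    rw [this] at h2
    simp [h0] at h2
    linarith

/-- circular arc from `A` to `B` -/
def arcC (A B : ℂ) (κ t : ℝ) : ℂ := A + (B - A) * arcE κ t

theorem arcC_isArc {A B : ℂ} (hAB : A ≠ B) {κ : ℝ} (h : κ ∈ Ioo (-Real.pi) Real.pi) : IsArcOn (arcC A B κ) 0 1 := by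
  by_cases h0 : κ = 0
  · refine ⟨Piece.seg A B, hAB, fun u _ => ?_⟩
    simp [arcC, arcE, h0, Piece.toFun]; ring
  · set z := (B - A) / (Complex.exp ((2 * κ : ℝ) * Complex.I) - 1) with hz
    have hz0 : z ≠ 0 := div_ne_zero (sub_ne_zero.2 hAB.symm) (den_ne h h0)
    refine ⟨Piece.arc (A - z) ‖z‖ (Complex.arg z) (Complex.arg z + 2 * κ), ⟨norm_ne_zero_iff.2 hz0, by simpa using h0⟩, fun u _ => ?_⟩
    have e : Complex.exp (Complex.I * ((Complex.arg z + u * (Complex.arg z + 2 * κ - Complex.arg z) : ℝ) : ℂ)) =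
        Complex.exp (Complex.arg z * Complex.I) * Complex.exp ((2 * κ * u : ℝ) * Complex.I) := by
      rw [← Complex.exp_add]; congr 1; push_cast; ring
    simp only [Piece.toFun]
    rw [e, ← mul_assoc, Complex.norm_mul_exp_arg_mul_I]
    simp only [arcC, arcE, if_neg h0]
    rw [hz]
    have := den_ne h h0
    rw [show (0:ℝ) + u * (1 - 0) = u by ring]
    field_simp
    ring

end

section
def Reg (γ γ' : ℝ → ℂ) : Prop :=
  (∀ t ∈ Icc (0:ℝ) 1, HasDerivWithinAt γ (γ' t) (Icc 0 1) t) ∧ ContinuousOn γ' (Icc 0 1) ∧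
    ∀ t ∈ Icc (0:ℝ) 1, γ' t ≠ 0

def arcC' (A B : ℂ) (κ t : ℝ) : ℂ := (B - A) * arcE' κ t

theorem arcC_zero (A B : ℂ) (κ : ℝ) : arcC A B κ 0 = A := by simp [arcC, arcE_zero]

theorem arcC_one (A B : ℂ) {κ : ℝ} (h : κ ∈ Ioo (-Real.pi) Real.pi) : arcC A B κ 1 = B := by simp [arcC, arcE_one h]

theorem arcC_reg {A B : ℂ} (hAB : A ≠ B) {κ : ℝ} (h : κ ∈ Ioo (-Real.pi) Real.pi) :
    Reg (arcC A B κ) (arcC' A B κ) := by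
  refine ⟨fun t _ => ?_, ?_, fun t _ => ?_⟩
  · exact (((arcE_deriv κ t).const_mul (B - A)).const_add A).hasDerivWithinAt
  · exact (continuous_const.mul (arcE'_cont κ)).continuousOn
  · exact mul_ne_zero (sub_ne_zero.2 hAB.symm) (arcE'_ne h t)

theorem arcC_inj {A B : ℂ} (hAB : A ≠ B) {κ : ℝ} (h : κ ∈ Ioo (-Real.pi) Real.pi) :
    InjOn (arcC A B κ) (Icc 0 1) := by
  intro x hx y hy hxy
  simp only [arcC, add_right_inj] at hxy
  exact arcE_inj h hx hy (mul_left_cancel₀ (sub_ne_zero.2 hAB.symm) hxy)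

theorem arcC_polyArc {A B : ℂ} (hAB : A ≠ B) {κ : ℝ} (h : κ ∈ Ioo (-Real.pi) Real.pi) :
    PolyArc 1 (arcC A B κ) := by
  refine ⟨1, one_pos, le_rfl, fun n => n, by simp, by simp, fun i _ => by simp, fun i hi => ?_⟩
  obtain rfl : i = 0 := by omega
  simpa using arcC_isArc hAB h

theorem pw_cont {b : ℝ} (hb : b ∈ Ioo (0:ℝ) 1) {f g : ℝ → ℂ} (hf : ContinuousOn f (Icc 0 b))
    (hg : ContinuousOn g (Icc b 1)) (h : f b = g b) :
    ContinuousOn (fun t => if t ≤ b then f t else g t) (Icc 0 1) := by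
  rw [← Icc_union_Icc_eq_Icc hb.1.le hb.2.le]
  refine ContinuousOn.union_of_isClosed (hf.congr fun t ht => ?_) (hg.congr fun t ht => ?_) isClosed_Icc isClosed_Icc
  · simp [ht.2]
  · beta_reduce
    split_ifs with h1
    · rw [le_antisymm h1 ht.1, h]
    · rfl

theorem pw_deriv {b : ℝ} (hb : b ∈ Ioo (0:ℝ) 1) {f g f' g' : ℝ → ℂ}
    (hf : ∀ t ∈ Icc 0 b, HasDerivWithinAt f (f' t) (Icc 0 b) t)
    (hg : ∀ t ∈ Icc b 1, HasDerivWithinAt g (g' t) (Icc b 1) t) (h : f b = g b) (h' : f' b = g' b) :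
    ∀ t ∈ Icc (0:ℝ) 1, HasDerivWithinAt (fun t => if t ≤ b then f t else g t)
      (if t ≤ b then f' t else g' t) (Icc 0 1) t := by
  intro t ht
  have e1 : ∀ t ∈ Icc 0 b, (fun t => if t ≤ b then f t else g t) t = f t := fun t ht => by simp [ht.2]
  have e2 : ∀ t ∈ Icc b 1, (fun t => if t ≤ b then f t else g t) t = g t := fun t ht => by
    beta_reduce
    split_ifs with h1
    · rw [le_antisymm h1 ht.1, h]
    · rfl
  rw [← Icc_union_Icc_eq_Icc hb.1.le hb.2.le]
  refine HasDerivWithinAt.union ?_ ?_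
  · by_cases h1 : t ≤ b
    · rw [if_pos h1]
      exact (hf t ⟨ht.1, h1⟩).congr e1 (e1 t ⟨ht.1, h1⟩)
    · exact HasFDerivWithinAt.of_notMem_closure (by rw [closure_Icc]; exact fun h => h1 h.2)
  · by_cases h1 : b ≤ t
    · have : (if t ≤ b then f' t else g' t) = g' t := by
        split_ifs with h2
        · rw [le_antisymm h2 h1, h']
        · rfl
      rw [this]
      exact (hg t ⟨h1, ht.2⟩).congr e2 (e2 t ⟨h1, ht.2⟩)
    · exact HasFDerivWithinAt.of_notMem_closure (by rw [closure_Icc]; exact fun h => h1 h.1)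

def join (b : ℝ) (F G : ℝ → ℂ) (t : ℝ) : ℂ := if t ≤ b then F (t / b) else G ((1 - t) / (1 - b))

def join' (b : ℝ) (F' G' : ℝ → ℂ) (t : ℝ) : ℂ :=
  if t ≤ b then F' (t / b) / b else - G' ((1 - t) / (1 - b)) / ((1 - b : ℝ) : ℂ)

section
variable {b : ℝ} {F G F' G' : ℝ → ℂ}

theorem map_left (hb : b ∈ Ioo (0:ℝ) 1) : MapsTo (fun t => t / b) (Icc 0 b) (Icc (0:ℝ) 1) := fun t ht =>
  ⟨div_nonneg ht.1 hb.1.le, (div_le_one hb.1).2 ht.2⟩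

theorem map_right (hb : b ∈ Ioo (0:ℝ) 1) : MapsTo (fun t => (1 - t) / (1 - b)) (Icc b 1) (Icc (0:ℝ) 1) := fun t ht =>
  ⟨div_nonneg (by linarith [ht.2]) (by linarith [hb.2]), (div_le_one (by linarith [hb.2])).2 (by linarith [ht.1])⟩

theorem join_left (hb : b ∈ Ioo (0:ℝ) 1) {t : ℝ} (h : t ≤ b) : join b F G t = F (t / b) := if_pos h

theorem join_right (hb : b ∈ Ioo (0:ℝ) 1) (hFG : F 1 = G 1) {t : ℝ} (h : b ≤ t) : join b F G t = G ((1 - t) / (1 - b)) := by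
  rcases h.eq_or_lt with rfl | h
  · rw [join_left hb le_rfl, div_self hb.1.ne', div_self (by linarith [hb.2]), hFG]
  · exact if_neg (not_le.2 h)

theorem join_zero (hb : b ∈ Ioo (0:ℝ) 1) : join b F G 0 = F 0 := by rw [join_left hb hb.1.le, zero_div]

theorem join_one (hb : b ∈ Ioo (0:ℝ) 1) (hFG : F 1 = G 1) : join b F G 1 = G 0 := by rw [join_right hb hFG hb.2.le, sub_self, zero_div]

theorem join_symm (hb : b ∈ Ioo (0:ℝ) 1) (hFG : F 1 = G 1) (t : ℝ) : join (1 - b) G F t = join b F G (1 - t) := by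
  have hb' : 1 - b ∈ Ioo (0:ℝ) 1 := ⟨by linarith [hb.2], by linarith [hb.1]⟩
  rcases le_total t (1 - b) with h | h
  · rw [join_left hb' h, join_right hb hFG (by linarith)]; congr 2; ring
  · rw [join_right hb' hFG.symm h, join_left hb (by linarith)]; congr 2; ring

theorem join_cont (hb : b ∈ Ioo (0:ℝ) 1) (hF : ContinuousOn F (Icc 0 1)) (hG : ContinuousOn G (Icc 0 1)) (hFG : F 1 = G 1) :
    ContinuousOn (join b F G) (Icc 0 1) := by
  refine pw_cont hb (hF.comp (by fun_prop) (map_left hb)) (hG.comp (f := fun t => (1 - t) / (1 - b)) (by fun_prop) (map_right hb)) ?_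
  rw [div_self hb.1.ne', div_self (by linarith [hb.2]), hFG]

theorem join_image (hb : b ∈ Ioo (0:ℝ) 1) (hFG : F 1 = G 1) : join b F G '' Icc 0 1 = F '' Icc 0 1 ∪ G '' Icc 0 1 := by
  have h1b : 0 < 1 - b := by linarith [hb.2]
  apply Subset.antisymm
  · rintro _ ⟨t, ht, rfl⟩
    rcases le_total t b with h | h
    · rw [join_left hb h]; exact Or.inl ⟨_, map_left hb ⟨ht.1, h⟩, rfl⟩
    · rw [join_right hb hFG h]; exact Or.inr ⟨_, map_right hb ⟨h, ht.2⟩, rfl⟩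
  · rintro _ (⟨s, hs, rfl⟩ | ⟨s, hs, rfl⟩)
    · refine ⟨s * b, ⟨mul_nonneg hs.1 hb.1.le, by nlinarith [hs.1, hs.2, hb.1, hb.2]⟩, ?_⟩
      rw [join_left hb (by nlinarith [hs.2, hb.1]), mul_div_cancel_right₀ _ hb.1.ne']
    · refine ⟨1 - s * (1 - b), ⟨by nlinarith [hs.1, hs.2, hb.1], by nlinarith [hs.1]⟩, ?_⟩
      rw [join_right hb hFG (by nlinarith [hs.2]), sub_sub_cancel, mul_div_cancel_right₀ _ h1b.ne']

theorem join_inj (hb : b ∈ Ioo (0:ℝ) 1) (hF : InjOn F (Icc 0 1)) (hG : InjOn G (Icc 0 1)) (hFG : F 1 = G 1)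
    (hd : ∀ s ∈ Icc (0:ℝ) 1, ∀ t ∈ Icc (0:ℝ) 1, F s = G t → s = 1 ∧ t = 1) : InjOn (join b F G) (Icc 0 1) := by
  have h1b : 0 < 1 - b := by linarith [hb.2]
  have hb1 := hb.1
  have cross : ∀ x y : ℝ, x ∈ Icc 0 b → y ∈ Icc b 1 → join b F G x = join b F G y → x = y := by
    intro x y hx hy hxy
    rw [join_left hb hx.2, join_right hb hFG hy.1] at hxy
    obtain ⟨e1, e2⟩ := hd _ (map_left hb hx) _ (map_right hb hy) hxy
    beta_reduce at e1 e2
    rw [div_eq_one_iff_eq hb1.ne'] at e1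
    rw [div_eq_one_iff_eq h1b.ne'] at e2
    linarith
  intro x hx y hy hxy
  rcases le_total x b with h1 | h1 <;> rcases le_total y b with h2 | h2
  · rw [join_left hb h1, join_left hb h2] at hxy
    have := hF (map_left hb ⟨hx.1, h1⟩) (map_left hb ⟨hy.1, h2⟩) hxy
    exact (div_left_inj' hb1.ne').1 this
  · exact cross x y ⟨hx.1, h1⟩ ⟨h2, hy.2⟩ hxy
  · exact (cross y x ⟨hy.1, h2⟩ ⟨h1, hx.2⟩ hxy.symm).symm
  · rw [join_right hb hFG h1, join_right hb hFG h2] at hxy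
    have := hG (map_right hb ⟨h1, hx.2⟩) (map_right hb ⟨h2, hy.2⟩) hxy
    have := (div_left_inj' h1b.ne').1 this
    linarith

theorem join_left_deriv (hb : b ∈ Ioo (0:ℝ) 1) (hF : Reg F F') : ∀ t ∈ Icc 0 b,
    HasDerivWithinAt (fun t => F (t / b)) (F' (t / b) / b) (Icc 0 b) t := by
  intro t ht
  have h1 : HasDerivWithinAt (fun t : ℝ => t / b) (1 / b) (Icc 0 b) t := ((hasDerivAt_id t).div_const b).hasDerivWithinAt
  have := HasDerivWithinAt.scomp t (hF.1 _ (map_left hb ht)) h1 (map_left hb)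
  refine this.congr_deriv ?_
  rw [Complex.real_smul]; push_cast; ring

theorem join_deriv_zero (hb : b ∈ Ioo (0:ℝ) 1) (hF : Reg F F') : HasDerivWithinAt (join b F G) (F' 0 / b) (Icc 0 1) 0 := by
  have h := join_left_deriv hb hF 0 ⟨le_rfl, hb.1.le⟩
  rw [zero_div] at h
  have h2 : HasDerivWithinAt (join b F G) (F' 0 / b) (Icc 0 b) 0 :=
    h.congr (fun t ht => join_left hb ht.2) (join_left hb hb.1.le)
  refine h2.mono_of_mem_nhdsWithin ?_
  have : Icc (0:ℝ) 1 ∩ Iio b ⊆ Icc 0 b := fun t ht => ⟨ht.1.1, ht.2.le⟩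
  exact Filter.mem_of_superset (inter_mem_nhdsWithin _ (Iio_mem_nhds hb.1)) this

theorem join_reg (hb : b ∈ Ioo (0:ℝ) 1) (hF : Reg F F') (hG : Reg G G') (hFG : F 1 = G 1)
    (hFG' : F' 1 / b = - G' 1 / ((1 - b : ℝ) : ℂ)) : Reg (join b F G) (join' b F' G') := by
  have h1b : 0 < 1 - b := by linarith [hb.2]
  have e1 : b / b = 1 := div_self hb.1.ne'
  have e2 : (1 - b) / (1 - b) = 1 := div_self h1b.ne'
  refine ⟨?_, ?_, ?_⟩
  · refine pw_deriv hb (f' := fun t => F' (t / b) / b) (g := fun t => G ((1 - t) / (1 - b)))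
      (g' := fun t => - G' ((1 - t) / (1 - b)) / ((1 - b : ℝ) : ℂ)) (join_left_deriv hb hF) ?_ ?_ ?_
    · intro t ht
      have h1 : HasDerivWithinAt (fun t : ℝ => (1 - t) / (1 - b)) (-1 / (1 - b)) (Icc b 1) t :=
        (((hasDerivAt_id t).const_sub 1).div_const (1 - b)).hasDerivWithinAt
      have := HasDerivWithinAt.scomp t (hG.1 _ (map_right hb ht)) h1 (map_right hb)
      refine this.congr_deriv ?_
      rw [Complex.real_smul]; push_cast; ring
    · rw [e1, e2, hFG]
    · rw [e1, e2, hFG']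
  · refine pw_cont hb (f := fun t => F' (t / b) / b) (g := fun t => - G' ((1 - t) / (1 - b)) / ((1 - b : ℝ) : ℂ)) ?_ ?_ ?_
    · exact ContinuousOn.div_const (hF.2.1.comp (by fun_prop) (map_left hb)) _
    · exact ContinuousOn.div_const (ContinuousOn.neg (hG.2.1.comp (f := fun t => (1 - t) / (1 - b)) (by fun_prop) (map_right hb))) _
    · rw [e1, e2, hFG']
  · intro t ht
    unfold join'
    split_ifs with h
    · exact div_ne_zero (hF.2.2 _ (map_left hb ⟨ht.1, h⟩)) (by exact_mod_cast hb.1.ne')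
    · exact div_ne_zero (neg_ne_zero.2 (hG.2.2 _ (map_right hb ⟨(not_le.1 h).le, ht.2⟩))) (by exact_mod_cast h1b.ne')

theorem join'_zero (hb : b ∈ Ioo (0:ℝ) 1) : join' b F' G' 0 = F' 0 / b := by simp [join', hb.1.le]

theorem join'_one (hb : b ∈ Ioo (0:ℝ) 1) : join' b F' G' 1 = - G' 0 / ((1 - b : ℝ) : ℂ) := by simp [join', hb.2]

end

theorem IsArcOn.rev {γ : ℝ → ℂ} {s t : ℝ} (h : IsArcOn γ s t) : IsArcOn γ t s := by
  obtain ⟨P, hP, hu⟩ := h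
  have key : ∀ u ∈ Icc (0:ℝ) 1, γ (t + u * (s - t)) = P.toFun (1 - u) := by
    intro u hu'
    rw [← hu (1 - u) ⟨by linarith [hu'.2], by linarith [hu'.1]⟩]; congr 1; ring
  cases P with
  | arc c r a b =>
    refine ⟨Piece.arc c r b a, ⟨hP.1, hP.2.symm⟩, fun u hu' => ?_⟩
    rw [key u hu']; simp only [Piece.toFun]; congr 5; ring
  | seg p q =>
    refine ⟨Piece.seg q p, Ne.symm hP, fun u hu' => ?_⟩
    rw [key u hu']; simp only [Piece.toFun]; push_cast; ring

theorem IsArcOn.affine {γ F : ℝ → ℂ} {s t s0 t0 : ℝ} (h : IsArcOn F s0 t0)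
    (e : ∀ u ∈ Icc (0:ℝ) 1, γ (s + u * (t - s)) = F (s0 + u * (t0 - s0))) : IsArcOn γ s t := by
  obtain ⟨P, hP, hu⟩ := h
  exact ⟨P, hP, fun u hu' => (e u hu').trans (hu u hu')⟩

theorem mono_of_steps {f : ℕ → ℝ} {m : ℕ} (h : ∀ i < m, f i < f (i + 1)) : ∀ j ≤ m, ∀ i ≤ j, f i ≤ f j := by
  intro j
  induction j with
  | zero => intro _ i hi; obtain rfl : i = 0 := by omega
            exact le_rfl
  | succ j ih =>
    intro hj i hi
    rcases Nat.lt_or_ge i (j + 1) with h1 | h1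
    · exact (ih (by omega) i (by omega)).trans (h j (by omega)).le
    · obtain rfl : i = j + 1 := by omega
      exact le_rfl

theorem join_polyArc {b : ℝ} (hb : b ∈ Ioo (0:ℝ) 1) {F G : ℝ → ℂ} (hFG : F 1 = G 1) {k k' : ℕ}
    (hF : PolyArc k F) (hG : PolyArc k' G) : PolyArc (k + k') (join b F G) := by
  obtain ⟨m, m0, mk, f, f0, f1, fs, fa⟩ := hF
  obtain ⟨m', m0', mk', g, g0, g1, gs, ga⟩ := hG
  have h1b : 0 < 1 - b := by linarith [hb.2]
  have hb1 := hb.1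
  have fm := mono_of_steps fs
  have gm := mono_of_steps gs
  refine ⟨m + m', by omega, by omega, fun i => if i ≤ m then b * f i else 1 - (1 - b) * g (m + m' - i), by simp [f0], ?_, ?_, ?_⟩
  · simp [g0, m0'.ne']
  · intro i hi
    beta_reduce
    rcases Nat.lt_trichotomy i m with h | rfl | h
    · rw [if_pos h.le, if_pos (by omega)]
      exact mul_lt_mul_of_pos_left (fs i h) hb1
    · rw [if_pos le_rfl, if_neg (by omega), f1]
      have := gs (m' - 1) (by omega)
      rw [show m' - 1 + 1 = m' by omega, g1] at this
      rw [show i + m' - (i + 1) = m' - 1 by omega]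
      nlinarith
    · rw [if_neg (by omega), if_neg (by omega)]
      have := gs (m + m' - (i + 1)) (by omega)
      rw [show m + m' - (i + 1) + 1 = m + m' - i by omega] at this
      nlinarith
  · intro i hi
    beta_reduce
    rcases Nat.lt_or_ge i m with h | h
    · rw [if_pos h.le, if_pos (by omega)]
      refine (fa i h).affine fun u hu => ?_
      have hle : f i + u * (f (i + 1) - f i) ≤ 1 := by
        have h2 := fm m le_rfl (i + 1) (by omega)
        rw [f1] at h2
        have := fs i h
        nlinarith [hu.2]
      rw [show b * f i + u * (b * f (i + 1) - b * f i) = (f i + u * (f (i + 1) - f i)) * b by ring,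
        join_left hb (by nlinarith), mul_div_cancel_right₀ _ hb1.ne']
    · have e1 : (if i ≤ m then b * f i else 1 - (1 - b) * g (m + m' - i)) = 1 - (1 - b) * g (m + m' - i) := by
        split_ifs with h2
        · obtain rfl : i = m := by omega
          rw [show i + m' - i = m' by omega, f1, g1]; ring
        · rfl
      rw [e1, if_neg (by omega)]
      have hj : m + m' - (i + 1) < m' := by omega
      have ej : m + m' - i = m + m' - (i + 1) + 1 := by omega
      rw [ej]
      generalize m + m' - (i + 1) = j at *
      refine (ga j hj).rev.affine fun u hu => ?_
      have hle : g (j + 1) + u * (g j - g (j + 1)) ≤ 1 := by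
        have h2 := gm m' le_rfl (j + 1) (by omega)
        rw [g1] at h2
        have := gs j hj
        nlinarith [hu.1]
      rw [show 1 - (1 - b) * g (j + 1) + u * (1 - (1 - b) * g j - (1 - (1 - b) * g (j + 1))) =
        1 - (g (j + 1) + u * (g j - g (j + 1))) * (1 - b) by ring,
        join_right hb hFG (by nlinarith), sub_sub_cancel, mul_div_cancel_right₀ _ h1b.ne']

theorem PolyArc.mono {k k' : ℕ} (h : k ≤ k') {γ : ℝ → ℂ} (hp : PolyArc k γ) : PolyArc k' γ := by
  obtain ⟨m, m0, mk, r⟩ := hp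
  exact ⟨m, m0, mk.trans h, r⟩

theorem Reg.smooth {γ γ' : ℝ → ℂ} (h : Reg γ γ') : ContDiffOn ℝ 1 γ (Icc 0 1) ∧
    ∀ t ∈ Icc (0 : ℝ) 1, derivWithin γ (Icc 0 1) t ≠ 0 := by
  have hu : UniqueDiffOn ℝ (Icc (0:ℝ) 1) := uniqueDiffOn_Icc one_pos
  have e : ∀ t ∈ Icc (0:ℝ) 1, derivWithin γ (Icc 0 1) t = γ' t := fun t ht => (h.1 t ht).derivWithin (hu t ht)
  refine ⟨?_, fun t ht => by rw [e t ht]; exact h.2.2 t ht⟩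
  have := (contDiffOn_succ_iff_derivWithin (𝕜 := ℝ) (n := 0) (f := γ) hu).2
    ⟨fun t ht => (h.1 t ht).differentiableWithinAt, by simp, contDiffOn_zero.2 (h.2.1.congr e)⟩
  simpa using this

end

section
open Complex in
theorem balanced {ι : Type*} [Fintype ι] (hn : 3 ≤ Fintype.card ι) (ζ : ι → ℂ) (hinj : Function.Injective ζ)
    (h1 : ∀ i, ‖ζ i‖ = 1) : ∃ P : ℂ, ‖P‖ < 1 ∧ ∑ i, (1 - (starRingEnd ℂ) P * ζ i) / (ζ i - P) = 0 := by
  classical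
  set n := Fintype.card ι with hndef
  have : Nonempty ι := Fintype.card_pos_iff.1 (by omega)
  -- minimal distance
  obtain ⟨d, d0, hd⟩ : ∃ d : ℝ, 0 < d ∧ ∀ i j, i ≠ j → d ≤ ‖ζ i - ζ j‖ := by
    have hfin : (((Finset.univ : Finset (ι × ι)).filter fun p => p.1 ≠ p.2).image fun p => ‖ζ p.1 - ζ p.2‖).Nonempty := by
      obtain ⟨a, b, hab⟩ := Fintype.one_lt_card_iff.1 (show 1 < Fintype.card ι by omega)
      exact ⟨_, Finset.mem_image.2 ⟨(a, b), by simp [hab], rfl⟩⟩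
    refine ⟨Finset.min' _ hfin, ?_, fun i j hij => Finset.min'_le _ _ (Finset.mem_image.2 ⟨(i, j), Finset.mem_filter.2 ⟨Finset.mem_univ _, hij⟩, rfl⟩)⟩
    · rw [Finset.lt_min'_iff]
      intro y hy
      obtain ⟨p, hp, rfl⟩ := Finset.mem_image.1 hy
      exact norm_pos_iff.2 (sub_ne_zero.2 fun h => (Finset.mem_filter.1 hp).2 (hinj h))
  set L : ℂ → ℝ := fun P => n * Real.log (1 - normSq P) - ∑ i, Real.log (normSq (ζ i - P)) with hL
  have ns : ∀ z : ℂ, normSq z = ‖z‖ ^ 2 := Complex.normSq_eq_norm_sq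
  have lt1 : ∀ P : ℂ, ‖P‖ < 1 → 0 < 1 - normSq P := fun P hP => by rw [ns]; nlinarith [norm_nonneg P]
  have far : ∀ P : ℂ, ‖P‖ < 1 → ∀ i, (1 - normSq P) / 2 ≤ ‖ζ i - P‖ := by
    intro P hP i
    have := norm_sub_norm_le (ζ i) P
    rw [h1] at this
    rw [ns]
    nlinarith [norm_nonneg P]
  have ne : ∀ P : ℂ, ‖P‖ < 1 → ∀ i, ζ i - P ≠ 0 := fun P hP i => by
    have := far P hP i
    have := lt1 P hP
    exact norm_pos_iff.1 (by linarith)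
  set C : ℝ := 2 * Real.log 2 - (n - 1) * Real.log ((d / 2) ^ 2) with hC
  have bound : ∀ P : ℂ, ‖P‖ < 1 → L P ≤ Real.log (1 - normSq P) + C := by
    intro P hP
    have hs := lt1 P hP
    obtain ⟨i0, -, hi0⟩ := Finset.exists_min_image Finset.univ (fun i => ‖ζ i - P‖) Finset.univ_nonempty
    have others : ∀ i ∈ Finset.univ.erase i0, Real.log ((d / 2) ^ 2) ≤ Real.log (normSq (ζ i - P)) := by
      intro i hi
      have h2 := hd i i0 (Finset.ne_of_mem_erase hi)
      have h3 := hi0 i (Finset.mem_univ _)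
      have h4 : ‖ζ i - ζ i0‖ ≤ ‖ζ i - P‖ + ‖ζ i0 - P‖ := by
        rw [show ζ i - ζ i0 = (ζ i - P) - (ζ i0 - P) by ring]; exact norm_sub_le _ _
      apply Real.log_le_log (by positivity)
      rw [ns]
      apply pow_le_pow_left₀ (by positivity)
      linarith
    have sumo := Finset.sum_le_sum others
    rw [Finset.sum_const, Finset.card_erase_of_mem (Finset.mem_univ _), Finset.card_univ, ← hndef, nsmul_eq_mul,
      Nat.cast_sub (by omega)] at sumo
    have one : 2 * (Real.log (1 - normSq P) - Real.log 2) ≤ Real.log (normSq (ζ i0 - P)) := by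
      have e0 : 2 * (Real.log (1 - normSq P) - Real.log 2) = Real.log (((1 - normSq P) / 2) ^ 2) := by
        rw [Real.log_pow, Real.log_div hs.ne' two_ne_zero]; norm_num
      rw [e0]
      apply Real.log_le_log (by positivity)
      rw [ns (ζ i0 - P)]
      apply pow_le_pow_left₀ (by positivity)
      exact far P hP i0
    have tot := Finset.add_sum_erase Finset.univ (fun i => Real.log (normSq (ζ i - P))) (Finset.mem_univ i0)
    have neg : Real.log (1 - normSq P) ≤ 0 := Real.log_nonpos hs.le (by linarith [normSq_nonneg P])
    have hn' : (3:ℝ) ≤ n := by exact_mod_cast hn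
    simp only [hL]
    rw [← tot]
    push_cast at sumo
    nlinarith
  have L0 : L 0 = 0 := by
    simp [hL, ns, h1]
  have C0 : 0 ≤ C := by
    have := bound 0 (by simp)
    simpa [L0] using this
  set S : Set ℂ := {P | normSq P ≤ 1 - Real.exp (-C)} with hS
  have hSlt : ∀ P ∈ S, ‖P‖ < 1 := by
    intro P hP
    have h2 : normSq P ≤ 1 - Real.exp (-C) := hP
    have := Real.exp_pos (-C)
    rw [ns] at h2
    nlinarith [norm_nonneg P]
  have hcont : ContinuousOn L S := by
    intro P hP
    have hP1 := hSlt P hP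
    apply ContinuousAt.continuousWithinAt
    refine ContinuousAt.sub (continuousAt_const.mul (ContinuousAt.log ?_ (lt1 P hP1).ne')) ?_
    · exact (continuous_const.sub continuous_normSq).continuousAt
    · refine tendsto_finsetSum _ fun i _ => ?_
      exact ContinuousAt.log (continuous_normSq.comp (continuous_const.sub continuous_id)).continuousAt
        (normSq_pos.2 (ne P hP1 i)).ne'
  have hcomp : IsCompact S := by
    refine Metric.isCompact_of_isClosed_isBounded (isClosed_le continuous_normSq continuous_const) ?_
    refine Metric.isBounded_ball.subset (s := S) (t := Metric.ball 0 1) fun P hP => ?_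
    simpa using hSlt P hP
  have h0S : (0:ℂ) ∈ S := by
    have := Real.exp_le_one_iff.2 (neg_nonpos.2 C0)
    simp [hS]; linarith
  obtain ⟨P, hPS, hmax⟩ := hcomp.exists_isMaxOn ⟨0, h0S⟩ hcont
  have hP1 := hSlt P hPS
  have hmax' : ∀ Q : ℂ, ‖Q‖ < 1 → L Q ≤ L P := by
    intro Q hQ
    by_cases hQS : Q ∈ S
    · exact hmax hQS
    · have h2 : 1 - Real.exp (-C) < normSq Q := not_le.1 hQS
      have h3 : Real.log (1 - normSq Q) ≤ -C := by
        rw [Real.log_le_iff_le_exp (lt1 Q hQ)]; linarith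
      have h4 : L 0 ≤ L P := hmax h0S
      have := bound Q hQ
      linarith
  have key : ∀ v : ℂ, (v * (∑ i, 1 / (ζ i - P) - n * ((starRingEnd ℂ) P / (1 - normSq P : ℝ)))).re = 0 := by
    intro v
    have dns : ∀ a w : ℂ, HasDerivAt (fun t : ℝ => normSq (a + t * w)) (2 * ((starRingEnd ℂ) a * w).re) 0 := by
      intro a w
      have e : (fun t : ℝ => normSq (a + t * w)) = fun t : ℝ => normSq a + t * (2 * ((starRingEnd ℂ) a * w).re) + t ^ 2 * normSq w := by
        funext t
        simp [normSq_apply]; ring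
      rw [e]
      have := (((hasDerivAt_id (0:ℝ)).mul_const (2 * ((starRingEnd ℂ) a * w).re)).const_add (normSq a)).add
        (((hasDerivAt_id (0:ℝ)).pow 2).mul_const (normSq w))
      refine HasDerivAt.congr_deriv (f := fun t : ℝ => normSq a + t * (2 * ((starRingEnd ℂ) a * w).re) + t ^ 2 * normSq w) this ?_
      simp
    have d1 : HasDerivAt (fun t : ℝ => L (P + t * v))
        (n * (- (2 * ((starRingEnd ℂ) P * v).re) / (1 - normSq P)) -
          ∑ i, (2 * ((starRingEnd ℂ) (ζ i - P) * (-v)).re) / normSq (ζ i - P)) 0 := by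
      simp only [hL]
      refine HasDerivAt.sub (HasDerivAt.const_mul _ ?_) (HasDerivAt.fun_sum fun i _ => ?_)
      · have := ((dns P v).const_sub 1).log (by simpa using (lt1 P hP1).ne')
        simpa using this
      · have := (dns (ζ i - P) (-v)).log (by simpa using ne P hP1 i)
        simp only [ofReal_zero, zero_mul, add_zero] at this
        refine this.congr_of_eventuallyEq (Filter.Eventually.of_forall fun t => ?_)
        beta_reduce
        congr 2; ring
    have lm : IsLocalMax (fun t : ℝ => L (P + t * v)) 0 := by
      have hc : ContinuousAt (fun t : ℝ => ‖P + t * v‖) 0 := by fun_prop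
      have := hc.eventually (Iio_mem_nhds (show ‖P + (0:ℝ) * v‖ < 1 by simpa using hP1))
      filter_upwards [this] with t ht
      simpa using hmax' _ ht
    have z := lm.hasDerivAt_eq_zero d1
    have e1 : ∀ i, (v * (1 / (ζ i - P))).re = ((starRingEnd ℂ) (ζ i - P) * v).re / normSq (ζ i - P) := by
      intro i
      rw [one_div, inv_def, ← mul_assoc, mul_comm v]
      rw [re_mul_ofReal, div_eq_mul_inv]
    rw [mul_sub, sub_re, Finset.mul_sum, re_sum, Finset.sum_congr rfl fun i _ => e1 i]
    have e2 : (v * (n * ((starRingEnd ℂ) P / (1 - normSq P : ℝ)))).re = n * (((starRingEnd ℂ) P * v).re / (1 - normSq P)) := by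
      rw [show v * (n * ((starRingEnd ℂ) P / ((1 - normSq P : ℝ) : ℂ))) = ((n : ℝ) : ℂ) * (((starRingEnd ℂ) P * v) / ((1 - normSq P : ℝ) : ℂ)) by push_cast; ring,
        re_ofReal_mul, div_ofReal_re]
    rw [e2]
    have e3 : ∀ i, (2 * ((starRingEnd ℂ) (ζ i - P) * (-v)).re) / normSq (ζ i - P) =
        (-2) * (((starRingEnd ℂ) (ζ i - P) * v).re / normSq (ζ i - P)) := by
      intro i; rw [mul_neg, neg_re]; ring
    rw [Finset.sum_congr rfl fun i _ => e3 i, ← Finset.mul_sum] at z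
    have e4 : - (2 * ((starRingEnd ℂ) P * v).re) / (1 - normSq P) = (-2) * (((starRingEnd ℂ) P * v).re / (1 - normSq P)) := by ring
    rw [e4] at z
    linarith
  set W := ∑ i, 1 / (ζ i - P) - n * ((starRingEnd ℂ) P / (1 - normSq P : ℝ)) with hW
  have W0 : W = 0 := by
    have := key ((starRingEnd ℂ) W)
    rw [mul_comm, mul_conj, ofReal_re] at this
    exact normSq_eq_zero.1 this
  refine ⟨P, hP1, ?_⟩
  have hs : ((1 - normSq P : ℝ) : ℂ) ≠ 0 := by exact_mod_cast (lt1 P hP1).ne'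
  have each : ∀ i, (1 - (starRingEnd ℂ) P * ζ i) / (ζ i - P) = ((1 - normSq P : ℝ) : ℂ) * (1 / (ζ i - P)) - (starRingEnd ℂ) P := by
    intro i
    have := ne P hP1 i
    have hns : ((normSq P : ℝ) : ℂ) = (starRingEnd ℂ) P * P := by rw [mul_comm, mul_conj]
    push_cast
    rw [hns]
    field_simp
    ring
  rw [Finset.sum_congr rfl fun i _ => each i, Finset.sum_sub_distrib, ← Finset.mul_sum, Finset.sum_const, Finset.card_univ, ← hndef,
    nsmul_eq_mul]
  have : ((1 - normSq P : ℝ) : ℂ) * W = 0 := by rw [W0, mul_zero]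
  rw [hW, mul_sub] at this
  rw [← this]
  field_simp

end

section
theorem cluster {n : ℕ} (a : Fin n → ℝ) (μ : ℝ) (h0 : ∑ k, Real.cos (a k - μ) = 0) {m : ℕ} (hm : m < n)
    (s : Finset (Fin n)) (hs : s.card = m + 1) {x : ℝ} (hx0 : 0 ≤ x) (hx : x ≤ Real.pi * (m / n - 1 / 2))
    (h : ∀ k ∈ s, Real.cos x ≤ Real.cos (a k - μ)) : False := by
  have hn : (0:ℝ) < n := by exact_mod_cast (by omega : 0 < n)
  have hm' : (m:ℝ) + 1 ≤ n := by exact_mod_cast hm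
  have hpi := Real.pi_pos
  have hmn : (m:ℝ) / n < 1 := by rw [div_lt_one hn]; linarith
  have hx2 : x ≤ Real.pi / 2 := by nlinarith
  have hc : 2 - 2 * ((m:ℝ) / n) ≤ Real.cos x := by
    have h1 := Real.one_sub_mul_le_cos hx0 hx2
    have h2 : 2 / Real.pi * x ≤ 2 / Real.pi * (Real.pi * (m / n - 1 / 2)) := by gcongr
    have h3 : 2 / Real.pi * (Real.pi * ((m:ℝ) / n - 1 / 2)) = 2 * (m / n) - 1 := by field_simp
    linarith
  have hge : (1:ℝ)/2 ≤ m / n := by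
    by_contra hcon; push Not at hcon
    nlinarith
  have s1 : ((m:ℝ) + 1) * Real.cos x ≤ ∑ k ∈ s, Real.cos (a k - μ) := by
    have := Finset.card_nsmul_le_sum s _ _ h
    rw [hs, nsmul_eq_mul] at this
    exact_mod_cast this
  have s2 : -((n:ℝ) - (m + 1)) ≤ ∑ k ∈ sᶜ, Real.cos (a k - μ) := by
    have := Finset.card_nsmul_le_sum sᶜ (fun k => Real.cos (a k - μ)) (-1) (fun k _ => Real.neg_one_le_cos _)
    rw [Finset.card_compl, Fintype.card_fin, hs, nsmul_eq_mul, Nat.cast_sub hm] at this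
    push_cast at this
    linarith
  have tot := Finset.sum_add_sum_compl s (fun k => Real.cos (a k - μ))
  rw [h0] at tot
  have e : (m:ℝ) = (m / n) * n := by field_simp
  generalize (m:ℝ) / n = y at *
  rw [e] at s1 s2 hm'
  have : (y * n + 1) * (2 - 2 * y) ≤ (y * n + 1) * Real.cos x := by gcongr
  nlinarith

theorem cos_shift_sum {n : ℕ} (a : Fin n → ℝ) (h : ∑ k, Complex.exp (a k * Complex.I) = 0) (μ : ℝ) :
    ∑ k, Real.cos (a k - μ) = 0 := by
  have h1 : ∑ k, Complex.exp ((a k - μ : ℝ) * Complex.I) = 0 := by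
    have : ∀ k, Complex.exp ((a k - μ : ℝ) * Complex.I) = Complex.exp (a k * Complex.I) * Complex.exp (-(μ * Complex.I)) := by
      intro k; rw [← Complex.exp_add]; congr 1; push_cast; ring
    rw [Finset.sum_congr rfl fun k _ => this k, ← Finset.sum_mul, h, zero_mul]
  have h2 := congrArg Complex.re h1
  rw [Complex.re_sum] at h2
  simpa only [Complex.exp_ofReal_mul_I_re, Complex.zero_re] using h2

theorem cos_ge {x y : ℝ} (hx : x ≤ Real.pi) (h1 : -x ≤ y) (h2 : y ≤ x) : Real.cos x ≤ Real.cos y := by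
  rw [← Real.cos_abs y]
  exact Real.cos_le_cos_of_nonneg_of_le_pi (abs_nonneg y) hx (abs_le.2 ⟨h1, h2⟩)

theorem delta_lt {n : ℕ} (a : Fin n → ℝ) (ha : StrictMono a) (hr : ∀ k, a k ∈ Ico 0 (2 * Real.pi))
    (h : n ≤ 2 ∨ ∑ k, Complex.exp (a k * Complex.I) = 0) (l k : Fin n) (hlk : l < k) :
    |(a k - 2 * Real.pi * (k : ℕ) / n) - (a l - 2 * Real.pi * (l : ℕ) / n)| < Real.pi := by
  have hpi := Real.pi_pos
  have hn0 : 0 < n := l.pos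
  have hn : (0:ℝ) < n := by exact_mod_cast hn0
  have hD := ha hlk
  have hk := hr k
  have hl := hr l
  have hlk' : (l : ℕ) < k := hlk
  rcases h with h | h
  · have hk1 : (k : ℕ) = 1 := by have := k.2; omega
    have hl1 : (l : ℕ) = 0 := by omega
    have : n = 2 := by have := k.2; omega
    rw [hk1, hl1, this, abs_lt]
    push_cast
    constructor <;> linarith [hk.1, hk.2, hl.1, hl.2]
  have hn1 : ((k:ℕ):ℝ) - (l:ℕ) = ((k - l : ℕ) : ℝ) := by rw [Nat.cast_sub hlk'.le]
  have e : (a k - 2 * Real.pi * (k : ℕ) / n) - (a l - 2 * Real.pi * (l : ℕ) / n) = (a k - a l) - 2 * Real.pi * (((k - l : ℕ) : ℝ) / n) := by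
    rw [← hn1]; ring
  rw [e, abs_lt]
  by_contra hcon
  rw [not_and_or] at hcon
  rcases hcon with hcon | hcon
  · have hB : a k - a l ≤ 2 * Real.pi * (((k - l : ℕ) : ℝ) / n) - Real.pi := by linarith
    refine cluster a ((a l + a k) / 2) (cos_shift_sum a h _) (m := k - l) (by have := k.2; omega) (Finset.Icc l k)
      (by rw [Fin.card_Icc]; omega) (x := (a k - a l) / 2) (by linarith) (by linarith) ?_
    intro j hj
    rw [Finset.mem_Icc] at hj
    have h1 := ha.monotone hj.1
    have h2 := ha.monotone hj.2
    apply cos_ge <;> linarith [hk.1, hk.2, hl.1, hl.2]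
  · have hA : 2 * Real.pi * (((k - l : ℕ) : ℝ) / n) + Real.pi ≤ a k - a l := by linarith
    have hkn := k.2
    have hc : ((n - (k - l) : ℕ) : ℝ) / n = 1 - ((k - l : ℕ) : ℝ) / n := by
      rw [Nat.cast_sub (by omega)]; field_simp
    refine cluster a ((a l + a k) / 2 + Real.pi) (cos_shift_sum a h _) (m := n - (k - l)) (by omega) (Finset.Iic l ∪ Finset.Ici k)
      ?_ (x := Real.pi - (a k - a l) / 2) (by linarith [hk.2, hl.1]) (by rw [hc]; linarith) ?_
    · rw [Finset.card_union_of_disjoint, Fin.card_Iic, Fin.card_Ici]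
      · omega
      · rw [Finset.disjoint_left]
        intro j h1 h2
        rw [Finset.mem_Iic] at h1
        rw [Finset.mem_Ici] at h2
        exact absurd (h2.trans h1) (not_le.2 hlk)
    intro j hj
    have hj' := hr j
    rcases Finset.mem_union.1 hj with h1 | h1
    · rw [Finset.mem_Iic] at h1
      have h2 := ha.monotone h1
      rw [← Real.cos_add_two_pi (a j - _)]
      apply cos_ge <;> linarith [hk.1, hk.2, hl.1, hl.2, hj'.1]
    · rw [Finset.mem_Ici] at h1
      have h2 := ha.monotone h1
      apply cos_ge <;> linarith [hk.1, hk.2, hl.1, hl.2, hj'.2]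

theorem angles {ι : Type*} [Fintype ι] (φ : ι → ℝ) (hφ : Function.Injective φ) (hr : ∀ k, φ k ∈ Ico 0 (2 * Real.pi))
    (h : Fintype.card ι ≤ 2 ∨ ∑ i, Complex.exp (φ i * Complex.I) = 0) :
    ∃ (θ : ℝ) (e : ι ≃ Fin (Fintype.card ι)),
      (∀ i, |θ + 2 * Real.pi * (e i : ℕ) / (Fintype.card ι) - φ i| < Real.pi / 2) ∧ ∀ i j, e i < e j → φ i < φ j := by
  classical
  set n := Fintype.card ι with hn
  let e0 := Fintype.equivFin ι
  let e := e0.trans (Tuple.sort (φ ∘ e0.symm)).symm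
  have hmono : StrictMono (φ ∘ e.symm) := by
    have h1 : Monotone (φ ∘ e.symm) := Tuple.monotone_sort (φ ∘ e0.symm)
    exact h1.strictMono_of_injective (hφ.comp e.symm.injective)
  have hsum : n ≤ 2 ∨ ∑ k, Complex.exp ((φ ∘ e.symm) k * Complex.I) = 0 := by
    refine h.imp_right fun h => ?_
    rw [← h]
    exact Equiv.sum_comp e.symm (fun i => Complex.exp (φ i * Complex.I))
  have key := delta_lt (φ ∘ e.symm) hmono (fun k => hr _) hsum
  have hord : ∀ i j, e i < e j → φ i < φ j := fun i j hij => by simpa using hmono hij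
  rcases isEmpty_or_nonempty ι with hemp | hne
  · exact ⟨0, e, fun i => hemp.elim i, hord⟩
  let δ : ι → ℝ := fun i => φ i - 2 * Real.pi * (e i : ℕ) / n
  obtain ⟨i1, -, h1⟩ := Finset.exists_max_image Finset.univ δ Finset.univ_nonempty
  obtain ⟨i2, -, h2⟩ := Finset.exists_min_image Finset.univ δ Finset.univ_nonempty
  have hlt : δ i1 - δ i2 < Real.pi := by
    rcases lt_trichotomy (e i1) (e i2) with hlt | heq | hgt
    · have := key _ _ hlt
      simp only [Function.comp, Equiv.symm_apply_apply] at this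
      have := (abs_lt.1 this).1
      simp only [δ]; linarith
    · rw [e.injective heq]; simp [Real.pi_pos]
    · have := key _ _ hgt
      simp only [Function.comp, Equiv.symm_apply_apply] at this
      exact (abs_lt.1 this).2
  refine ⟨(δ i1 + δ i2) / 2, e, fun i => ?_, hord⟩
  have a1 := h1 i (Finset.mem_univ _)
  have a2 := h2 i (Finset.mem_univ _)
  have e3 : (δ i1 + δ i2) / 2 + 2 * Real.pi * (e i : ℕ) / n - φ i = (δ i1 + δ i2) / 2 - δ i := by simp only [δ]; ring
  rw [e3, abs_lt]
  constructor <;> linarith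

end

section
theorem refr_mono {κ : ℝ} (h0 : 0 ≤ κ) (h1 : κ ≤ 1) :
    MonotoneOn (fun δ => δ - Real.arcsin (κ * Real.sin δ)) (Ioo (-(Real.pi / 2)) (Real.pi / 2)) := by
  have hb : ∀ δ ∈ Ioo (-(Real.pi / 2)) (Real.pi / 2), -1 < κ * Real.sin δ ∧ κ * Real.sin δ < 1 := by
    intro δ hδ
    have hc := Real.cos_pos_of_mem_Ioo hδ
    have := Real.sin_sq_add_cos_sq δ
    have h3 : (κ * Real.sin δ) ^ 2 < 1 := by
      have : κ ^ 2 ≤ 1 := by nlinarith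
      have : Real.sin δ ^ 2 < 1 := by nlinarith
      nlinarith [sq_nonneg (Real.sin δ)]
    exact abs_lt.1 ((sq_lt_one_iff_abs_lt_one _).1 h3)
  have hd : ∀ δ ∈ Ioo (-(Real.pi / 2)) (Real.pi / 2), HasDerivAt (fun δ => δ - Real.arcsin (κ * Real.sin δ))
      (1 - 1 / √(1 - (κ * Real.sin δ) ^ 2) * (κ * Real.cos δ)) δ := by
    intro δ hδ
    obtain ⟨b1, b2⟩ := hb δ hδ
    have hc : HasDerivAt (fun δ => Real.arcsin (κ * Real.sin δ)) _ δ :=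
      HasDerivAt.comp δ (h₂ := Real.arcsin) (h := fun δ => κ * Real.sin δ)
        (Real.hasDerivAt_arcsin b1.ne' b2.ne) ((Real.hasDerivAt_sin δ).const_mul κ)
    exact (hasDerivAt_id δ).sub hc
  refine monotoneOn_of_deriv_nonneg (convex_Ioo _ _) (fun δ hδ => (hd δ hδ).continuousAt.continuousWithinAt) ?_ ?_
  · rw [interior_Ioo]; exact fun δ hδ => (hd δ hδ).differentiableAt.differentiableWithinAt
  · rw [interior_Ioo]
    intro δ hδ
    rw [(hd δ hδ).deriv, sub_nonneg, one_div, inv_mul_le_iff₀, mul_one]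
    · apply Real.le_sqrt_of_sq_le
      have := Real.sin_sq_add_cos_sq δ
      have e : (κ * Real.cos δ) ^ 2 = κ ^ 2 - (κ * Real.sin δ) ^ 2 := by linear_combination κ ^ 2 * this
      rw [e]
      nlinarith
    · obtain ⟨b1, b2⟩ := hb δ hδ
      apply Real.sqrt_pos.2
      nlinarith

theorem arcsin_mono' {κ : ℝ} (h0 : 0 ≤ κ) {x y : ℝ} (hx : -(Real.pi / 2) ≤ x) (hy : y ≤ Real.pi / 2) (hxy : x ≤ y) :
    Real.arcsin (κ * Real.sin x) ≤ Real.arcsin (κ * Real.sin y) := by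
  apply Real.monotone_arcsin
  have := Real.sin_le_sin_of_le_of_le_pi_div_two hx hy hxy
  gcongr

theorem psi_lt {κ : ℝ} (h0 : 0 ≤ κ) (h1 : κ ≤ 1) {φ₁ φ₂ θ₁ θ₂ : ℝ} (hφ : φ₁ < φ₂) (hθ : θ₁ < θ₂)
    (b1 : |θ₁ - φ₁| < Real.pi / 2) (b2 : |θ₂ - φ₂| < Real.pi / 2) :
    θ₁ - Real.arcsin (κ * Real.sin (θ₁ - φ₁)) < θ₂ - Real.arcsin (κ * Real.sin (θ₂ - φ₂)) := by
  rcases le_total (θ₁ - φ₁) (θ₂ - φ₂) with h | h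
  · have := refr_mono h0 h1 (abs_lt.1 b1) (abs_lt.1 b2) h
    beta_reduce at this
    linarith
  · have := arcsin_mono' h0 (abs_lt.1 b2).1.le (abs_lt.1 b1).2.le h
    linarith

theorem ray_polar {φ θ s : ℝ} (hs : 0 ≤ s) (b : |θ - φ| < Real.pi / 2) {ρ : ℝ} 
    (hρ : ρ = ‖Complex.exp (φ * Complex.I) + s * Complex.exp (θ * Complex.I)‖) : 1 ≤ ρ ∧
    Complex.exp (φ * Complex.I) + s * Complex.exp (θ * Complex.I) =
      ρ * Complex.exp ((θ - Real.arcsin (1 / ρ * Real.sin (θ - φ)) : ℝ) * Complex.I) := by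
  have hc := Real.cos_pos_of_mem_Ioo (abs_lt.1 b)
  have hsc := Real.sin_sq_add_cos_sq (θ - φ)
  have e : Complex.exp (φ * Complex.I) + s * Complex.exp (θ * Complex.I) =
      Complex.exp (θ * Complex.I) * ⟨s + Real.cos (θ - φ), - Real.sin (θ - φ)⟩ := by
    have e1 : Complex.exp (φ * Complex.I) = Complex.exp (θ * Complex.I) * Complex.exp ((-(θ - φ) : ℝ) * Complex.I) := by
      rw [← Complex.exp_add]; congr 1; push_cast; ring
    have e2 : (⟨s + Real.cos (θ - φ), - Real.sin (θ - φ)⟩ : ℂ) = s + Complex.exp ((-(θ - φ) : ℝ) * Complex.I) := by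
      apply Complex.ext
      · simp [Complex.exp_ofReal_mul_I_re, -Complex.ofReal_neg, -Complex.ofReal_sub, -neg_sub]
      · simp [Complex.exp_ofReal_mul_I_im, -Complex.ofReal_neg, -Complex.ofReal_sub, -neg_sub]
    rw [e2, e1]; ring
  set z : ℂ := ⟨s + Real.cos (θ - φ), - Real.sin (θ - φ)⟩ with hz
  have hρz : ρ = ‖z‖ := by rw [hρ, e, norm_mul, Complex.norm_exp_ofReal_mul_I, one_mul]
  have hzsq : ρ ^ 2 = (s + Real.cos (θ - φ)) ^ 2 + Real.sin (θ - φ) ^ 2 := by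
    rw [hρz, ← Complex.normSq_eq_norm_sq, Complex.normSq_apply]; simp [hz]; ring
  have hρ0 : 0 ≤ ρ := by rw [hρz]; exact norm_nonneg _
  have h1 : 1 ≤ ρ := by nlinarith [mul_nonneg hs hc.le]
  refine ⟨h1, ?_⟩
  have harg : Complex.arg z = - Real.arcsin (1 / ρ * Real.sin (θ - φ)) := by
    rw [Complex.arg_of_re_nonneg (by simp only [hz]; positivity), ← hρz, ← Real.arcsin_neg]
    congr 1; simp only [hz]; ring
  have e3 := Complex.norm_mul_exp_arg_mul_I z
  rw [← hρz, harg] at e3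
  rw [e, ← e3]
  rw [show ((θ - Real.arcsin (1 / ρ * Real.sin (θ - φ)) : ℝ) : ℂ) * Complex.I = θ * Complex.I + ((- Real.arcsin (1 / ρ * Real.sin (θ - φ)) : ℝ) : ℂ) * Complex.I by push_cast; ring,
    Complex.exp_add]
  ring

theorem rays_disjoint {φ₁ φ₂ θ₁ θ₂ : ℝ} (hφ : φ₁ < φ₂) (hφ' : φ₂ < φ₁ + 2 * Real.pi) (hθ : θ₁ < θ₂) (hθ' : θ₂ < θ₁ + 2 * Real.pi)
    (b1 : |θ₁ - φ₁| < Real.pi / 2) (b2 : |θ₂ - φ₂| < Real.pi / 2) {s t : ℝ} (hs : 0 ≤ s) (ht : 0 ≤ t) :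
    Complex.exp (φ₁ * Complex.I) + s * Complex.exp (θ₁ * Complex.I) ≠ Complex.exp (φ₂ * Complex.I) + t * Complex.exp (θ₂ * Complex.I) := by
  intro heq
  obtain ⟨r1, e1⟩ := ray_polar hs b1 rfl
  obtain ⟨-, e2⟩ := ray_polar ht b2 (ρ := ‖Complex.exp (φ₁ * Complex.I) + s * Complex.exp (θ₁ * Complex.I)‖) (by rw [heq])
  generalize ‖Complex.exp (φ₁ * Complex.I) + s * Complex.exp (θ₁ * Complex.I)‖ = ρ at *
  have k0 : 0 ≤ 1 / ρ := by positivity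
  have k1 : 1 / ρ ≤ 1 := by rw [div_le_one (by linarith)]; exact r1
  have l1 := psi_lt k0 k1 hφ hθ b1 b2
  have l2 := psi_lt k0 k1 hφ' hθ' b2 (by rw [add_sub_add_right_eq_sub]; exact b1)
  rw [add_sub_add_right_eq_sub, add_sub_right_comm] at l2
  rw [e1, e2] at heq
  have hρ : (ρ : ℂ) ≠ 0 := by exact_mod_cast (by linarith : ρ ≠ 0)
  have heq' := mul_left_cancel₀ hρ heq
  generalize θ₁ - Real.arcsin (1 / ρ * Real.sin (θ₁ - φ₁)) = x at *
  generalize θ₂ - Real.arcsin (1 / ρ * Real.sin (θ₂ - φ₂)) = y at *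
  rw [Complex.exp_eq_exp_iff_exists_int] at heq'
  obtain ⟨n, hn⟩ := heq'
  have h2 : x = y + n * (2 * Real.pi) := by
    have : (x : ℂ) * Complex.I = ((y + n * (2 * Real.pi) : ℝ) : ℂ) * Complex.I := by
      rw [hn]; push_cast; ring
    exact_mod_cast mul_right_cancel₀ Complex.I_ne_zero this
  have hpi := Real.pi_pos
  have n1 : (n:ℝ) < 0 := by by_contra hc; push Not at hc; nlinarith
  have n2 : (-1:ℝ) < n := by nlinarith
  have n1' : n < 0 := by exact_mod_cast n1
  have n2' : -1 < n := by exact_mod_cast n2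
  omega

end

section
theorem fin_pos_lb {α : Type*} [Finite α] (f : α → ℝ) (hf : ∀ a, 0 < f a) : ∃ ε > 0, ∀ a, ε ≤ f a := by
  rcases isEmpty_or_nonempty α with h | h
  · exact ⟨1, one_pos, fun a => h.elim a⟩
  · obtain ⟨a, ha⟩ := Finite.exists_min f
    exact ⟨f a, hf a, ha⟩

theorem ray_sep {a b D E : ℂ} (hD : ‖D‖ = 1) (hE : ‖E‖ = 1) (hDE : D ≠ E)
    (h : ∀ s t : ℝ, 0 ≤ s → 0 ≤ t → a + s * D ≠ b + t * E) :
    ∃ δ > 0, ∀ s t : ℝ, 0 ≤ s → 0 ≤ t → δ ≤ ‖(a + s * D) - (b + t * E)‖ := by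
  have nD : Complex.normSq D = 1 := by rw [Complex.normSq_eq_norm_sq, hD]; norm_num
  have nE : Complex.normSq E = 1 := by rw [Complex.normSq_eq_norm_sq, hE]; norm_num
  set g := D.re * E.re + D.im * E.im with hg
  have nDE : Complex.normSq (D - E) = 2 - 2 * g := by
    rw [Complex.normSq_apply] at nD nE ⊢
    simp only [Complex.sub_re, Complex.sub_im]
    linear_combination nD + nE
  have g1 : g < 1 := by
    have := Complex.normSq_pos.2 (sub_ne_zero.2 hDE)
    linarith
  have g2 : -1 ≤ g := by
    have := Complex.normSq_nonneg (D + E)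
    rw [Complex.normSq_apply] at nD nE this
    simp only [Complex.add_re, Complex.add_im] at this
    nlinarith
  set k := √((1 - g) / 2) with hk
  have k0 : 0 < k := Real.sqrt_pos.2 (by linarith)
  have ksq : k ^ 2 = (1 - g) / 2 := Real.sq_sqrt (by linarith)
  have coer : ∀ s t : ℝ, 0 ≤ s → 0 ≤ t → k * (s + t) ≤ ‖s * D - t * E‖ := by
    intro s t hs ht
    apply le_of_sq_le_sq _ (norm_nonneg _)
    rw [← Complex.normSq_eq_norm_sq, mul_pow, ksq]
    have : Complex.normSq (s * D - t * E) = s ^ 2 + t ^ 2 - 2 * s * t * g := by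
      rw [Complex.normSq_apply] at nD nE ⊢
      simp only [Complex.sub_re, Complex.sub_im, Complex.re_ofReal_mul, Complex.im_ofReal_mul]
      linear_combination s ^ 2 * nD + t ^ 2 * nE
    rw [this]
    nlinarith [mul_nonneg (show 0 ≤ 1 + g by linarith) (sq_nonneg (s - t))]
  set M := (‖a - b‖ + 1) / k with hM
  have M0 : 0 ≤ M := by positivity
  have hc : IsCompact (Icc (0:ℝ) M ×ˢ Icc (0:ℝ) M) := isCompact_Icc.prod isCompact_Icc
  obtain ⟨p, hp, hmin⟩ := hc.exists_isMinOn ⟨(0, 0), ⟨⟨le_rfl, M0⟩, ⟨le_rfl, M0⟩⟩⟩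
    (f := fun p : ℝ × ℝ => ‖(a + p.1 * D) - (b + p.2 * E)‖) (by fun_prop)
  refine ⟨min 1 ‖(a + p.1 * D) - (b + p.2 * E)‖, lt_min one_pos ?_, ?_⟩
  · exact norm_pos_iff.2 (sub_ne_zero.2 (h _ _ hp.1.1 hp.2.1))
  · intro s t hs ht
    by_cases hst : s ≤ M ∧ t ≤ M
    · exact (min_le_right _ _).trans (hmin (a := (s, t)) ⟨⟨hs, hst.1⟩, ⟨ht, hst.2⟩⟩)
    · refine (min_le_left _ _).trans ?_
      have h1 : M ≤ s + t := by
        by_contra hcon; push Not at hcon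
        exact hst ⟨by linarith, by linarith⟩
      have h2 := coer s t hs ht
      have h3 : k * M ≤ k * (s + t) := by gcongr
      have h4 : k * M = ‖a - b‖ + 1 := by rw [hM]; field_simp
      have h5 : ‖s * D - t * E‖ ≤ ‖(a + s * D) - (b + t * E)‖ + ‖a - b‖ := by
        rw [show s * D - t * E = ((a + s * D) - (b + t * E)) - (a - b) by ring]; exact norm_sub_le _ _
      linarith

theorem L1unit {ι : Type*} [Fintype ι] (ζ : ι → ℂ) (hinj : Function.Injective ζ) (h1 : ∀ i, ‖ζ i‖ = 1) :
    ∃ (P : ℂ) (u D : ι → ℂ) (θ : ℝ) (e : ι ≃ Fin (Fintype.card ι)), ‖P‖ < 1 ∧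
      (∀ i, u i = (1 - (starRingEnd ℂ) P * ζ i) / (ζ i - P)) ∧
      (∀ i, D i = Complex.exp ((θ + 2 * Real.pi * (e i : ℕ) / (Fintype.card ι) : ℝ) * Complex.I)) ∧
      (∀ i, 0 < (D i * (starRingEnd ℂ) (u i)).re) ∧
      (∀ i j, i ≠ j → D i ≠ D j ∧ ∀ s t : ℝ, 0 ≤ s → 0 ≤ t → u i + s * D i ≠ u j + t * D j) := by
  have hpi := Real.pi_pos
  obtain ⟨P, hP, hsum⟩ : ∃ P : ℂ, ‖P‖ < 1 ∧ (Fintype.card ι ≤ 2 ∨ ∑ i, (1 - (starRingEnd ℂ) P * ζ i) / (ζ i - P) = 0) := by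
    by_cases hn : Fintype.card ι ≤ 2
    · exact ⟨0, by simp, Or.inl hn⟩
    · obtain ⟨P, hP, h⟩ := balanced (by omega) ζ hinj h1
      exact ⟨P, hP, Or.inr h⟩
  set u : ι → ℂ := fun i => (1 - (starRingEnd ℂ) P * ζ i) / (ζ i - P) with hu
  have ne : ∀ i, ζ i - P ≠ 0 := fun i h => by
    rw [sub_eq_zero] at h; rw [← h, h1] at hP; exact lt_irrefl _ hP
  have zz : ∀ i, ζ i * (starRingEnd ℂ) (ζ i) = 1 := fun i => by
    rw [Complex.mul_conj, Complex.normSq_eq_norm_sq, h1]; norm_num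
  have hu2 : ∀ i, u i = ζ i * (starRingEnd ℂ) (ζ i - P) / (ζ i - P) := by
    intro i
    simp only [hu]; congr 1
    rw [map_sub]; linear_combination -(zz i)
  have hu1 : ∀ i, ‖u i‖ = 1 := by
    intro i
    rw [hu2, norm_div, norm_mul, h1, one_mul, RCLike.norm_conj, div_self (norm_ne_zero_iff.2 (ne i))]
  have uinj : Function.Injective u := by
    intro i j hij
    simp only [hu] at hij
    rw [div_eq_div_iff (ne i) (ne j)] at hij
    have h3 : (ζ i - ζ j) * (1 - (starRingEnd ℂ) P * P) = 0 := by linear_combination -hij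
    rcases mul_eq_zero.1 h3 with h | h
    · exact hinj (sub_eq_zero.1 h)
    · exfalso
      rw [mul_comm, Complex.mul_conj, sub_eq_zero] at h
      have h4 : 1 = Complex.normSq P := by exact_mod_cast h
      rw [Complex.normSq_eq_norm_sq] at h4
      nlinarith [norm_nonneg P]
  choose φ hφr hφ using fun i => exists_angle (u i)
  simp only [hu1, Complex.ofReal_one, one_mul] at hφ
  have φinj : Function.Injective φ := fun i j hij => uinj (by rw [hφ i, hφ j, hij])
  obtain ⟨θ, e, b, ord⟩ := angles φ φinj hφr (hsum.imp_right fun h => by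
    rw [← h]; exact Finset.sum_congr rfl fun i _ => (hφ i).symm)
  set Θ : ι → ℝ := fun i => θ + 2 * Real.pi * (e i : ℕ) / (Fintype.card ι) with hΘ
  have Θb : ∀ i j, e i < e j → Θ i < Θ j ∧ Θ j < Θ i + 2 * Real.pi := by
    intro i j hij
    have hn : (0:ℝ) < Fintype.card ι := by exact_mod_cast (e i).pos
    have h2 : ((e i : ℕ) : ℝ) < (e j : ℕ) := by exact_mod_cast hij
    have h3 : ((e j : ℕ) : ℝ) < Fintype.card ι := by exact_mod_cast (e j).2
    have h4 : (0:ℝ) ≤ ((e i : ℕ) : ℝ) := by positivity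
    constructor
    · simp only [hΘ]; gcongr
    · have : 2 * Real.pi * ((e j : ℕ) : ℝ) / Fintype.card ι < 2 * Real.pi := by
        rw [div_lt_iff₀ hn]; gcongr
      have h5 : 0 ≤ 2 * Real.pi * ((e i : ℕ) : ℝ) / Fintype.card ι := by positivity
      simp only [hΘ]; linarith
  have main : ∀ i j, e i < e j → Complex.exp (Θ i * Complex.I) ≠ Complex.exp (Θ j * Complex.I) ∧
      ∀ s t : ℝ, 0 ≤ s → 0 ≤ t → u i + s * Complex.exp (Θ i * Complex.I) ≠ u j + t * Complex.exp (Θ j * Complex.I) := by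
    intro i j hij
    obtain ⟨t1, t2⟩ := Θb i j hij
    constructor
    · have := rays_disjoint t1 t2 t1 t2 (by simp [hpi]) (by simp [hpi]) le_rfl le_rfl
      simpa using this
    · intro s t hs ht
      rw [hφ i, hφ j]
      exact rays_disjoint (ord i j hij) (by linarith [(hφr i).1, (hφr j).2]) t1 t2 (b i) (b j) hs ht
  refine ⟨P, u, fun i => Complex.exp (Θ i * Complex.I), θ, e, hP, fun i => rfl, fun i => rfl, fun i => ?_, fun i j hij => ?_⟩
  · beta_reduce
    rw [hφ i, ← Complex.exp_conj, ← Complex.exp_add]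
    rw [show (Θ i : ℂ) * Complex.I + (starRingEnd ℂ) (φ i * Complex.I) = ((Θ i - φ i : ℝ) : ℂ) * Complex.I by
      rw [map_mul, Complex.conj_I, Complex.conj_ofReal]; push_cast; ring]
    rw [Complex.exp_ofReal_mul_I_re]
    exact Real.cos_pos_of_mem_Ioo (abs_lt.1 (b i))
  · rcases lt_or_gt_of_ne (e.injective.ne hij) with h | h
    · exact main i j h
    · exact ⟨(main j i h).1.symm, fun s t hs ht => ((main j i h).2 t s ht hs).symm⟩

theorem L1 {ι : Type*} [Fintype ι] (c : ℂ) {r : ℝ} (hr : 0 < r) (m : ι → ℂ) (hinj : Function.Injective m) (hm : ∀ i, ‖m i - c‖ = r) :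
    ∃ (P : ℂ) (D : ι → ℂ) (θ : ℝ) (e : ι ≃ Fin (Fintype.card ι)) (ε : ℝ), ‖P - c‖ < r ∧ 0 < ε ∧
      (∀ i, D i = Complex.exp ((θ + 2 * Real.pi * (e i : ℕ) / (Fintype.card ι) : ℝ) * Complex.I)) ∧
      (∀ i, 0 < (D i * (starRingEnd ℂ) ((1 / (m i - P)) ^ 2 * (m i - c))).re) ∧
      (∀ i j, i ≠ j → ∀ s t : ℝ, 0 ≤ s → 0 ≤ t →
        2 * ε ≤ ‖(1 / (m i - P) + s * D i) - (1 / (m j - P) + t * D j)‖) := by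
  have hrc : (r : ℂ) ≠ 0 := by exact_mod_cast hr.ne'
  have h1 : ∀ i, ‖(m i - c) / r‖ = 1 := fun i => by
    rw [norm_div, hm, Complex.norm_real, Real.norm_of_nonneg hr.le, div_self hr.ne']
  obtain ⟨P, u, D, θ, e, hP, hu, hD, hpos, hray⟩ := L1unit (fun i => (m i - c) / r)
    (fun i j hij => hinj (by beta_reduce at hij; rw [div_left_inj' hrc] at hij; exact sub_left_inj.1 hij)) h1
  have hDn : ∀ i, ‖D i‖ = 1 := fun i => by rw [hD, Complex.norm_exp_ofReal_mul_I]
  set ζ : ι → ℂ := fun i => (m i - c) / r with hζ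
  have ne : ∀ i, ζ i - P ≠ 0 := fun i h => by
    rw [sub_eq_zero] at h
    have := h1 i
    rw [show (m i - c) / r = P from h] at this; linarith
  have q : ∀ i, 1 / (m i - (c + r * P)) = 1 / (r * (ζ i - P)) := fun i => by
    simp only [hζ]; congr 1; field_simp; ring
  have zz : ∀ i, ζ i * (starRingEnd ℂ) (ζ i) = 1 := fun i => by
    rw [Complex.mul_conj, Complex.normSq_eq_norm_sq, h1]; norm_num
  have hu' : ∀ i, u i = (1 - (starRingEnd ℂ) P * ζ i) / (ζ i - P) := hu
  set S : ℝ := 1 - Complex.normSq P with hS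
  have S0 : 0 < S := by rw [hS, Complex.normSq_eq_norm_sq]; nlinarith [norm_nonneg P]
  have hSc : (S : ℂ) ≠ 0 := by exact_mod_cast S0.ne'
  have qu : ∀ i, u i = r * S * (1 / (m i - (c + r * P))) - (starRingEnd ℂ) P := by
    intro i
    have := ne i
    have e1 : (S : ℂ) = 1 - P * (starRingEnd ℂ) P := by rw [Complex.mul_conj, hS]; push_cast; ring
    rw [hu' i, q, e1]; field_simp; ring
  have sep : ∀ p : {p : ι × ι // p.1 ≠ p.2}, ∃ δ > 0, ∀ s t : ℝ, 0 ≤ s → 0 ≤ t →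
      δ ≤ ‖(1 / (m p.1.1 - (c + r * P)) + s * D p.1.1) - (1 / (m p.1.2 - (c + r * P)) + t * D p.1.2)‖ := by
    rintro ⟨⟨i, j⟩, hij⟩
    obtain ⟨h2, h3⟩ := hray i j hij
    refine ray_sep (hDn i) (hDn j) h2 fun s t hs ht heq => ?_
    refine h3 (r * S * s) (r * S * t) (by positivity) (by positivity) ?_
    rw [qu, qu]; push_cast
    linear_combination (r * S : ℂ) * heq
  choose δ δ0 hδ using sep
  obtain ⟨ε, ε0, hε⟩ := fin_pos_lb δ δ0
  refine ⟨c + r * P, D, θ, e, ε / 2, ?_, by positivity, hD, fun i => ?_, fun i j hij s t hs ht => ?_⟩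
  · rw [add_sub_cancel_left, norm_mul, Complex.norm_real, Real.norm_of_nonneg hr.le]; nlinarith
  · have hu2 : u i = ζ i * (starRingEnd ℂ) (ζ i - P) / (ζ i - P) := by
      rw [hu' i]; congr 1
      rw [map_sub]; linear_combination -(zz i)
    have hN : Complex.normSq (ζ i - P) ≠ 0 := (Complex.normSq_pos.2 (ne i)).ne'
    have hNc : (Complex.normSq (ζ i - P) : ℂ) ≠ 0 := by exact_mod_cast hN
    have : (1 / (m i - (c + r * P))) ^ 2 * (m i - c) = ((1 / (r * Complex.normSq (ζ i - P)) : ℝ) : ℂ) * u i := by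
      have e1 : m i - c = r * ζ i := by simp only [hζ]; field_simp
      rw [q, e1, hu2]
      have := ne i
      have e2 := Complex.mul_conj (ζ i - P)
      push_cast
      rw [← e2]
      have hcn : (starRingEnd ℂ) (ζ i - P) ≠ 0 := (map_ne_zero _).2 this
      generalize (starRingEnd ℂ) (ζ i - P) = w at *
      field_simp
    rw [this, map_mul, Complex.conj_ofReal, mul_left_comm, Complex.re_ofReal_mul]
    refine mul_pos ?_ (hpos i)
    have := Complex.normSq_pos.2 (ne i)
    positivity
  · rw [mul_div_cancel₀ _ (two_ne_zero)]
    exact (hε ⟨(i, j), hij⟩).trans (hδ _ s t hs ht)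

end

section
theorem slit_of {Z : ℂ} (h0 : Z ≠ 0) (h : ∀ s : ℝ, 0 < s → 1 + s * Z ≠ 0) : Complex.arg Z ∈ Ioo (-Real.pi) Real.pi := by
  refine ⟨Complex.neg_pi_lt_arg Z, lt_of_le_of_ne (Complex.arg_le_pi Z) fun hpi => ?_⟩
  obtain ⟨h1, h2⟩ := Complex.arg_eq_pi_iff.1 hpi
  refine h (-1 / Z.re) (div_pos_of_neg_of_neg (by norm_num) h1) ?_
  have : Z = (Z.re : ℂ) := Complex.ext (by simp) (by simp [h2])
  have hre : (Z.re : ℂ) ≠ 0 := by exact_mod_cast h1.ne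
  rw [this]
  push_cast
  simp only [Complex.ofReal_re]
  field_simp
  ring

theorem arcZ {A B Z : ℂ} (h0 : Z ≠ 0) (hZ : Complex.arg Z ∈ Ioo (-Real.pi) Real.pi) :
    (∀ t ∈ Ioc (0:ℝ) 1, ∃ s : ℝ, 0 ≤ s ∧ (t < 1 → 0 < s) ∧ arcE (Complex.arg Z) t ≠ 0 ∧
      B - arcC A B (Complex.arg Z) t = s * Z * (arcC A B (Complex.arg Z) t - A)) ∧
    (∃ σ : ℝ, 0 < σ ∧ arcC' A B (Complex.arg Z) 0 = σ * ((B - A) / Z)) ∧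
    (∃ σ : ℝ, 0 < σ ∧ arcC' A B (Complex.arg Z) 1 = σ * ((B - A) * Z)) := by
  have hn : 0 < ‖Z‖ := norm_pos_iff.2 h0
  have hnc : (‖Z‖ : ℂ) ≠ 0 := by exact_mod_cast hn.ne'
  have e : Complex.exp (Complex.arg Z * Complex.I) = Z / ‖Z‖ := by
    rw [eq_div_iff hnc, mul_comm, Complex.norm_mul_exp_arg_mul_I]
  obtain ⟨σ, σ0, e0, e1⟩ := arcE'_ends hZ
  refine ⟨fun t ht => ?_, ⟨σ * ‖Z‖, by positivity, ?_⟩, ⟨σ / ‖Z‖, by positivity, ?_⟩⟩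
  · rcases ht.2.eq_or_lt with rfl | h1
    · exact ⟨0, le_rfl, fun h => absurd h (lt_irrefl _), by rw [arcE_one hZ]; exact one_ne_zero, by rw [arcC_one _ _ hZ]; simp⟩
    · obtain ⟨s, s0, hE, hs⟩ := arcE_ratio hZ ⟨ht.1, h1⟩
      refine ⟨s / ‖Z‖, by positivity, fun _ => by positivity, hE, ?_⟩
      rw [e] at hs
      unfold arcC
      push_cast
      linear_combination (B - A) * hs
  · rw [arcC', e0, Complex.exp_neg, e]; push_cast; field_simp
  · rw [arcC', e1, e]; push_cast; field_simp

theorem OUT {P m c z : ℂ} {r : ℝ} (hP : ‖P - c‖ < r) (hm : ‖m - c‖ = r)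
    (hz : 0 < (z * (starRingEnd ℂ) ((1 / (m - P)) ^ 2 * (m - c))).re) :
    1 / (m - P) + z ≠ 0 ∧ ‖P + 1 / (1 / (m - P) + z) - c‖ < r := by
  have hr : 0 < r := (norm_nonneg _).trans_lt hP
  have hmP : m - P ≠ 0 := fun h => by rw [← sub_eq_zero.1 h, hm] at hP; exact lt_irrefl _ hP
  set q := 1 / (m - P) with hq
  have hf : ∀ w : ℂ, 0 < Complex.normSq w * (r ^ 2 - Complex.normSq (P - c)) - 2 * ((P - c) * w).re - 1 →
      w ≠ 0 ∧ ‖P + 1 / w - c‖ < r := by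
    intro w hw
    have hw0 : w ≠ 0 := by rintro rfl; simp at hw; linarith
    refine ⟨hw0, ?_⟩
    have e1 : ‖P + 1 / w - c‖ * ‖w‖ = ‖(P - c) * w + 1‖ := by
      rw [← norm_mul]; congr 1; field_simp; ring
    have e2 : Complex.normSq ((P - c) * w + 1) = Complex.normSq (P - c) * Complex.normSq w + 2 * ((P - c) * w).re + 1 := by
      rw [Complex.normSq_add]; simp
      ring
    have hwn : 0 < ‖w‖ := norm_pos_iff.2 hw0
    have e3 : ‖(P - c) * w + 1‖ < r * ‖w‖ := by
      apply lt_of_pow_lt_pow_left₀ 2 (by positivity)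
      rw [← Complex.normSq_eq_norm_sq, e2, mul_pow, ← Complex.normSq_eq_norm_sq w]
      linarith
    rw [← e1] at e3
    exact lt_of_mul_lt_mul_right e3 hwn.le
  apply hf
  set p := P - c with hp
  set a := m - c with ha
  have hap : m - P = a - p := by rw [ha, hp]; ring
  have haa : a * (starRingEnd ℂ) a = ((r ^ 2 : ℝ) : ℂ) := by rw [Complex.mul_conj, Complex.normSq_eq_norm_sq, hm]
  have hpp : p * (starRingEnd ℂ) p = (Complex.normSq p : ℂ) := Complex.mul_conj p
  set R : ℝ := r ^ 2 - Complex.normSq p with hR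
  have R0 : 0 < R := by rw [hR, Complex.normSq_eq_norm_sq]; nlinarith [norm_nonneg p]
  have hcn : (starRingEnd ℂ) (a - p) ≠ 0 := (map_ne_zero _).2 (hap ▸ hmP)
  have hap0 : a - p ≠ 0 := hap ▸ hmP
  have coef : (starRingEnd ℂ) q * R - p = (Complex.normSq (a - p) : ℂ) * (starRingEnd ℂ) (q ^ 2 * a) := by
    rw [← Complex.mul_conj, hq, hap, map_mul, map_pow, map_div₀, map_one, hR]
    push_cast
    rw [← hpp]
    push_cast at haa
    rw [← haa]
    have e5 : (starRingEnd ℂ) (a - p) = (starRingEnd ℂ) a - (starRingEnd ℂ) p := map_sub _ _ _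
    field_simp
    rw [e5]; ring
  have fq : Complex.normSq q * R - 2 * (p * q).re - 1 = 0 := by
    have e1 : q * ((starRingEnd ℂ) q * R - p) - (starRingEnd ℂ) (p * q) = 1 := by
      rw [coef, ← Complex.mul_conj, hq, hap, map_mul, map_mul, map_pow, map_div₀, map_one]
      have e5 : (starRingEnd ℂ) (a - p) = (starRingEnd ℂ) a - (starRingEnd ℂ) p := map_sub _ _ _
      field_simp
      rw [e5]
    have e2 : q * ((starRingEnd ℂ) q * R - p) - (starRingEnd ℂ) (p * q) = ((Complex.normSq q * R : ℝ) : ℂ) - (p * q + (starRingEnd ℂ) (p * q)) := by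
      have := Complex.mul_conj q
      push_cast; linear_combination (R : ℂ) * this
    rw [e2] at e1
    have := congrArg Complex.re e1
    rw [Complex.sub_re, Complex.ofReal_re, Complex.one_re, Complex.add_re, Complex.conj_re] at this
    linarith
  have exp1 : Complex.normSq (q + z) * R - 2 * (p * (q + z)).re - 1 =
      (Complex.normSq q * R - 2 * (p * q).re - 1) + 2 * (z * ((starRingEnd ℂ) q * R - p)).re + Complex.normSq z * R := by
    simp only [Complex.normSq_apply, Complex.mul_re, Complex.add_re, Complex.add_im, Complex.sub_re, Complex.sub_im,
      Complex.mul_im, Complex.conj_re, Complex.conj_im, Complex.ofReal_re, Complex.ofReal_im]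
    ring
  rw [exp1, fq, coef, mul_left_comm, Complex.re_ofReal_mul]
  have := Complex.normSq_pos.2 hap0
  have := Complex.normSq_nonneg z
  have : 0 < Complex.normSq (a - p) * (z * (starRingEnd ℂ) (q ^ 2 * a)).re := by positivity
  nlinarith [mul_nonneg (Complex.normSq_nonneg z) R0.le]

structure Half (P m c D : ℂ) (r ε : ℝ) (k : ℕ) (h h' : ℝ → ℂ) : Prop where
  reg : Reg h h'
  inj : InjOn h (Icc 0 1)
  h0 : h 0 = P
  h1 : h 1 = m
  poly : PolyArc k h
  d0 : ∃ l : ℝ, 0 < l ∧ h' 0 = l * (starRingEnd ℂ) D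
  ball : ∀ t ∈ Ico (0:ℝ) 1, ‖h t - c‖ < r
  near : ∀ t ∈ Ioc (0:ℝ) 1, h t ≠ P ∧ ∃ s : ℝ, 0 ≤ s ∧ ‖1 / (h t - P) - (1 / (m - P) + s * D)‖ < ε

theorem inv_of_ratio {A B x Z : ℂ} {s : ℝ} (hxA : x - A ≠ 0) (hAB : B - A ≠ 0) (h : B - x = s * Z * (x - A)) :
    1 / (x - A) = 1 / (B - A) * (1 + s * Z) := by
  field_simp
  linear_combination h

theorem halfA {P m c D : ℂ} {r ε : ℝ} (hP : ‖P - c‖ < r) (hm : ‖m - c‖ = r) (hD : ‖D‖ = 1) (hε : 0 < ε)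
    (hpos : 0 < (D * (starRingEnd ℂ) ((1 / (m - P)) ^ 2 * (m - c))).re) :
    ∃ h h' : ℝ → ℂ, Half P m c D r ε 1 h h' ∧ 0 < (h' 1 * (starRingEnd ℂ) (m - c)).re := by
  have hmP : m - P ≠ 0 := fun h => by rw [← sub_eq_zero.1 h, hm] at hP; exact lt_irrefl _ hP
  have hPm : P ≠ m := fun h => hmP (by rw [h, sub_self])
  have hD0 : D ≠ 0 := norm_ne_zero_iff.1 (by rw [hD]; exact one_ne_zero)
  have out : ∀ s : ℝ, 0 < s → 1 / (m - P) + s * D ≠ 0 ∧ ‖P + 1 / (1 / (m - P) + s * D) - c‖ < r := fun s hs =>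
    OUT hP hm (by rw [mul_assoc, Complex.re_ofReal_mul]; positivity)
  set Z := D * (m - P) with hZ
  have hZ0 : Z ≠ 0 := mul_ne_zero hD0 hmP
  have harg := slit_of hZ0 fun s hs h => (out s hs).1 (by
    have : 1 / (m - P) + s * D = (1 + s * Z) * (1 / (m - P)) := by rw [hZ]; field_simp
    rw [this, h, zero_mul])
  obtain ⟨hr, ⟨σ0, s0, d0⟩, ⟨σ1, s1, d1⟩⟩ := arcZ (A := P) (B := m) hZ0 harg
  have hxP : ∀ t, arcE (Complex.arg Z) t ≠ 0 → arcC P m (Complex.arg Z) t - P ≠ 0 := fun t ht => by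
    unfold arcC; rw [add_sub_cancel_left]; exact mul_ne_zero hmP ht
  have cD : (starRingEnd ℂ) D = 1 / D := by
    rw [eq_div_iff hD0, mul_comm, Complex.mul_conj, Complex.normSq_eq_norm_sq, hD]; norm_num
  refine ⟨arcC P m (Complex.arg Z), arcC' P m (Complex.arg Z),
    ⟨arcC_reg hPm harg, arcC_inj hPm harg, arcC_zero _ _ _, arcC_one _ _ harg, arcC_polyArc hPm harg, ?_, ?_, ?_⟩, ?_⟩
  · refine ⟨σ0, s0, ?_⟩
    rw [d0, cD, hZ]; field_simp
  · intro t ht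
    rcases ht.1.eq_or_lt with rfl | h
    · rw [arcC_zero]; exact hP
    · obtain ⟨s, -, hs, hE, e⟩ := hr t ⟨h, ht.2.le⟩
      have hx := hxP t hE
      have e2 := inv_of_ratio hx hmP e
      have e3 : 1 / (m - P) * (1 + s * Z) = 1 / (m - P) + s * D := by rw [hZ]; field_simp
      have := (out s (hs ht.2)).2
      rw [← e3, ← e2, one_div_one_div] at this
      rwa [add_sub_cancel] at this
  · intro t ht
    obtain ⟨s, hs0, hs, hE, e⟩ := hr t ht
    have hx := hxP t hE
    have e2 := inv_of_ratio hx hmP e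
    have e3 : 1 / (m - P) * (1 + s * Z) = 1 / (m - P) + s * D := by rw [hZ]; field_simp
    exact ⟨fun h => hx (by rw [h, sub_self]), s, hs0, by rw [e2, e3, sub_self, norm_zero]; exact hε⟩
  · have hcn : (starRingEnd ℂ) (m - P) ≠ 0 := (map_ne_zero _).2 hmP
    have : arcC' P m (Complex.arg Z) 1 * (starRingEnd ℂ) (m - c) =
        ((σ1 * Complex.normSq (m - P) ^ 2 : ℝ) : ℂ) * (D * (starRingEnd ℂ) ((1 / (m - P)) ^ 2 * (m - c))) := by
      rw [d1, map_mul, map_pow, map_div₀, map_one, hZ]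
      push_cast
      rw [← Complex.mul_conj]
      field_simp
    rw [this, Complex.re_ofReal_mul]
    have := Complex.normSq_pos.2 hmP
    positivity

end

section
theorem re_inv_pos {z N : ℂ} : 0 < (N * z⁻¹).re ↔ 0 < (z * (starRingEnd ℂ) N).re := by
  by_cases hz : z = 0
  · simp [hz]
  have : (N * z⁻¹).re = (z * (starRingEnd ℂ) N).re / Complex.normSq z := by
    rw [Complex.inv_def, ← mul_assoc, Complex.re_mul_ofReal, div_eq_mul_inv]
    congr 1
    simp [Complex.mul_re]; ring
  rw [this]
  have := Complex.normSq_pos.2 hz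
  constructor
  · intro h; by_contra hc; push Not at hc
    exact absurd h (not_lt.2 (div_nonpos_of_nonpos_of_nonneg hc this.le))
  · intro h; positivity

theorem halfB {P m c D T : ℂ} {r ε : ℝ} (hP : ‖P - c‖ < r) (hm : ‖m - c‖ = r) (hD : ‖D‖ = 1) (hε : 0 < ε)
    (hpos : 0 < (D * (starRingEnd ℂ) ((1 / (m - P)) ^ 2 * (m - c))).re) (hT : (T * (starRingEnd ℂ) (m - c)).re < 0) :
    ∃ h h' : ℝ → ℂ, Half P m c D r ε 2 h h' ∧ ∃ μ : ℝ, 0 < μ ∧ h' 1 = - (μ * T) := by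
  have hmP : m - P ≠ 0 := fun h => by rw [← sub_eq_zero.1 h, hm] at hP; exact lt_irrefl _ hP
  have hD0 : D ≠ 0 := norm_ne_zero_iff.1 (by rw [hD]; exact one_ne_zero)
  have hT0 : T ≠ 0 := by rintro rfl; simp at hT
  have cD : (starRingEnd ℂ) D = 1 / D := by
    rw [eq_div_iff hD0, mul_comm, Complex.mul_conj, Complex.normSq_eq_norm_sq, hD]; norm_num
  set q := 1 / (m - P) with hq
  have hq0 : q ≠ 0 := one_div_ne_zero hmP
  have hmq : m - P = 1 / q := by rw [hq, one_div_one_div]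
  set N := q ^ 2 * (m - c) with hN
  set T' := -(q ^ 2 * T) with hT'
  have hT'0 : T' ≠ 0 := neg_ne_zero.2 (mul_ne_zero (pow_ne_zero _ hq0) hT0)
  have posT' : 0 < (T' * (starRingEnd ℂ) N).re := by
    have : T' * (starRingEnd ℂ) N = ((-(Complex.normSq (q ^ 2)) : ℝ) : ℂ) * (T * (starRingEnd ℂ) (m - c)) := by
      rw [hT', hN, map_mul]; push_cast; rw [← Complex.mul_conj]; ring
    rw [this, Complex.re_ofReal_mul]
    have := Complex.normSq_pos.2 (pow_ne_zero 2 hq0)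
    nlinarith
  set k := ‖T'‖ with hk
  have k0 : 0 < k := norm_pos_iff.2 hT'0
  have kc : (k : ℂ) ≠ 0 := by exact_mod_cast k0.ne'
  set τ := T' / k with hτ
  have hTτ : T' = k * τ := by rw [hτ]; field_simp
  have τn : ‖τ‖ = 1 := by rw [hτ, norm_div, Complex.norm_real, Real.norm_of_nonneg k0.le, ← hk, div_self k0.ne']
  have τ0 : τ ≠ 0 := norm_ne_zero_iff.1 (by rw [τn]; exact one_ne_zero)
  have posτ : 0 < (τ * (starRingEnd ℂ) N).re := by
    rw [hTτ, mul_assoc, Complex.re_ofReal_mul] at posT'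
    exact pos_of_mul_pos_right posT' k0.le
  set w := D + τ with hw
  have posw : 0 < (w * (starRingEnd ℂ) N).re := by rw [hw, add_mul, Complex.add_re]; linarith
  have w0 : w ≠ 0 := by intro h; rw [h] at posw; simp at posw
  have wsq : w * w = Complex.normSq w * (D * τ) := by
    have h1 : D * (starRingEnd ℂ) D = 1 := by rw [Complex.mul_conj, Complex.normSq_eq_norm_sq, hD]; norm_num
    have h2 : τ * (starRingEnd ℂ) τ = 1 := by rw [Complex.mul_conj, Complex.normSq_eq_norm_sq, τn]; norm_num
    rw [← Complex.mul_conj, hw, map_add]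
    linear_combination -(D * τ + τ ^ 2) * h1 - (D * τ + D ^ 2) * h2
  have Dw : 0 < (D * w⁻¹).re := by
    rw [re_inv_pos, hw]
    have e1 : ((D + τ) * (starRingEnd ℂ) D).re = 1 + (τ * (starRingEnd ℂ) D).re := by
      rw [add_mul, Complex.mul_conj, Complex.add_re, Complex.ofReal_re, Complex.normSq_eq_norm_sq, hD]; norm_num
    have e2 : Complex.normSq w = 2 + 2 * (τ * (starRingEnd ℂ) D).re := by
      rw [hw, Complex.normSq_add, Complex.normSq_eq_norm_sq, Complex.normSq_eq_norm_sq, hD, τn]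
      simp [Complex.mul_re]; ring
    have := Complex.normSq_pos.2 w0
    rw [e1]; linarith
  have Nw : 0 < (N * w⁻¹).re := re_inv_pos.2 posw
  -- choose a small parameter
  obtain ⟨l, l0, hl1, hl2⟩ : ∃ l : ℝ, 0 < l ∧ l * ‖w‖ < ε ∧ l * ‖N‖ < ε * (N * w⁻¹).re := by
    have a1 : 0 < ‖w‖ + 1 := by positivity
    have a2 : 0 < ‖N‖ + 1 := by positivity
    refine ⟨min (ε / (‖w‖ + 1)) (ε * (N * w⁻¹).re / (‖N‖ + 1)), by positivity, ?_, ?_⟩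
    · have h1 := min_le_left (ε / (‖w‖ + 1)) (ε * (N * w⁻¹).re / (‖N‖ + 1))
      calc _ ≤ ε / (‖w‖ + 1) * ‖w‖ := by gcongr
        _ < ε / (‖w‖ + 1) * (‖w‖ + 1) := by gcongr; linarith
        _ = ε := by field_simp
    · have h1 := min_le_right (ε / (‖w‖ + 1)) (ε * (N * w⁻¹).re / (‖N‖ + 1))
      calc _ ≤ ε * (N * w⁻¹).re / (‖N‖ + 1) * ‖N‖ := by gcongr
        _ < ε * (N * w⁻¹).re / (‖N‖ + 1) * (‖N‖ + 1) := by gcongr; linarith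
        _ = ε * (N * w⁻¹).re := by field_simp
  have lc : (l : ℂ) ≠ 0 := by exact_mod_cast l0.ne'
  set v := (l : ℂ) * w with hv
  have v0 : v ≠ 0 := mul_ne_zero lc w0
  have posv : 0 < (v * (starRingEnd ℂ) N).re := by rw [hv, mul_assoc, Complex.re_ofReal_mul]; positivity
  set X := q + v with hX
  have outX : ∀ s : ℝ, 0 ≤ s → X + s * D ≠ 0 ∧ ‖P + 1 / (X + s * D) - c‖ < r := fun s hs => by
    have := OUT (z := v + s * D) hP hm (by
      rw [add_mul, Complex.add_re, mul_assoc (s : ℂ), Complex.re_ofReal_mul]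
      have := mul_nonneg hs hpos.le
      linarith)
    rw [← hq, ← add_assoc, ← hX] at this
    exact this
  have X0 : X ≠ 0 := by have := (outX 0 le_rfl).1; simpa using this
  set x := P + 1 / X with hx
  have hxP : x - P = 1 / X := by rw [hx, add_sub_cancel_left]
  have hPx : P ≠ x := fun h => one_div_ne_zero X0 (by rw [← hxP, ← h, sub_self])
  have hxm : x - m = 1 / X - 1 / q := by rw [← hxP, ← hmq]; ring
  have hxm' : x - m = -v / (q * X) := by
    have hvX : v = X - q := by rw [hX]; ring
    rw [hxm, hvX]; field_simp; ring
  have hxm0 : x - m ≠ 0 := by rw [hxm']; exact div_ne_zero (neg_ne_zero.2 v0) (mul_ne_zero hq0 X0)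
  have hmx : m ≠ x := fun h => hxm0 (by rw [h, sub_self])
  -- arc 3
  set Z3 := D / X with hZ3
  have Z30 : Z3 ≠ 0 := div_ne_zero hD0 X0
  have arg3 := slit_of Z30 fun s hs h => (outX s hs.le).1 (by
    have : X + s * D = (1 + s * Z3) * X := by rw [hZ3]; field_simp
    rw [this, h, zero_mul])
  obtain ⟨r3, ⟨σ3, s3, d30⟩, ⟨σ3', s3', d31⟩⟩ := arcZ (A := P) (B := x) Z30 arg3
  -- the `w`-plane description of arc 2
  have outV : ∀ s : ℝ, 0 ≤ s → v⁻¹ + s * T'⁻¹ ≠ 0 ∧ ‖(v⁻¹ + s * T'⁻¹)⁻¹‖ < ε ∧ q + (v⁻¹ + s * T'⁻¹)⁻¹ ≠ 0 ∧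
      ‖P + 1 / (q + (v⁻¹ + s * T'⁻¹)⁻¹) - c‖ < r := by
    intro s hs
    have h1 : (N * v⁻¹).re = (N * w⁻¹).re / l := by
      rw [hv, mul_inv, mul_left_comm, ← Complex.ofReal_inv, Complex.re_ofReal_mul, div_eq_mul_inv, mul_comm]
    have h2 : 0 ≤ s * (N * T'⁻¹).re := mul_nonneg hs (re_inv_pos.2 posT').le
    have h3 : (N * (v⁻¹ + s * T'⁻¹)).re = (N * w⁻¹).re / l + s * (N * T'⁻¹).re := by
      rw [mul_add, Complex.add_re, h1, mul_left_comm, Complex.re_ofReal_mul]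
    have h4 : 0 < (N * w⁻¹).re / l := by positivity
    have ne : v⁻¹ + s * T'⁻¹ ≠ 0 := by intro h; rw [h, mul_zero, Complex.zero_re] at h3; linarith
    have h5 := OUT (z := (v⁻¹ + s * T'⁻¹)⁻¹) hP hm (re_inv_pos.1 (by rw [inv_inv]; rw [← hq, ← hN, h3]; linarith))
    rw [← hq] at h5
    refine ⟨ne, ?_, h5⟩
    have h6 : (N * w⁻¹).re / l ≤ ‖N‖ * ‖v⁻¹ + s * T'⁻¹‖ := by
      rw [← norm_mul]; refine le_trans ?_ (Complex.re_le_norm _); rw [h3]; linarith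
    rw [norm_inv, inv_lt_comm₀ (norm_pos_iff.2 ne) hε]
    rw [div_le_iff₀ l0] at h6
    have h7 : 0 < l * ‖N‖ := by
      refine mul_pos l0 (norm_pos_iff.2 ?_); intro h; rw [h] at Nw; simp at Nw
    rw [inv_lt_iff_one_lt_mul₀ hε]
    nlinarith
  set Z2 := (x - m) / T with hZ2
  have Z20 : Z2 ≠ 0 := div_ne_zero hxm0 hT0
  have hTT' : T = - T' / q ^ 2 := by rw [hT']; field_simp
  have Z2e : Z2 = v * q / (X * T') := by rw [hZ2, hxm', hTT']; field_simp
  have Z2f : ∀ s : ℝ, 0 ≤ s → 1 + s * Z2 = (q + (v⁻¹ + s * T'⁻¹)⁻¹) * (v⁻¹ + s * T'⁻¹) * v / X := by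
    intro s hs
    have := (outV s hs).1
    rw [add_mul, inv_mul_cancel₀ this, Z2e]
    field_simp
    rw [hX]; ring
  have Z2ne : ∀ s : ℝ, 0 ≤ s → 1 + s * Z2 ≠ 0 := fun s hs => by
    rw [Z2f s hs]
    exact div_ne_zero (mul_ne_zero (mul_ne_zero (outV s hs).2.2.1 (outV s hs).1) v0) X0
  have arg2 := slit_of Z20 fun s hs => Z2ne s hs.le
  obtain ⟨r2, ⟨σ2, s2, d20⟩, ⟨σ2', s2', d21⟩⟩ := arcZ (A := m) (B := x) Z20 arg2
  have pt2 : ∀ t ∈ Ioc (0:ℝ) 1, ∃ s : ℝ, 0 ≤ s ∧ (t < 1 → 0 < s) ∧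
      arcC m x (Complex.arg Z2) t = P + 1 / (q + (v⁻¹ + s * T'⁻¹)⁻¹) := by
    intro t ht
    obtain ⟨s, hs0, hs, -, e⟩ := r2 t ht
    refine ⟨s, hs0, hs, ?_⟩
    obtain ⟨n1, -, n2, -⟩ := outV s hs0
    have e' : x - (P + 1 / (q + (v⁻¹ + s * T'⁻¹)⁻¹)) = s * Z2 * ((P + 1 / (q + (v⁻¹ + s * T'⁻¹)⁻¹)) - m) := by
      have hmm : m = P + 1 / q := by rw [← hmq]; ring
      rw [hx, Z2e]
      conv_rhs => rw [hmm]
      set V := (v⁻¹ + s * T'⁻¹)⁻¹ with hV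
      have hV0 : V ≠ 0 := inv_ne_zero n1
      have hVe : V * (T' + s * v) = v * T' := by
        have : V * (v⁻¹ + s * T'⁻¹) = 1 := by rw [hV]; exact inv_mul_cancel₀ n1
        field_simp at this
        linear_combination this
      field_simp
      rw [hX]
      linear_combination hVe
    have := Z2ne s hs0
    have : (arcC m x (Complex.arg Z2) t - (P + 1 / (q + (v⁻¹ + s * T'⁻¹)⁻¹))) * (1 + s * Z2) = 0 := by
      linear_combination e' - e
    rcases mul_eq_zero.1 this with h | h
    · exact sub_eq_zero.1 h
    · exact absurd h (Z2ne s hs0)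
  have pt3 : ∀ t ∈ Ioc (0:ℝ) 1, ∃ s : ℝ, 0 ≤ s ∧ (t < 1 → 0 < s) ∧
      arcC P x (Complex.arg Z3) t = P + 1 / (X + s * D) := by
    intro t ht
    obtain ⟨s, hs0, hs, hE, e⟩ := r3 t ht
    refine ⟨s, hs0, hs, ?_⟩
    have hxx : x - P ≠ 0 := sub_ne_zero.2 hPx.symm
    have h1 : arcC P x (Complex.arg Z3) t - P ≠ 0 := by
      unfold arcC; rw [add_sub_cancel_left]; exact mul_ne_zero hxx hE
    have h2 := inv_of_ratio h1 hxx e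
    have h3 : 1 / (x - P) * (1 + s * Z3) = X + s * D := by rw [hxP, hZ3]; field_simp
    rw [h3] at h2
    rw [← h2, one_div_one_div]; ring
  set F := arcC P x (Complex.arg Z3) with hF
  set G := arcC m x (Complex.arg Z2) with hG
  have F1 : F 1 = x := arcC_one _ _ arg3
  have G1 : G 1 = x := arcC_one _ _ arg2
  have F0 : F 0 = P := arcC_zero _ _ _
  have G0 : G 0 = m := arcC_zero _ _ _
  have FG : F 1 = G 1 := F1.trans G1.symm
  have ballF : ∀ t ∈ Icc (0:ℝ) 1, ‖F t - c‖ < r := by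
    intro t ht
    rcases ht.1.eq_or_lt with rfl | h
    · rw [F0]; exact hP
    · obtain ⟨s, hs0, -, e⟩ := pt3 t ⟨h, ht.2⟩
      rw [e]; exact (outX s hs0).2
  have ballG : ∀ t ∈ Ioc (0:ℝ) 1, ‖G t - c‖ < r := by
    intro t ht
    obtain ⟨s, hs0, -, e⟩ := pt2 t ht
    rw [e]; exact (outV s hs0).2.2.2
  have nearF : ∀ t ∈ Ioc (0:ℝ) 1, F t ≠ P ∧ ∃ s : ℝ, 0 ≤ s ∧ ‖1 / (F t - P) - (q + s * D)‖ < ε := by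
    intro t ht
    obtain ⟨s, hs0, -, e⟩ := pt3 t ht
    have hn := (outX s hs0).1
    have e2 : F t - P = 1 / (X + s * D) := by rw [e, add_sub_cancel_left]
    refine ⟨fun h => one_div_ne_zero hn (by rw [← e2, h, sub_self]), s, hs0, ?_⟩
    rw [e2, one_div_one_div, hX, show q + v + s * D - (q + s * D) = v by ring, hv, norm_mul, Complex.norm_real, Real.norm_of_nonneg l0.le]
    exact hl1
  have nearG : ∀ t ∈ Icc (0:ℝ) 1, G t ≠ P ∧ ∃ s : ℝ, 0 ≤ s ∧ ‖1 / (G t - P) - (q + s * D)‖ < ε := by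
    intro t ht
    rcases ht.1.eq_or_lt with rfl | h
    · rw [G0]
      exact ⟨fun h => hmP (by rw [h, sub_self]), 0, le_rfl, by rw [← hq]; simpa using hε⟩
    · obtain ⟨s, hs0, -, e⟩ := pt2 t ⟨h, ht.2⟩
      obtain ⟨n1, n2, n3, n4⟩ := outV s hs0
      have e2 : G t - P = 1 / (q + (v⁻¹ + s * T'⁻¹)⁻¹) := by rw [e, add_sub_cancel_left]
      refine ⟨fun h => one_div_ne_zero n3 (by rw [← e2, h, sub_self]), 0, le_rfl, ?_⟩
      rw [e2, one_div_one_div]; simpa using n2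
  have disj : ∀ s ∈ Icc (0:ℝ) 1, ∀ t ∈ Icc (0:ℝ) 1, F s = G t → s = 1 ∧ t = 1 := by
    intro a ha b hb hab
    rcases ha.2.eq_or_lt with rfl | ha1
    · exact ⟨rfl, arcC_inj hmx arg2 hb ⟨zero_le_one, le_rfl⟩ (by rw [← hG, ← hab, F1, G1])⟩
    rcases hb.2.eq_or_lt with rfl | hb1
    · exact ⟨arcC_inj hPx arg3 ha ⟨zero_le_one, le_rfl⟩ (by rw [← hF, hab, F1, G1]), rfl⟩
    exfalso
    rcases ha.1.eq_or_lt with rfl | ha0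
    · exact (nearG b hb).1 (by rw [← hab, F0])
    rcases hb.1.eq_or_lt with rfl | hb0
    · have := ballF a ha
      rw [hab, G0, hm] at this; exact lt_irrefl _ this
    obtain ⟨s, hs0, hs, e⟩ := pt3 a ⟨ha0, ha.2⟩
    obtain ⟨s', hs0', hs', e'⟩ := pt2 b ⟨hb0, hb.2⟩
    have sp := hs ha1
    have sp' := hs' hb1
    rw [e, e', add_right_inj, one_div, one_div, inv_inj, hX, add_assoc, add_right_inj] at hab
    have n1 := (outV s' hs0').1
    have h1 : (v + s * D) * (v⁻¹ + s' * T'⁻¹) = 1 := by rw [hab]; exact inv_mul_cancel₀ n1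
    have h2 : ((s / (l * Complex.normSq w) + s' * l / k : ℝ) : ℂ) + ((s * s' / k : ℝ) : ℂ) * (D * w⁻¹) = 0 := by
      have hnw : (Complex.normSq w : ℂ) ≠ 0 := by exact_mod_cast (Complex.normSq_pos.2 w0).ne'
      have h3 : s * D / (l * w) + s' * (l * w) / (k * τ) + s * s' * D / (k * τ) = 0 := by
        rw [hTτ, hv] at h1
        have : (l * w + s * D) * ((l * w)⁻¹ + s' * (k * τ)⁻¹) = 1 + (s * D / (l * w) + s' * (l * w) / (k * τ) + s * s' * D / (k * τ)) := by
          field_simp; ring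
        rw [this] at h1
        linear_combination h1
      have h4 : (s * D / (l * w) + s' * (l * w) / (k * τ) + s * s' * D / (k * τ)) * (τ / w) = 0 := by rw [h3, zero_mul]
      have h5 : D * τ / (w * w) = 1 / Complex.normSq w := by rw [wsq]; field_simp
      rw [← h4]
      push_cast
      have : s * D / (l * w) * (τ / w) = s / l * (D * τ / (w * w)) := by field_simp
      rw [add_mul, add_mul, this, h5]
      field_simp
    have h6 := congrArg Complex.re h2
    rw [Complex.add_re, Complex.ofReal_re, Complex.re_ofReal_mul, Complex.zero_re] at h6
    have := Complex.normSq_pos.2 w0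
    have : 0 < s / (l * Complex.normSq w) + s' * l / k := by positivity
    have : 0 < (s * s' / k) * (D * w⁻¹).re := by positivity
    linarith
  -- choose the breakpoint
  have e31 : arcC' P x (Complex.arg Z3) 1 = σ3' * (D / X ^ 2) := by rw [d31, hxP, hZ3]; field_simp
  set B := σ2' * (l ^ 2 * Complex.normSq w / k) with hB
  have B0 : 0 < B := by have := Complex.normSq_pos.2 w0; positivity
  have e21 : arcC' m x (Complex.arg Z2) 1 = - (B * (D / X ^ 2)) := by
    rw [d21, hxm', Z2e, hB, hTτ, hv]
    push_cast
    have : w * w = Complex.normSq w * (D * τ) := wsq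
    field_simp
    linear_combination (-(σ2' : ℂ)) * this
  have sum0 : 0 < σ3' + B := by linarith
  set b := σ3' / (σ3' + B) with hb
  have hb1 : 1 - b = B / (σ3' + B) := by rw [hb]; field_simp; ring
  have hbm : b ∈ Ioo (0:ℝ) 1 := ⟨by positivity, by have : 0 < 1 - b := by rw [hb1]; positivity
                                                   linarith⟩
  have hreg := join_reg hbm (arcC_reg hPx arg3) (arcC_reg hmx arg2) FG (by
    rw [e31, e21, hb1, hb]
    have a1 : (σ3' : ℂ) ≠ 0 := by exact_mod_cast s3'.ne'
    have a2 : (B : ℂ) ≠ 0 := by exact_mod_cast B0.ne'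
    have a3 : (σ3' : ℂ) + B ≠ 0 := by exact_mod_cast sum0.ne'
    push_cast
    field_simp)
  have bc : (b : ℂ) ≠ 0 := by exact_mod_cast hbm.1.ne'
  have h1b : 0 < 1 - b := by linarith [hbm.2]
  refine ⟨join b F G, join' b (arcC' P x (Complex.arg Z3)) (arcC' m x (Complex.arg Z2)),
    ⟨hreg, join_inj hbm (arcC_inj hPx arg3) (arcC_inj hmx arg2) FG disj, ?_, ?_,
      join_polyArc hbm FG (arcC_polyArc hPx arg3) (arcC_polyArc hmx arg2), ?_, ?_, ?_⟩, ?_⟩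
  · rw [join_zero hbm, F0]
  · rw [join_one hbm FG, G0]
  · refine ⟨σ3 / b, div_pos s3 hbm.1, ?_⟩
    rw [join'_zero hbm, d30, hxP, hZ3, cD]; push_cast; field_simp
  · intro t ht
    rcases le_total t b with h | h
    · rw [join_left hbm h]; exact ballF _ (map_left hbm ⟨ht.1, h⟩)
    · rw [join_right hbm FG h]
      refine ballG _ ⟨div_pos (by linarith [ht.2]) h1b, (map_right hbm ⟨h, ht.2.le⟩).2⟩
  · intro t ht
    rcases le_total t b with h | h
    · rw [join_left hbm h]; exact nearF _ ⟨div_pos ht.1 hbm.1, (map_left hbm ⟨ht.1.le, h⟩).2⟩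
    · rw [join_right hbm FG h]
      exact nearG _ (map_right hbm ⟨h, ht.2⟩)
  · refine ⟨σ2 / (1 - b), by positivity, ?_⟩
    rw [join'_one hbm, d20, hZ2]
    push_cast; field_simp

end

section
theorem assemble {V : Type*} {G : SimpleGraph V} {c P : V → ℂ} {r ε : V → ℝ} {m D : V → V → ℂ} {k : V → V → ℕ}
    {h h' : V → V → ℝ → ℂ} {b : V → V → ℝ} {K : ℕ}
    (hdisj : ∀ i j, i ≠ j → r i + r j ≤ dist (c i) (c j))
    (hmout : ∀ u v w, G.Adj u v → ‖m u v - c w‖ ≤ r w → w = u ∨ w = v)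
    (hmn : ∀ u v, G.Adj u v → ‖m u v - c u‖ = r u)
    (hms : ∀ u v, G.Adj u v → m v u = m u v)
    (hP : ∀ u, ‖P u - c u‖ < r u)
    (hsep : ∀ u v v', G.Adj u v → G.Adj u v' → v ≠ v' → ∀ s t : ℝ, 0 ≤ s → 0 ≤ t →
      2 * ε u ≤ ‖(1 / (m u v - P u) + s * D u v) - (1 / (m u v' - P u) + t * D u v')‖)
    (hH : ∀ u v, G.Adj u v → Half (P u) (m u v) (c u) (D u v) (r u) (ε u) (k u v) (h u v) (h' u v))
    (hb : ∀ u v, G.Adj u v → b u v ∈ Ioo (0:ℝ) 1) (hbs : ∀ u v, G.Adj u v → b v u = 1 - b u v)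
    (hK : ∀ u v, G.Adj u v → k u v + k v u ≤ K)
    (hang : ∀ u, ∃ (θ : ℝ) (e : {v // G.Adj u v} ≃ Fin (Nat.card {v // G.Adj u v})), ∀ (v : V) (a : G.Adj u v),
      D u v ≠ 0 ∧ dirAngle ((starRingEnd ℂ) (D u v)) = ((θ + 2 * Real.pi * ((e ⟨v, a⟩ : Fin _) : ℕ) /
            (Nat.card {v // G.Adj u v}) : ℝ) : Real.Angle)) :
    ∃ Dr : GraphDrawing V G, Dr.NonCrossing ∧ Dr.KArc K ∧ Dr.PerfectRes ∧
      ∀ (u v : V) (a : G.Adj u v), Dr.curve a = join (b u v) (h u v) (h v u) := by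
  have dis : ∀ u w (x : ℂ), ‖x - c u‖ < r u → ‖x - c w‖ ≤ r w → u = w := by
    intro u w x h1 h2
    by_contra hne
    have := hdisj u w hne
    have h3 := dist_triangle_left (c u) (c w) x
    rw [dist_eq_norm x, dist_eq_norm x] at h3
    linarith
  have mem : ∀ u v (x : ℂ), G.Adj u v → x ∈ h u v '' Icc 0 1 → (‖x - c u‖ < r u ∨ x = m u v) ∧ ‖x - c u‖ ≤ r u := by
    rintro u v x a ⟨t, ht, rfl⟩
    rcases ht.2.eq_or_lt with rfl | h1
    · rw [(hH u v a).h1]; exact ⟨Or.inr rfl, (hmn u v a).le⟩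
    · have := (hH u v a).ball t ⟨ht.1, h1⟩
      exact ⟨Or.inl this, this.le⟩
  have meet : ∀ u v u' v' (x : ℂ), G.Adj u v → G.Adj u' v' → x ∈ h u v '' Icc 0 1 → x ∈ h u' v' '' Icc 0 1 →
      (u = u' ∧ (v = v' ∨ x = P u)) ∨ (u' = v ∧ v' = u ∧ x = m u v) := by
    intro u v u' v' x a a' hx hx'
    by_cases hu : u = u'
    · subst hu
      refine Or.inl ⟨rfl, ?_⟩
      by_contra! hc
      obtain ⟨hvv, hxP⟩ := hc
      have near : ∀ w, G.Adj u w → x ∈ h u w '' Icc 0 1 →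
          ∃ s : ℝ, 0 ≤ s ∧ ‖1 / (x - P u) - (1 / (m u w - P u) + s * D u w)‖ < ε u := by
        rintro w aw ⟨t, ht, rfl⟩
        refine ((hH u w aw).near t ⟨lt_of_le_of_ne ht.1 ?_, ht.2⟩).2
        rintro rfl; exact hxP (hH u w aw).h0
      obtain ⟨s, hs, e1⟩ := near v a hx
      obtain ⟨s', hs', e2⟩ := near v' a' hx'
      have e3 := hsep u v v' a a' hvv s s' hs hs'
      have e4 := dist_triangle_left (1 / (m u v - P u) + s * D u v) (1 / (m u v' - P u) + s' * D u v') (1 / (x - P u))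
      rw [dist_eq_norm, dist_eq_norm, dist_eq_norm] at e4
      linarith
    · right
      have m1 := mem u v x a hx
      have m2 := mem u' v' x a' hx'
      have x1 : x = m u v := m1.1.resolve_left fun h => hu (dis _ _ _ h m2.2)
      have x2 : x = m u' v' := m2.1.resolve_left fun h => hu (dis _ _ _ h m1.2).symm
      refine ⟨(hmout u v u' a (x1 ▸ m2.2)).resolve_left (Ne.symm hu), ?_, x1⟩
      exact ((hmout u' v' u a' (x2 ▸ m1.2)).resolve_left hu).symm
  have FG : ∀ u v, G.Adj u v → h u v 1 = h v u 1 := fun u v a => by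
    rw [(hH u v a).h1, (hH v u a.symm).h1, hms u v a]
  have img : ∀ u v, G.Adj u v → join (b u v) (h u v) (h v u) '' Icc 0 1 = h u v '' Icc 0 1 ∪ h v u '' Icc 0 1 :=
    fun u v a => join_image (hb u v a) (FG u v a)
  have hc : ∀ u v, G.Adj u v → ContinuousOn (h u v) (Icc 0 1) := fun u v a t ht =>
    ((hH u v a).reg.1 t ht).continuousWithinAt
  let Dr : GraphDrawing V G :=
    { pos := P
      inj := fun u v e => dis u v (P u) (hP u) (by rw [e]; exact (hP v).le)
      curve := fun u v _ => join (b u v) (h u v) (h v u)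
      cont := fun u v a => join_cont (hb u v a) (hc u v a) (hc v u a.symm) (FG u v a)
      source_eq := fun u v a => by rw [join_zero (hb u v a), (hH u v a).h0]
      target_eq := fun u v a => by rw [join_one (hb u v a) (FG u v a), (hH v u a.symm).h0]
      symm := fun u v a t => by rw [hbs u v a, join_symm (hb u v a) (FG u v a)]
      simple := fun u v a => join_inj (hb u v a) (hH u v a).inj (hH v u a.symm).inj (FG u v a) (by
        intro s hs t ht e
        have key : ∀ x y s, G.Adj x y → s ∈ Icc (0:ℝ) 1 → h x y s = m x y → s = 1 := by
          intro x y s a hs e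
          by_contra hne
          have := (hH x y a).ball s ⟨hs.1, lt_of_le_of_ne hs.2 hne⟩
          rw [e, hmn x y a] at this; exact lt_irrefl _ this
        rcases meet u v v u (h u v s) a a.symm ⟨s, hs, rfl⟩ ⟨t, ht, e.symm⟩ with h1 | h1
        · exact absurd h1.1 a.ne
        · exact ⟨key u v s a hs h1.2.2, key v u t a.symm ht (by rw [← e, h1.2.2, hms u v a])⟩)
      vertexFree := by
        intro u v a w hw
        rw [img u v a] at hw
        rcases hw with hw | hw
        · exact Or.inl (dis _ _ _ (hP w) (mem u v _ a hw).2)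
        · exact Or.inr (dis _ _ _ (hP w) (mem v u _ a.symm hw).2) }
  refine ⟨Dr, ?_, ?_, ?_, fun u v a => rfl⟩
  · intro u v u' v' a a' hne x hx
    have hx1 : x ∈ h u v '' Icc 0 1 ∪ h v u '' Icc 0 1 := by rw [← img u v a]; exact hx.1
    have hx2 : x ∈ h u' v' '' Icc 0 1 ∪ h v' u' '' Icc 0 1 := by rw [← img u' v' a']; exact hx.2
    have key : ∀ u v u' v', G.Adj u v → G.Adj u' v' → s(u, v) ≠ s(u', v') → x ∈ h u v '' Icc 0 1 →
        x ∈ h u' v' '' Icc 0 1 → x = P u ∧ x = P u' := by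
      intro u v u' v' a a' hne hx hx'
      rcases meet u v u' v' x a a' hx hx' with ⟨rfl, rfl | h2⟩ | ⟨rfl, rfl, _⟩
      · exact absurd rfl hne
      · exact ⟨h2, h2⟩
      · exact absurd Sym2.eq_swap hne
    change x ∈ ({P u, P v} ∩ {P u', P v'} : Set ℂ)
    rcases hx1 with hx1 | hx1 <;> rcases hx2 with hx2 | hx2
    · obtain ⟨e1, e2⟩ := key u v u' v' a a' hne hx1 hx2
      exact ⟨Or.inl e1, Or.inl e2⟩
    · obtain ⟨e1, e2⟩ := key u v v' u' a a'.symm (by rwa [Sym2.eq_swap (a := v')]) hx1 hx2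
      exact ⟨Or.inl e1, Or.inr e2⟩
    · obtain ⟨e1, e2⟩ := key v u u' v' a.symm a' (by rwa [Sym2.eq_swap (a := v)]) hx1 hx2
      exact ⟨Or.inr e1, Or.inl e2⟩
    · obtain ⟨e1, e2⟩ := key v u v' u' a.symm a'.symm (by rwa [Sym2.eq_swap (a := v), Sym2.eq_swap (a := v')]) hx1 hx2
      exact ⟨Or.inr e1, Or.inr e2⟩
  · intro u v a
    exact (join_polyArc (hb u v a) (FG u v a) (hH u v a).poly (hH v u a.symm).poly).mono (hK u v a)
  · intro u
    obtain ⟨θ, e, he⟩ := hang u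
    refine ⟨θ, e, fun v a => ?_⟩
    obtain ⟨l, hl, hd⟩ := (hH u v a).d0
    have hpos : 0 < l / b u v := div_pos hl (hb u v a).1
    have e1 : h' u v 0 / (b u v : ℂ) = ((l / b u v : ℝ) : ℂ) * (starRingEnd ℂ) (D u v) := by rw [hd]; push_cast; ring
    refine ⟨_, ?_, join_deriv_zero (hb u v a) (hH u v a).reg, ?_⟩
    · rw [e1]
      exact mul_ne_zero (by exact_mod_cast hpos.ne') ((map_ne_zero _).2 (he v a).1)
    · rw [← (he v a).2, e1, dirAngle, Complex.arg_real_mul _ hpos]; rfl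

/-- Data at a single vertex. -/
theorem vertex_data {V : Type*} [Fintype V] (G : SimpleGraph V) (u : V) (c : ℂ) {r : ℝ} (hr : 0 < r) (m : V → ℂ)
    (hinj : ∀ v v', G.Adj u v → G.Adj u v' → m v = m v' → v = v') (hm : ∀ v, G.Adj u v → ‖m v - c‖ = r) :
    ∃ (P : ℂ) (D : V → ℂ) (ε : ℝ), ‖P - c‖ < r ∧ 0 < ε ∧
      (∀ v, G.Adj u v → ‖D v‖ = 1) ∧
      (∀ v, G.Adj u v → 0 < (D v * (starRingEnd ℂ) ((1 / (m v - P)) ^ 2 * (m v - c))).re) ∧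
      (∀ v v', G.Adj u v → G.Adj u v' → v ≠ v' → ∀ s t : ℝ, 0 ≤ s → 0 ≤ t →
        2 * ε ≤ ‖(1 / (m v - P) + s * D v) - (1 / (m v' - P) + t * D v')‖) ∧
      ∃ (θ : ℝ) (e : {v // G.Adj u v} ≃ Fin (Nat.card {v // G.Adj u v})), ∀ (v : V) (a : G.Adj u v),
      D v ≠ 0 ∧ dirAngle ((starRingEnd ℂ) (D v)) = ((θ + 2 * Real.pi * ((e ⟨v, a⟩ : Fin _) : ℕ) /
            (Nat.card {v // G.Adj u v}) : ℝ) : Real.Angle) := by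
  classical
  obtain ⟨P, D, θ, e, ε, hP, hε, hD, hpos, hsep⟩ := L1 (ι := {v // G.Adj u v}) c hr (fun v => m v)
    (fun v v' h => Subtype.ext (hinj v v' v.2 v'.2 h)) (fun v => hm v v.2)
  let D' : V → ℂ := fun v => if a : G.Adj u v then D ⟨v, a⟩ else 0
  have hD' : ∀ v (a : G.Adj u v), D' v = D ⟨v, a⟩ := fun v a => dif_pos a
  have n1 : ∀ v, G.Adj u v → ‖D' v‖ = 1 := fun v a => by rw [hD' v a, hD, Complex.norm_exp_ofReal_mul_I]
  refine ⟨P, D', ε, hP, hε, n1, fun v a => by rw [hD' v a]; exact hpos ⟨v, a⟩, ?_, ?_⟩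
  · intro v v' a a' hne s t hs ht
    rw [hD' v a, hD' v' a']
    exact hsep ⟨v, a⟩ ⟨v', a'⟩ (fun h => hne (congrArg Subtype.val h)) s t hs ht
  · have hcard : Fintype.card {v // G.Adj u v} = Nat.card {v // G.Adj u v} := Nat.card_eq_fintype_card.symm
    rw [← hcard]
    refine ⟨-θ - 2 * Real.pi * ((Fintype.card {v // G.Adj u v}) - 1) / (Fintype.card {v // G.Adj u v}), e.trans Fin.revPerm, fun v a => ⟨fun h0 => ?_, ?_⟩⟩
    · have := n1 v a; rw [h0, norm_zero] at this; exact zero_ne_one this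
    have hlt : (e ⟨v, a⟩ : ℕ) < (Fintype.card {v // G.Adj u v}) := (e ⟨v, a⟩).2
    have hn0 : ((Fintype.card {v // G.Adj u v}) : ℝ) ≠ 0 := by
      have : 0 < (Fintype.card {v // G.Adj u v}) := by omega
      exact_mod_cast this.ne'
    rw [hD' v a, hD, ← Complex.exp_conj, dirAngle, map_mul, Complex.conj_ofReal, Complex.conj_I, mul_neg, ← neg_mul,
      ← Complex.ofReal_neg, Complex.arg_exp_mul_I, Real.Angle.coe_toIocMod]
    congr 1
    have : (((e.trans Fin.revPerm) ⟨v, a⟩ : Fin (Fintype.card {v // G.Adj u v})) : ℕ) + ((e ⟨v, a⟩ : ℕ) + 1) = (Fintype.card {v // G.Adj u v}) := by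
      simp [Fin.val_rev]
    have h2 : ((((e.trans Fin.revPerm) ⟨v, a⟩ : Fin (Fintype.card {v // G.Adj u v})) : ℕ) : ℝ) = (Fintype.card {v // G.Adj u v}) - 1 - (e ⟨v, a⟩ : ℕ) := by
      have : ((((e.trans Fin.revPerm) ⟨v, a⟩ : Fin (Fintype.card {v // G.Adj u v})) : ℕ) : ℝ) + ((e ⟨v, a⟩ : ℕ) + 1) = (Fintype.card {v // G.Adj u v}) := by exact_mod_cast this
      linarith
    rw [h2]
    field_simp
    ring

end

section
/-- The contact point of two tangent disks. -/
def mc {V : Type*} (c : V → ℂ) (r : V → ℝ) (u v : V) : ℂ := (r v * c u + r u * c v) / (r u + r v)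

section
variable {V : Type*} {G : SimpleGraph V} {c : V → ℂ} {r : V → ℝ}

theorem mc_symm (u v : V) : mc c r v u = mc c r u v := by
  unfold mc; rw [add_comm, add_comm (r v : ℂ)]

theorem mc_rel (hr : ∀ i, 0 < r i) (u v : V) :
    (r u : ℂ) * (mc c r u v - c v) = - (r v * (mc c r u v - c u)) := by
  have h : (r u : ℂ) + r v ≠ 0 := by exact_mod_cast (add_pos (hr u) (hr v)).ne'
  unfold mc; field_simp; ring

theorem mc_norm (hr : ∀ i, 0 < r i) (ht : ∀ i j, G.Adj i j → dist (c i) (c j) = r i + r j) (u v : V) (a : G.Adj u v) :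
    ‖mc c r u v - c u‖ = r u := by
  have hs := add_pos (hr u) (hr v)
  have h : (r u : ℂ) + r v ≠ 0 := by exact_mod_cast hs.ne'
  have e : mc c r u v - c u = ((r u / (r u + r v) : ℝ) : ℂ) * (c v - c u) := by
    unfold mc; push_cast; field_simp; ring
  have := ht u v a
  rw [dist_comm, dist_eq_norm] at this
  rw [e, norm_mul, Complex.norm_real, Real.norm_of_nonneg (div_pos (hr u) hs).le, this]
  field_simp

theorem mc_out (hr : ∀ i, 0 < r i) (hdisj : ∀ i j, i ≠ j → r i + r j ≤ dist (c i) (c j))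
    (ht : ∀ i j, G.Adj i j → dist (c i) (c j) = r i + r j) (u v w : V) (a : G.Adj u v)
    (hw : ‖mc c r u v - c w‖ ≤ r w) : w = u ∨ w = v := by
  by_contra! hc
  have key : ∀ x, w ≠ x → ‖mc c r u v - c x‖ = r x →
      inner ℝ (mc c r u v - c w) (mc c r u v - c x) ≤ - (r w * r x) := by
    intro x hx hn
    have h1 := hdisj w x hx
    have h2 := norm_sub_sq_real (mc c r u v - c w) (mc c r u v - c x)
    rw [hn, sub_sub_sub_cancel_left, ← dist_eq_norm, dist_comm] at h2
    have h3 : (r w + r x) ^ 2 ≤ dist (c w) (c x) ^ 2 := by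
      have := hr w
      have := hr x
      gcongr
    have h4 : ‖mc c r u v - c w‖ ^ 2 ≤ r w ^ 2 := by gcongr
    nlinarith
  have k1 := key u hc.1 (mc_norm hr ht u v a)
  have k2 := key v hc.2 (by rw [← mc_symm]; exact mc_norm hr ht v u a.symm)
  have e : r u * inner ℝ (mc c r u v - c w) (mc c r u v - c v) = - (r v * inner ℝ (mc c r u v - c w) (mc c r u v - c u)) := by
    have := mc_rel (c := c) hr u v
    rw [← real_inner_smul_right, ← real_inner_smul_right, ← inner_neg_right, Complex.real_smul, Complex.real_smul, this]
  have := mul_pos (hr w) (mul_pos (hr u) (hr v))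
  have := mul_le_mul_of_nonneg_left k1 (hr v).le
  have := mul_le_mul_of_nonneg_left k2 (hr u).le
  nlinarith
end

theorem main_two_three {V : Type*} [Fintype V] (G : SimpleGraph V)
    (hplanar : ∃ D : GraphDrawing V G, D.NonCrossing) :
    (∃ D : GraphDrawing V G, D.NonCrossing ∧ D.KArc 2 ∧ D.PerfectRes) ∧
    (∃ D : GraphDrawing V G, D.NonCrossing ∧ D.KArc 3 ∧ D.Smooth ∧ D.PerfectRes) := by
  classical
  obtain ⟨D0, hD0⟩ := hplanar
  obtain ⟨c, r, hr, hdisj, ht⟩ := packing_of_drawing G D0 hD0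
  have hmn : ∀ u v, G.Adj u v → ‖mc c r u v - c u‖ = r u := mc_norm hr ht
  have hmout := mc_out hr hdisj ht
  have hms : ∀ u v, G.Adj u v → mc c r v u = mc c r u v := fun u v _ => mc_symm u v
  choose P D ε hP hε hD1 hpos hsep hang using fun u => vertex_data G u (c u) (hr u) (mc c r u)
    (fun v v' a a' e => by
      have := hmout u v v' a (by rw [e, ← mc_symm]; exact (hmn v' u a'.symm).le)
      rcases this with h | h
      · exact absurd h a'.ne'
      · exact h.symm) (fun v a => hmn u v a)
  have EA : ∀ u v, ∃ F F' : ℝ → ℂ, G.Adj u v →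
      Half (P u) (mc c r u v) (c u) (D u v) (r u) (ε u) 1 F F' ∧ 0 < (F' 1 * (starRingEnd ℂ) (mc c r u v - c u)).re := by
    intro u v
    by_cases a : G.Adj u v
    · obtain ⟨F, F', h⟩ := halfA (hP u) (hmn u v a) (hD1 u v a) (hε u) (hpos u v a)
      exact ⟨F, F', fun _ => h⟩
    · exact ⟨0, 0, fun h => absurd h a⟩
  choose F F' hF using EA
  have EB : ∀ u v, ∃ (H H' : ℝ → ℂ) (μ : ℝ), 0 < μ ∧ (G.Adj u v →
      Half (P v) (mc c r v u) (c v) (D v u) (r v) (ε v) 2 H H' ∧ H' 1 = -(μ * F' u v 1)) := by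
    intro u v
    by_cases a : G.Adj u v
    · have hT : (F' u v 1 * (starRingEnd ℂ) (mc c r v u - c v)).re < 0 := by
        have h1 := (hF u v a).2
        have h2 : mc c r v u - c v = ((-(r v / r u) : ℝ) : ℂ) * (mc c r u v - c u) := by
          have h3 := mc_rel (c := c) hr u v
          have h4 : (r u : ℂ) ≠ 0 := by exact_mod_cast (hr u).ne'
          rw [mc_symm]
          apply mul_left_cancel₀ h4
          rw [h3]; push_cast; field_simp
        rw [h2, map_mul, Complex.conj_ofReal, mul_left_comm, Complex.re_ofReal_mul, neg_mul]
        have := mul_pos (div_pos (hr v) (hr u)) h1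
        linarith
      obtain ⟨H, H', h, μ, hμ, e⟩ := halfB (hP v) (hmn v u a.symm) (hD1 v u a.symm) (hε v) (hpos v u a.symm) hT
      exact ⟨H, H', μ, hμ, fun _ => ⟨h, e⟩⟩
    · exact ⟨0, 0, 1, one_pos, fun h => absurd h a⟩
  choose H H' μ hμ hH using EB
  constructor
  · obtain ⟨Dr, h1, h2, h3, _⟩ := assemble (K := 2) (k := fun _ _ => 1) (b := fun _ _ => 1 / 2) (h := F) (h' := F')
      hdisj hmout hmn hms hP hsep (fun u v a => (hF u v a).1) (fun _ _ _ => by norm_num) (fun _ _ _ => by norm_num)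
      (fun _ _ _ => le_rfl) hang
    exact ⟨Dr, h1, h2, h3⟩
  · let o := Fintype.equivFin V
    have tri : ∀ u v, G.Adj u v → (o u < o v ∧ ¬ o v < o u) ∨ (o v < o u ∧ ¬ o u < o v) := by
      intro u v a
      rcases lt_trichotomy (o u) (o v) with h | h | h
      · exact Or.inl ⟨h, h.asymm⟩
      · exact absurd (o.injective h) a.ne
      · exact Or.inr ⟨h, h.asymm⟩
    let h : V → V → ℝ → ℂ := fun u v => if o u < o v then F u v else H v u
    let h' : V → V → ℝ → ℂ := fun u v => if o u < o v then F' u v else H' v u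
    let k : V → V → ℕ := fun u v => if o u < o v then 1 else 2
    let b : V → V → ℝ := fun u v => if o u < o v then 1 / (1 + μ u v) else μ v u / (1 + μ v u)
    have hh : ∀ u v, G.Adj u v → Half (P u) (mc c r u v) (c u) (D u v) (r u) (ε u) (k u v) (h u v) (h' u v) := by
      intro u v a
      rcases tri u v a with ⟨t, t'⟩ | ⟨t, t'⟩
      · simp only [h, h', k, if_pos t]; exact (hF u v a).1
      · simp only [h, h', k, if_neg t']; exact (hH v u a.symm).1
    have hb : ∀ u v, G.Adj u v → b u v ∈ Ioo (0:ℝ) 1 := by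
      intro u v a
      have p1 := hμ u v
      have p2 := hμ v u
      rcases tri u v a with ⟨t, t'⟩ | ⟨t, t'⟩
      · simp only [b, if_pos t]; exact ⟨by positivity, by rw [div_lt_one (by positivity)]; linarith⟩
      · simp only [b, if_neg t']; exact ⟨by positivity, by rw [div_lt_one (by positivity)]; linarith⟩
    have hbs : ∀ u v, G.Adj u v → b v u = 1 - b u v := by
      intro u v a
      have p1 := hμ u v
      have p2 := hμ v u
      rcases tri u v a with ⟨t, t'⟩ | ⟨t, t'⟩
      · simp only [b, if_pos t, if_neg t']; field_simp; ring
      · simp only [b, if_pos t, if_neg t']; field_simp; ring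
    obtain ⟨Dr, h1, h2, h3, h4⟩ := assemble (K := 3) hdisj hmout hmn hms hP hsep hh hb hbs (by
      intro u v a
      rcases tri u v a with ⟨t, t'⟩ | ⟨t, t'⟩
      · simp only [k, if_pos t, if_neg t']; norm_num
      · simp only [k, if_pos t, if_neg t']; norm_num) hang
    refine ⟨Dr, h1, h2, ?_, h3⟩
    intro u v a
    rw [h4 u v a]
    refine (join_reg (hb u v a) (hh u v a).reg (hh v u a.symm).reg ?_ ?_).smooth
    · rw [(hh u v a).h1, (hh v u a.symm).h1, hms u v a]
    · have p1 := hμ u v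
      have p2 := hμ v u
      have q1 : (μ u v : ℂ) ≠ 0 := by exact_mod_cast p1.ne'
      have q2 : (μ v u : ℂ) ≠ 0 := by exact_mod_cast p2.ne'
      have q3 : (1 : ℂ) + μ u v ≠ 0 := by exact_mod_cast (by positivity : 0 < 1 + μ u v).ne'
      have q4 : (1 : ℂ) + μ v u ≠ 0 := by exact_mod_cast (by positivity : 0 < 1 + μ v u).ne'
      rw [← hbs u v a]
      rcases tri u v a with ⟨t, t'⟩ | ⟨t, t'⟩
      · simp only [b, h', if_pos t, if_neg t']
        rw [(hH u v a).2]; push_cast; field_simp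
      · simp only [b, h', if_pos t, if_neg t']
        rw [(hH v u a.symm).2]; push_cast; field_simp

end

/-- Every planar graph has a planar (possibly non-smooth, i.e. pointed)
2-Lombardi drawing, and consequently every planar graph has a planar smooth
3-Lombardi drawing. -/
theorem planar_pointed_two_and_smooth_three_lombardi
    {V : Type*} [Fintype V] (G : SimpleGraph V)
    (hplanar : ∃ D : GraphDrawing V G, D.NonCrossing) :
    (∃ D : GraphDrawing V G, D.NonCrossing ∧ D.KArc 2 ∧ D.PerfectRes) ∧
    (∃ D : GraphDrawing V G, D.NonCrossing ∧ D.KArc 3 ∧ D.Smooth ∧ D.PerfectRes) := by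
  exact main_two_three G hplanar
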